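/- Quasi-diffusive bounds on the two-point function: there exists β̄ ≥ 1 such that for every β ≥ β̄ and every α with 1/ln β ≤ α < 1/2 there are constants K, K' > 0 (independent of f, L, ε and x) with the following property. For every L ≥ 2 and ε > 0 with ε · L^{3−α} ≥ 1, every nonnegative function f : Λ → [0,∞) and every fixed site x ∈ Λ, one has (1/K') [f̃; G₀ f̃] ≤ Σ_{i,j∈Λ} C_{ij} f(i) f(j) ≤ K [f; G̃₀ f], where C_{ij} = ⟨e^{t_i+t_j} (D_{β,ε}(t)^{-1})_{ij}⟩, f̃(j) = (1 + |j − x|^α)^{-1} f(j), G₀ = (−βΔ + ε)^{-1} and G̃₀ = (−βΔ + ε/2)^{-1}, Δ being the graph Laplacian of the torus, and [u; G v] = Σ_{i,j} u(i) G(i,j) v(j). -/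

import Mathlib

open scoped BigOperators Classical
open MeasureTheory

noncomputable section

/-- The 3-dimensional discrete torus of side `L`. -/
abbrev Torus (L : ℕ) := Fin 3 → ZMod L

/-- The unit vector in direction `i`. -/
def unitVec (L : ℕ) (i : Fin 3) : Torus L := fun j => if j = i then 1 else 0

/-- Nearest-neighbor relation on the torus. -/
def NN {L : ℕ} (x y : Torus L) : Prop :=
  x ≠ y ∧ ∃ i : Fin 3, y = x + unitVec L i ∨ y = x - unitVec L i

/-- Periodic (Euclidean) distance on the torus. -/
def torusDist {L : ℕ} (x y : Torus L) : ℝ :=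
  Real.sqrt (∑ i : Fin 3, (min ((x i - y i).val) (L - (x i - y i).val) : ℝ) ^ 2)

variable {L : ℕ}

/-- Sum of a (symmetric) function over unordered nearest-neighbor pairs. -/
def nnSum [NeZero L] (f : Torus L → Torus L → ℝ) : ℝ :=
  (1 / 2) * ∑ x : Torus L, ∑ y : Torus L, if NN x y then f x y else 0

/-- The matrix of the operator `D_{β,ε}(t)`, the symmetric operator on `ℝ^Λ` with
quadratic form `β ∑_{NN (ij)} e^{t_i+t_j}(v_i-v_j)² + ε ∑_k e^{t_k} v_k²`. -/
def Dmat [NeZero L] (β ε : ℝ) (t : Torus L → ℝ) : Matrix (Torus L) (Torus L) ℝ :=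
  Matrix.of fun j k =>
    if j = k then
      β * (∑ i : Torus L, if NN i j then Real.exp (t i + t j) else 0) + ε * Real.exp (t j)
    else if NN j k then -(β * Real.exp (t j + t k)) else 0

/-- The free energy (effective action) `F_{β,ε}(t)`. -/
def freeEnergy [NeZero L] (β ε : ℝ) (t : Torus L → ℝ) : ℝ :=
  β * nnSum (fun i j => Real.cosh (t i - t j) - 1)
    - (1 / 2) * Real.log (Dmat β ε t).det
    + ∑ k : Torus L, (t k - ε + ε * Real.cosh (t k))

/-- The expectation `⟨f⟩ = ∫ f(t) e^{-F_{β,ε}(t)} ∏ dt_k/√(2π)`. -/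
def expect [NeZero L] (β ε : ℝ) (f : (Torus L → ℝ) → ℝ) : ℝ :=
  ∫ t : Torus L → ℝ,
    f t * Real.exp (-(freeEnergy β ε t)) *
      ((Real.sqrt (2 * Real.pi))⁻¹) ^ (Fintype.card (Torus L))

/-- The graph Laplacian of the torus: `(Δv)_j = ∑_{i ∼ j} (v_i - v_j)`. -/
def lap (L : ℕ) [NeZero L] : Matrix (Torus L) (Torus L) ℝ :=
  Matrix.of fun j k =>
    if j = k then -(∑ i : Torus L, if NN i j then (1 : ℝ) else 0)
    else if NN j k then 1 else 0

/-- `[u ; G v] = ∑_{a,b} u_a G_{ab} v_b`. -/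
def qform [NeZero L] (G : Matrix (Torus L) (Torus L) ℝ) (u v : Torus L → ℝ) : ℝ :=
  ∑ a : Torus L, ∑ b : Torus L, u a * G a b * v b

/-- The two-point correlation `C_{ij} = ⟨e^{t_i+t_j} (D_{β,ε}(t)⁻¹)_{ij}⟩`. -/
def corr [NeZero L] (β ε : ℝ) (i j : Torus L) : ℝ :=
  expect β ε (fun t => Real.exp (t i + t j) * (Dmat β ε t)⁻¹ i j)

namespace QD

/-! ### Part A: one-dimensional integrals -/

lemma cosh_lower (u : ℝ) : 1 + u ^ 2 / 2 ≤ Real.cosh u := by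
  have h := Real.cosh_two_mul (u / 2)
  have h2 := Real.cosh_sq (u / 2)
  have h3 : (u/2)^2 ≤ Real.sinh (u / 2) ^ 2 := by
    rw [sq_le_sq, Real.abs_sinh]
    exact Real.self_le_sinh_iff.2 (abs_nonneg _)
  have : 2 * (u/2) = u := by ring
  rw [this] at h
  nlinarith

/-- modified Bessel integrand -/
def bint (a e u : ℝ) : ℝ := Real.exp (a * u - e * Real.cosh u)

lemma bint_integrable (a : ℝ) {e : ℝ} (he : 0 < e) : Integrable (bint a e) := by
  have h1 : Integrable (fun u : ℝ => Real.exp (a ^ 2 / e) * Real.exp (-(e/4) * u ^ 2)) :=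
    (integrable_exp_neg_mul_sq (by positivity)).const_mul _
  refine h1.mono' (by unfold bint; fun_prop) (Filter.Eventually.of_forall fun u => ?_)
  rw [bint, Real.norm_eq_abs, Real.abs_exp, ← Real.exp_add]
  apply Real.exp_le_exp.2
  have h2 := mul_le_mul_of_nonneg_left (cosh_lower u) he.le
  have h3 : a * u ≤ a^2/e + e/4*u^2 := by
    have : a^2/e + e/4*u^2 - a * u = (a - e*u/2)^2/e := by field_simp; ring
    have : 0 ≤ (a - e*u/2)^2/e := by positivity
    linarith
  nlinarith

def bJ (a e : ℝ) : ℝ := ∫ u, bint a e u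

lemma bJ_neg (a e : ℝ) : bJ (-a) e = bJ a e := by
  unfold bJ
  rw [← integral_neg_eq_self]
  congr 1; ext u; simp [bint]

lemma bJ_pos (a : ℝ) {e : ℝ} (he : 0 < e) : 0 < bJ a e := by
  unfold bJ
  rw [integral_pos_iff_support_of_nonneg (f := bint a e) (fun u => (Real.exp_pos _).le) (bint_integrable a he)]
  have : Function.support (bint a e) = Set.univ := by
    ext u; simp [bint, Real.exp_ne_zero]
  rw [this]; simp

lemma bJ_rec (a : ℝ) {e : ℝ} (he : 0 < e) :
    bJ (a + 1) e = bJ (a - 1) e + (2 * a / e) * bJ a e := by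
  have hd : ∀ u, HasDerivAt (bint a e) (a * bint a e u - (e/2) * bint (a+1) e u + (e/2) * bint (a-1) e u) u := by
    intro u
    have h : HasDerivAt (fun u => a * u - e * Real.cosh u) (a * 1 - e * Real.sinh u) u :=
      ((hasDerivAt_id u).const_mul a).sub ((Real.hasDerivAt_cosh u).const_mul e)
    have h2 := h.exp
    refine h2.congr_deriv ?_
    have e1 : bint (a+1) e u = Real.exp (a * u - e * Real.cosh u) * Real.exp u := by
      rw [bint, ← Real.exp_add]; ring_nf
    have e2 : bint (a-1) e u = Real.exp (a * u - e * Real.cosh u) * Real.exp (-u) := by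
      rw [bint, ← Real.exp_add]; ring_nf
    rw [e1, e2, bint, Real.sinh_eq]; ring
  have i0 := bint_integrable a he
  have i1 := bint_integrable (a+1) he
  have i2 := bint_integrable (a-1) he
  have hz := integral_eq_zero_of_hasDerivAt_of_integrable hd
    (((i0.const_mul a).sub (i1.const_mul (e/2))).add (i2.const_mul (e/2))) i0
  have i3 : Integrable (fun x => a * bint a e x - e/2 * bint (a+1) e x) :=
    (i0.const_mul a).sub (i1.const_mul (e/2))
  rw [integral_add i3 (i2.const_mul (e/2)),
    integral_sub (i0.const_mul a) (i1.const_mul (e/2)), integral_const_mul, integral_const_mul,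
    integral_const_mul] at hz
  change a * bJ a e - e/2 * bJ (a+1) e + e/2 * bJ (a-1) e = 0 at hz
  field_simp
  linarith

lemma bJ_half {e : ℝ} (he : 0 < e) :
    bJ (1/2) e = Real.exp (-e) * Real.sqrt (2 * Real.pi / e) := by
  have h1 : bJ (1/2) e + bJ (-(1/2)) e = ∫ u, 2 * Real.cosh (u/2) * Real.exp (-e * Real.cosh u) := by
    unfold bJ
    rw [← integral_add (bint_integrable _ he) (bint_integrable _ he)]
    congr 1; ext u
    simp only [bint, Real.cosh_eq (u/2)]
    rw [sub_eq_add_neg, sub_eq_add_neg, Real.exp_add, Real.exp_add]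
    ring_nf
  have hd : ∀ u : ℝ, HasDerivAt (fun u => Real.sinh (u/2)) (Real.cosh (u/2) * (1/2)) u := fun u =>
    ((hasDerivAt_id u).div_const 2).sinh
  have hinj : Function.Injective (fun u : ℝ => Real.sinh (u/2)) := by
    intro a b h
    have := Real.sinh_injective h
    linarith
  have himg : Set.image (fun u : ℝ => Real.sinh (u/2)) Set.univ = Set.univ := by
    rw [Set.image_univ, Set.range_eq_univ]
    intro y
    obtain ⟨x, hx⟩ := Real.sinh_surjective y
    exact ⟨2*x, by simp [hx]⟩
  have hc := integral_image_eq_integral_abs_deriv_smul MeasurableSet.univ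
    (fun u _ => (hd u).hasDerivWithinAt) hinj.injOn (fun v : ℝ => 4 * Real.exp (-e) * Real.exp (-(2*e) * v^2))
  rw [himg] at hc
  simp only [Measure.restrict_univ] at hc
  rw [integral_const_mul, integral_gaussian] at hc
  have h2 : (∫ u, 2 * Real.cosh (u/2) * Real.exp (-e * Real.cosh u)) =
      ∫ x : ℝ, |Real.cosh (x/2) * (1/2)| • (4 * Real.exp (-e) * Real.exp (-(2*e) * Real.sinh (x/2)^2)) := by
    congr 1; ext u
    have h := Real.cosh_two_mul (u / 2)
    have h2 := Real.cosh_sq (u / 2)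
    have : 2 * (u/2) = u := by ring
    rw [this] at h
    rw [abs_of_pos (by positivity), smul_eq_mul, h, h2, mul_assoc 4, ← Real.exp_add]
    ring_nf
  rw [bJ_neg] at h1
  have hs : Real.sqrt (2 * Real.pi / e) = 2 * Real.sqrt (Real.pi / (2*e)) := by
    rw [show 2 * Real.pi / e = 2^2 * (Real.pi / (2*e)) by field_simp, Real.sqrt_mul (by positivity),
      Real.sqrt_sq (by norm_num)]
  rw [hs]
  linarith

/-- normalised density in logarithmic coordinates -/
def gd (e u : ℝ) : ℝ := Real.sqrt (e / (2 * Real.pi)) * Real.exp e * bint (-(1/2)) e u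

/-- moments -/
def Im (p e : ℝ) : ℝ := Real.sqrt (e / (2 * Real.pi)) * Real.exp e * bJ (p - 1/2) e

lemma gd_nonneg (e u : ℝ) : 0 ≤ gd e u := by unfold gd bint; positivity

lemma lint_gd (p : ℝ) {e : ℝ} (he : 0 < e) :
    ∫⁻ u, ENNReal.ofReal (gd e u) * ENNReal.ofReal (Real.exp (p * u)) = ENNReal.ofReal (Im p e) := by
  rw [Im, bJ, ← integral_const_mul, ofReal_integral_eq_lintegral_ofReal
    ((bint_integrable _ he).const_mul _)
    (Filter.Eventually.of_forall fun u => by unfold bint; positivity)]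
  congr 1; ext u
  rw [← ENNReal.ofReal_mul (gd_nonneg e u), gd, mul_assoc, bint, ← Real.exp_add, bint]
  ring_nf

lemma Im_pos (p : ℝ) {e : ℝ} (he : 0 < e) : 0 < Im p e := by
  unfold Im; have := bJ_pos (p-1/2) he; positivity

lemma Im_symm (p e : ℝ) : Im (1 - p) e = Im p e := by
  unfold Im; rw [← bJ_neg]; ring_nf

lemma Im_one {e : ℝ} (he : 0 < e) : Im 1 e = 1 := by
  unfold Im
  rw [show (1:ℝ) - 1/2 = 1/2 by norm_num, bJ_half he]
  have h : Real.sqrt (e / (2 * Real.pi)) * Real.sqrt (2 * Real.pi / e) = 1 := by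
    rw [← Real.sqrt_mul (by positivity)]
    rw [show e / (2 * Real.pi) * (2 * Real.pi / e) = 1 by field_simp]; simp
  have h2 : Real.exp e * Real.exp (-e) = 1 := by rw [← Real.exp_add]; simp
  linear_combination h + Real.sqrt (e / (2 * Real.pi)) * Real.sqrt (2 * Real.pi / e) * h2

lemma Im_zero {e : ℝ} (he : 0 < e) : Im 0 e = 1 := by
  rw [← Im_one he, ← Im_symm]; norm_num

lemma Im_rec (q : ℝ) {e : ℝ} (he : 0 < e) :
    Im (-q) e = Im (2 - q) e + ((2 * q - 1) / e) * Im (1 - q) e := by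
  unfold Im
  have h := bJ_rec (q - 1/2) he
  rw [show -q - 1/2 = -(q - 1/2 + 1) by ring, bJ_neg, h,
    show 2 - q - 1/2 = -(q - 1/2 - 1) by ring, bJ_neg,
    show 1 - q - 1/2 = -(q - 1/2) by ring, bJ_neg]
  ring

lemma Im_neg4_rec {e : ℝ} (he : 0 < e) : Im (-4) e = Im (-2) e + 7 / e * Im (-3) e := by
  rw [Im_rec 4 he]; norm_num

lemma Im_neg4_le {ε e : ℝ} (hε : 0 < ε) (he : ε ≤ e) :
    Im (-4) e ≤ (1 + 3 / ε * (1 + 1/ε)) + 7 / ε * ((1 + 1/ε) + 5 / ε * (1 + 3 / ε * (1 + 1/ε))) := by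
  have he0 : 0 < e := hε.trans_le he
  have h1 : Im (-1) e ≤ 1 + 1 / ε := by
    rw [Im_rec 1 he0]; norm_num
    rw [Im_one he0, Im_zero he0]
    have : e⁻¹ ≤ ε⁻¹ := by gcongr
    linarith
  have h2 : Im (-2) e ≤ 1 + 3 / ε * (1 + 1 / ε) := by
    rw [Im_rec 2 he0]
    norm_num only [sub_self]
    rw [Im_zero he0]
    have := Im_pos (-1) he0
    norm_num at h1 ⊢
    gcongr
  have h3 : Im (-3) e ≤ (1 + 1/ε) + 5 / ε * (1 + 3 / ε * (1 + 1/ε)) := by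
    rw [Im_rec 3 he0]
    norm_num only [sub_self]
    have := Im_pos (-2) he0
    norm_num at h1 h2 ⊢
    gcongr
  rw [Im_neg4_rec he0]
  have := Im_pos (-3) he0
  gcongr

/-- inverse-Gaussian type density -/
def rd (e s : ℝ) : ℝ := (Real.sqrt (2 * Real.pi))⁻¹ * (Real.sqrt s)⁻¹ * Real.exp (e - s/2 - e^2/(2*s))

lemma rd_link {e : ℝ} (he : 0 < e) (φ : ℝ → ENNReal) :
    ∫⁻ s in Set.Ioi 0, ENNReal.ofReal (rd e s) * φ s =
      ∫⁻ u, ENNReal.ofReal (gd e u) * φ (e * Real.exp (-u)) := by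
  have hd : ∀ u : ℝ, HasDerivAt (fun u => e * Real.exp (-u)) (e * (Real.exp (-u) * (-1))) u := fun u =>
    ((hasDerivAt_neg u).exp).const_mul e
  have hinj : Function.Injective (fun u : ℝ => e * Real.exp (-u)) := by
    intro a b h
    have := Real.exp_injective (mul_left_cancel₀ he.ne' h)
    linarith
  have himg : Set.image (fun u : ℝ => e * Real.exp (-u)) Set.univ = Set.Ioi 0 := by
    ext s
    simp only [Set.image_univ, Set.mem_range, Set.mem_Ioi]
    constructor
    · rintro ⟨u, rfl⟩; positivity
    · intro hs
      refine ⟨-Real.log (s/e), ?_⟩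
      rw [neg_neg, Real.exp_log (by positivity)]; field_simp
  rw [← himg, lintegral_image_eq_lintegral_abs_deriv_mul MeasurableSet.univ
    (fun u _ => (hd u).hasDerivWithinAt) hinj.injOn]
  rw [Measure.restrict_univ]
  congr 1; ext u
  rw [← mul_assoc, ← ENNReal.ofReal_mul (abs_nonneg _)]
  congr 2
  rw [show e * (Real.exp (-u) * (-1)) = -(e * Real.exp (-u)) by ring, abs_neg, abs_of_pos (by positivity)]
  unfold rd gd bint
  have h1 : e * Real.exp (-u) * (Real.sqrt (e * Real.exp (-u)))⁻¹ = Real.sqrt (e * Real.exp (-u)) := by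
    rw [← div_eq_mul_inv, Real.div_sqrt]
  have h2 : Real.sqrt (e * Real.exp (-u)) = Real.sqrt e * Real.exp (-u/2) := by
    rw [Real.sqrt_mul he.le]; congr 1
    rw [show -u = -u/2 + -u/2 by ring, Real.exp_add, Real.sqrt_mul_self (Real.exp_pos _).le]
    congr 1; ring
  have h3 : e^2 / (2 * (e * Real.exp (-u))) = e * Real.exp u / 2 := by
    rw [Real.exp_neg]; field_simp
  rw [h3, Real.sqrt_div he.le]
  calc _ = (Real.sqrt (2 * Real.pi))⁻¹ * (e * Real.exp (-u) * (Real.sqrt (e * Real.exp (-u)))⁻¹) *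
      Real.exp (e - e * Real.exp (-u) / 2 - e * Real.exp u / 2) := by ring
    _ = _ := by
      rw [h1, h2, Real.cosh_eq]
      have : Real.exp (-u/2) * Real.exp (e - e * Real.exp (-u) / 2 - e * Real.exp u / 2) =
        Real.exp e * Real.exp (-(1/2) * u - e * ((Real.exp u + Real.exp (-u))/2)) := by
        rw [← Real.exp_add, ← Real.exp_add]; ring_nf
      linear_combination (Real.sqrt (2 * Real.pi))⁻¹ * Real.sqrt e * this

lemma rd_mom (p : ℝ) {e : ℝ} (he : 0 < e) {φ : ℝ → ENNReal}
    (h : ∀ u, φ (e * Real.exp (-u)) = ENNReal.ofReal (Real.exp (p * u))) :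
    ∫⁻ s in Set.Ioi 0, ENNReal.ofReal (rd e s) * φ s = ENNReal.ofReal (Im p e) := by
  rw [rd_link he, ← lint_gd p he]; simp_rw [h]

end QD

namespace QD

/-! ### Part B: block matrices -/
section blocks
open Matrix
variable {V : Type} [Fintype V] [DecidableEq V]

/-- bordered matrix -/
def bord (A : Matrix V V ℝ) (w : V → ℝ) (b : ℝ) : Matrix (V ⊕ Unit) (V ⊕ Unit) ℝ :=
  fromBlocks A (of fun i _ => - w i) (of fun _ j => - w j) (of fun _ _ => b)

lemma bord_det (A : Matrix V V ℝ) (hA : A.PosDef) (w : V → ℝ) (b : ℝ) :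
    (bord A w b).det = A.det * (b - w ⬝ᵥ A⁻¹ *ᵥ w) := by
  have := hA.isUnit.invertible
  rw [bord, det_fromBlocks₁₁]
  congr 1
  rw [det_unique]
  simp only [Matrix.sub_apply, of_apply, invOf_eq_nonsing_inv]
  congr 1
  rw [Matrix.mul_apply, dotProduct_mulVec, dotProduct]
  refine Finset.sum_congr rfl fun i _ => ?_
  simp [Matrix.mul_apply, vecMul, dotProduct]

lemma bord_posDef_iff (A : Matrix V V ℝ) (w : V → ℝ) (b : ℝ) :
    (bord A w b).PosDef ↔ A.PosDef ∧ 0 < b - w ⬝ᵥ A⁻¹ *ᵥ w := by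
  constructor
  · intro h
    have hA : A.PosDef := by
      have := h.submatrix (e := Sum.inl) Sum.inl_injective
      exact this
    refine ⟨hA, ?_⟩
    have h1 := h.det_pos
    rw [bord_det A hA] at h1
    exact (mul_pos_iff_of_pos_left hA.det_pos).1 h1
  · rintro ⟨hA, hs⟩
    have := hA.isUnit.invertible
    have hB : (of fun (_ : Unit) (j : V) => - w j) = (of fun (i : V) (_ : Unit) => - w i)ᴴ := by
      ext i j; simp
    have h1 : (bord A w b).PosSemidef := by
      rw [bord, hB, PosDef.fromBlocks₁₁ _ _ hA, posSemidef_iff_dotProduct_mulVec]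
      constructor
      · rw [IsHermitian]; ext i j; cases i; cases j; simp
      · intro x
        have e1 : ((of fun (_ : Unit) (_ : Unit) => b) - (of fun (i : V) (_ : Unit) => - w i)ᴴ * A⁻¹ * (of fun (i : V) (_ : Unit) => - w i)) () () = b - w ⬝ᵥ A⁻¹ *ᵥ w := by
          rw [Matrix.sub_apply, Matrix.mul_apply, dotProduct_mulVec, dotProduct]
          simp [Matrix.mul_apply, vecMul, dotProduct]
        simp only [dotProduct, mulVec, Finset.univ_unique, Finset.sum_singleton, PUnit.default_eq_unit]
        have e2 : star x () = x () := by simp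
        rw [e1, e2]
        have := mul_nonneg hs.le (mul_self_nonneg (x ()))
        linarith
    refine h1.posDef_iff_isUnit.2 ?_
    rw [isUnit_iff_isUnit_det, bord_det A hA, isUnit_iff_ne_zero]
    exact mul_ne_zero hA.det_pos.ne' hs.ne'

lemma bord_solve (A : Matrix V V ℝ) (hA : A.PosDef) (w : V → ℝ) (b : ℝ)
    (hs : 0 < b - w ⬝ᵥ A⁻¹ *ᵥ w) (η : V → ℝ) (ηy : ℝ) :
    (bord A w b)⁻¹ *ᵥ (Sum.elim η (fun _ => ηy)) =
      Sum.elim (A⁻¹ *ᵥ η + ((ηy + w ⬝ᵥ A⁻¹ *ᵥ η) / (b - w ⬝ᵥ A⁻¹ *ᵥ w)) • A⁻¹ *ᵥ w)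
        (fun _ => (ηy + w ⬝ᵥ A⁻¹ *ᵥ η) / (b - w ⬝ᵥ A⁻¹ *ᵥ w)) := by
  have hM : (bord A w b).PosDef := (bord_posDef_iff A w b).2 ⟨hA, hs⟩
  have hMu : IsUnit (bord A w b).det := (isUnit_iff_isUnit_det _).1 hM.isUnit
  have hAu : IsUnit A.det := (isUnit_iff_isUnit_det _).1 hA.isUnit
  set z := (ηy + w ⬝ᵥ A⁻¹ *ᵥ η) / (b - w ⬝ᵥ A⁻¹ *ᵥ w) with hz
  have hz2 : z * (b - w ⬝ᵥ A⁻¹ *ᵥ w) = ηy + w ⬝ᵥ A⁻¹ *ᵥ η := by rw [hz]; field_simp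
  have key : (bord A w b) *ᵥ (Sum.elim (A⁻¹ *ᵥ η + z • A⁻¹ *ᵥ w) (fun _ => z)) = Sum.elim η (fun _ => ηy) := by
    rw [bord, fromBlocks_mulVec]
    congr 1
    · simp only [Sum.elim_comp_inl, Sum.elim_comp_inr]
      rw [mulVec_add, mulVec_smul, mulVec_mulVec, mulVec_mulVec, mul_nonsing_inv _ hAu]
      ext i
      simp [mulVec, dotProduct]; ring
    · simp only [Sum.elim_comp_inl, Sum.elim_comp_inr]
      ext i
      have e1 : ((of fun (_ : Unit) (j : V) => - w j) *ᵥ (A⁻¹ *ᵥ η + z • A⁻¹ *ᵥ w)) i =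
        - (w ⬝ᵥ (A⁻¹ *ᵥ η + z • A⁻¹ *ᵥ w)) := by
        simp [mulVec, dotProduct]
      have e2 : ((of fun (_ : Unit) (_ : Unit) => b) *ᵥ fun _ => z) i = b * z := by
        simp [mulVec, dotProduct]
      rw [Pi.add_apply, e1, e2, dotProduct_add, dotProduct_smul, smul_eq_mul]
      linarith
  rw [← key, mulVec_mulVec, nonsing_inv_mul _ hMu, one_mulVec]

lemma bord_inv_yy (A : Matrix V V ℝ) (hA : A.PosDef) (w : V → ℝ) (b : ℝ)
    (hs : 0 < b - w ⬝ᵥ A⁻¹ *ᵥ w) :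
    (bord A w b)⁻¹ (Sum.inr ()) (Sum.inr ()) = 1 / (b - w ⬝ᵥ A⁻¹ *ᵥ w) := by
  have h := congrFun (bord_solve A hA w b hs 0 1) (Sum.inr ())
  simp only [mulVec_zero, dotProduct_zero, add_zero, Sum.elim_inr] at h
  rw [← h, mulVec, dotProduct]
  simp

lemma bord_quad (A : Matrix V V ℝ) (hA : A.PosDef) (w : V → ℝ) (b : ℝ)
    (hs : 0 < b - w ⬝ᵥ A⁻¹ *ᵥ w) (η : V → ℝ) (ηy : ℝ) :
    (Sum.elim η (fun _ => ηy)) ⬝ᵥ (bord A w b)⁻¹ *ᵥ (Sum.elim η (fun _ => ηy)) =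
      η ⬝ᵥ A⁻¹ *ᵥ η + (ηy + w ⬝ᵥ A⁻¹ *ᵥ η)^2 / (b - w ⬝ᵥ A⁻¹ *ᵥ w) := by
  rw [bord_solve A hA w b hs, sumElim_dotProduct_sumElim]
  have hsym : η ⬝ᵥ A⁻¹ *ᵥ w = w ⬝ᵥ A⁻¹ *ᵥ η := by
    have hT : A⁻¹ᵀ = A⁻¹ := by
      have := hA.inv.isHermitian
      rw [IsHermitian, conjTranspose_eq_transpose_of_trivial] at this
      exact this
    rw [dotProduct_mulVec, ← mulVec_transpose, hT, dotProduct_comm]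
  rw [dotProduct_add, dotProduct_smul, hsym]
  simp [dotProduct]
  ring

/-- maximum principle -/
lemma pos_of_mulVec_nonneg (H : Matrix V V ℝ) (hH : H.PosDef) (hoff : ∀ i j, i ≠ j → H i j ≤ 0)
    (φ : V → ℝ) (h : ∀ i, 0 ≤ (H *ᵥ φ) i) : ∀ i, 0 ≤ φ i := by
  set m : V → ℝ := fun i => max (-φ i) 0 with hm
  have h1 : 0 ≤ m ⬝ᵥ H *ᵥ φ :=
    Finset.sum_nonneg fun i _ => mul_nonneg (le_max_right _ _) (h i)
  have h2 : m ⬝ᵥ H *ᵥ φ ≤ - (m ⬝ᵥ H *ᵥ m) := by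
    simp only [dotProduct, mulVec, Finset.mul_sum, ← Finset.sum_neg_distrib]
    refine Finset.sum_le_sum fun i _ => Finset.sum_le_sum fun j _ => ?_
    have hmi : 0 ≤ m i := le_max_right _ _
    have hmj : 0 ≤ φ j + m j := by
      have : -φ j ≤ m j := le_max_left _ _
      linarith
    by_cases hij : i = j
    · subst hij
      have : m i * (φ i + m i) = 0 := by
        simp only [hm]
        rcases le_total (-φ i) 0 with h | h
        · rw [max_eq_right h]; simp
        · rw [max_eq_left h]; simp
      have : H i i * (m i * (φ i + m i)) = 0 := by rw [this, mul_zero]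
      linarith
    · have := mul_nonneg (mul_nonneg (neg_nonneg.2 (hoff i j hij)) hmi) hmj
      nlinarith
  have h3 : m = 0 := by
    by_contra hne
    have := (posDef_iff_dotProduct_mulVec.1 hH).2 hne
    simp only [star_trivial] at this
    linarith
  intro i
  have := congrFun h3 i
  simp only [hm, Pi.zero_apply] at this
  have := le_max_left (-φ i) 0
  linarith

end blocks
end QD

namespace QD
section densities
open Matrix
variable {V : Type} [Fintype V] [DecidableEq V]

/-- Schrödinger-type matrix with diagonal `B` and off-diagonal `-W` -/
def Hm (W : V → V → ℝ) (B : V → ℝ) : Matrix V V ℝ := of fun i j => if i = j then B i else - W i j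

/-- the density in the `B` coordinates -/
def dens (W : V → V → ℝ) (η B : V → ℝ) : ℝ :=
  if (Hm W B).PosDef then
    ((Real.sqrt (2 * Real.pi))⁻¹) ^ (Fintype.card V) *
      Real.exp (-(1/2) * (∑ i, ∑ j, Hm W B i j) - (1/2) * (η ⬝ᵥ (Hm W B)⁻¹ *ᵥ η) + ∑ i, η i) *
      (Real.sqrt (Hm W B).det)⁻¹
  else 0

lemma dens_nonneg (W : V → V → ℝ) (η B : V → ℝ) : 0 ≤ dens W η B := by
  unfold dens; split_ifs <;> positivity

lemma Hm_cont (W : V → V → ℝ) : Continuous (Hm W) := by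
  refine continuous_matrix fun i j => ?_
  simp only [Hm, of_apply]
  split_ifs <;> fun_prop

lemma Hm_herm (W : V → V → ℝ) (hW : ∀ i j, W i j = W j i) (B : V → ℝ) : (Hm W B).IsHermitian := by
  ext i j
  by_cases h : i = j
  · subst h; simp [Hm]
  · simp [Hm, h, Ne.symm h, hW i j]

lemma Hm_posDef_meas (W : V → V → ℝ) (hW : ∀ i j, W i j = W j i) :
    MeasurableSet {B : V → ℝ | (Hm W B).PosDef} := by
  have h1 : {B : V → ℝ | (Hm W B).PosDef} =
      (⋂ x : V → ℝ, {B | 0 ≤ x ⬝ᵥ Hm W B *ᵥ x}) ∩ {B | (Hm W B).det ≠ 0} := by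
    ext B
    simp only [Set.mem_setOf_eq, Set.mem_inter_iff, Set.mem_iInter]
    constructor
    · intro h
      refine ⟨fun x => ?_, h.det_pos.ne'⟩
      have := (posSemidef_iff_dotProduct_mulVec.1 h.posSemidef).2 x
      simpa using this
    · rintro ⟨h, hd⟩
      have : (Hm W B).PosSemidef := posSemidef_iff_dotProduct_mulVec.2 ⟨Hm_herm W hW B, fun x => by simpa using h x⟩
      refine this.posDef_iff_isUnit.2 ?_
      rw [isUnit_iff_isUnit_det, isUnit_iff_ne_zero]; exact hd
  rw [h1]
  have hc := Hm_cont W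
  refine MeasurableSet.inter ?_ ?_
  · refine (isClosed_iInter fun x => isClosed_le continuous_const ?_).measurableSet
    exact Continuous.dotProduct continuous_const (Continuous.matrix_mulVec hc continuous_const)
  · have : Continuous fun B => (Hm W B).det := hc.matrix_det
    exact (this.measurable (measurableSet_singleton 0)).compl

lemma Hm_inv_meas (W : V → V → ℝ) (i j : V) : Measurable fun B => (Hm W B)⁻¹ i j := by
  simp only [Matrix.inv_def, Ring.inverse_eq_inv', Matrix.smul_apply, smul_eq_mul]
  have hc := Hm_cont W
  have h1 : Continuous fun B => (Hm W B).det := hc.matrix_det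
  have h2 : Continuous fun B => (Hm W B).adjugate i j := (hc.matrix_adjugate).matrix_elem i j
  exact h1.measurable.inv.mul h2.measurable

lemma Hm_invVec_meas (W : V → V → ℝ) (η : V → ℝ) (i : V) : Measurable fun B => ((Hm W B)⁻¹ *ᵥ η) i := by
  simp only [mulVec, dotProduct]
  exact Finset.measurable_sum _ fun j _ => (Hm_inv_meas W i j).mul_const _

lemma dens_meas (W : V → V → ℝ) (hW : ∀ i j, W i j = W j i) (η : V → ℝ) : Measurable (dens W η) := by
  unfold dens
  refine Measurable.ite (Hm_posDef_meas W hW) ?_ measurable_const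
  have hc := Hm_cont W
  have h1 : Measurable fun B => (Hm W B).det := hc.matrix_det.measurable
  have h2 : Measurable fun B => (∑ i, ∑ j, Hm W B i j) :=
    Finset.measurable_sum _ fun i _ => Finset.measurable_sum _ fun j _ => (hc.matrix_elem i j).measurable
  have h3 : Measurable fun B => η ⬝ᵥ (Hm W B)⁻¹ *ᵥ η := by
    simp only [dotProduct]
    exact Finset.measurable_sum _ fun j _ => (Hm_invVec_meas W η j).const_mul _
  fun_prop

/-- reindexing -/
lemma Hm_reindex {U : Type} [Fintype U] [DecidableEq U] (e : U ≃ V) (W : V → V → ℝ) (B : V → ℝ) :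
    Hm (fun i j => W (e i) (e j)) (B ∘ e) = (Hm W B).submatrix e e := by
  ext i j; simp [Hm]

lemma posDef_reindex {U : Type} [Fintype U] [DecidableEq U] (e : U ≃ V) (M : Matrix V V ℝ) :
    (M.submatrix e e).PosDef ↔ M.PosDef := by
  constructor
  · intro h
    have := h.submatrix (e := e.symm) e.symm.injective
    simpa using this
  · intro h; exact h.submatrix (e := e) e.injective

lemma inv_reindex {U : Type} [Fintype U] [DecidableEq U] (e : U ≃ V) (M : Matrix V V ℝ) :
    (M.submatrix e e)⁻¹ = M⁻¹.submatrix e e := by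
  rw [Matrix.inv_submatrix_equiv]

lemma invVec_reindex {U : Type} [Fintype U] [DecidableEq U] (e : U ≃ V) (M : Matrix V V ℝ) (η : V → ℝ) :
    (M.submatrix e e)⁻¹ *ᵥ (η ∘ e) = (M⁻¹ *ᵥ η) ∘ e := by
  rw [inv_reindex, submatrix_mulVec_equiv]
  congr 1; congr 1; ext i; simp

lemma dens_reindex {U : Type} [Fintype U] [DecidableEq U] (e : U ≃ V) (W : V → V → ℝ) (η B : V → ℝ) :
    dens (fun i j => W (e i) (e j)) (η ∘ e) (B ∘ e) = dens W η B := by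
  unfold dens
  rw [Hm_reindex]
  simp only [posDef_reindex, det_submatrix_equiv_self, invVec_reindex, Fintype.card_congr e]
  have h1 : (η ∘ e) ⬝ᵥ ((Hm W B)⁻¹ *ᵥ η) ∘ e = η ⬝ᵥ (Hm W B)⁻¹ *ᵥ η := by
    simp only [dotProduct, Function.comp]
    exact Equiv.sum_comp e (fun i => η i * ((Hm W B)⁻¹ *ᵥ η) i)
  have h2 : ∑ i, ∑ j, (Hm W B).submatrix e e i j = ∑ i, ∑ j, Hm W B i j := by
    simp only [submatrix_apply]
    rw [← Equiv.sum_comp e]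
    refine Finset.sum_congr rfl fun i _ => ?_
    exact Equiv.sum_comp e (fun j => Hm W B (e i) j)
  have h3 : ∑ i, (η ∘ e) i = ∑ i, η i := Equiv.sum_comp e η
  rw [h1, h2, h3]

lemma Hm_bord (W : V ⊕ Unit → V ⊕ Unit → ℝ) (hW : ∀ i j, W i j = W j i) (B : V → ℝ) (b : ℝ) :
    Hm W (Sum.elim B fun _ => b) =
      bord (Hm (fun i j => W (Sum.inl i) (Sum.inl j)) B) (fun i => W (Sum.inl i) (Sum.inr ())) b := by
  ext i j
  rcases i with i | i <;> rcases j with j | j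
  · simp [Hm, bord]
  · simp [Hm, bord]
  · simp [Hm, bord, hW (Sum.inr ()) (Sum.inl j)]
  · simp [Hm, bord]

lemma dens_bord (W : V ⊕ Unit → V ⊕ Unit → ℝ) (hW : ∀ i j, W i j = W j i) (η B : V → ℝ) (ηy b : ℝ)
    (H : Matrix V V ℝ) (hH : H = Hm (fun i j => W (Sum.inl i) (Sum.inl j)) B)
    (w : V → ℝ) (hw : w = fun i => W (Sum.inl i) (Sum.inr ())) :
    dens W (Sum.elim η fun _ => ηy) (Sum.elim B fun _ => b) =
      dens (fun i j => W (Sum.inl i) (Sum.inl j)) (η + w) B *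
        (if 0 < b - w ⬝ᵥ H⁻¹ *ᵥ w then rd (ηy + w ⬝ᵥ H⁻¹ *ᵥ η) (b - w ⬝ᵥ H⁻¹ *ᵥ w) else 0) := by
  unfold dens
  rw [Hm_bord W hW, ← hH, ← hw, bord_posDef_iff]
  by_cases hA : H.PosDef
  swap
  · simp [hA]
  by_cases hs : 0 < b - w ⬝ᵥ H⁻¹ *ᵥ w
  swap
  · simp [hs]
  rw [if_pos ⟨hA, hs⟩, if_pos hA, if_pos hs, bord_quad H hA w b hs, bord_det H hA]
  have hsum : ∑ i, ∑ j, bord H w b i j = (∑ i, ∑ j, H i j) - 2 * (∑ i, w i) + b := by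
    simp only [Fintype.sum_sum_type, bord, fromBlocks_apply₁₁, fromBlocks_apply₁₂, fromBlocks_apply₂₁, fromBlocks_apply₂₂,
      of_apply, Finset.univ_unique, Finset.sum_singleton, Finset.sum_add_distrib, Finset.sum_neg_distrib]
    ring
  have hη : ∑ i, (Sum.elim η fun (_ : Unit) => ηy) i = ∑ i, η i + ηy := by
    simp [Fintype.sum_sum_type]
  have hT : H⁻¹ᵀ = H⁻¹ := by
    have := hA.inv.isHermitian
    rw [IsHermitian, conjTranspose_eq_transpose_of_trivial] at this
    exact this
  have hsym : η ⬝ᵥ H⁻¹ *ᵥ w = w ⬝ᵥ H⁻¹ *ᵥ η := by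
    rw [dotProduct_mulVec, ← mulVec_transpose, hT, dotProduct_comm]
  have hq : (η + w) ⬝ᵥ H⁻¹ *ᵥ (η + w) = η ⬝ᵥ H⁻¹ *ᵥ η + 2 * (w ⬝ᵥ H⁻¹ *ᵥ η) + w ⬝ᵥ H⁻¹ *ᵥ w := by
    rw [mulVec_add, add_dotProduct, dotProduct_add, dotProduct_add, hsym]; ring
  rw [hsum, hη, hq, Real.sqrt_mul hA.det_pos.le]
  set s := b - w ⬝ᵥ H⁻¹ *ᵥ w with hsdef
  have hb : b = s + w ⬝ᵥ H⁻¹ *ᵥ w := by rw [hsdef]; ring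
  rw [hb]
  set c := w ⬝ᵥ H⁻¹ *ᵥ w
  set d := w ⬝ᵥ H⁻¹ *ᵥ η
  unfold rd
  have hcard : Fintype.card (V ⊕ Unit) = Fintype.card V + 1 := by simp
  rw [hcard, pow_succ, mul_inv]
  have hexp : Real.exp (-(1/2) * ((∑ i, ∑ j, H i j) - 2 * (∑ i, w i) + (s + c)) -
      1/2 * (η ⬝ᵥ H⁻¹ *ᵥ η + (ηy + d)^2/s) + (∑ i, η i + ηy)) =
    Real.exp (-(1/2) * (∑ i, ∑ j, H i j) - 1/2 * (η ⬝ᵥ H⁻¹ *ᵥ η + 2 * d + c) + ∑ i, (η + w) i) *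
     Real.exp (ηy + d - s/2 - (ηy + d)^2/(2*s)) := by
    rw [← Real.exp_add]
    congr 1
    simp only [Pi.add_apply, Finset.sum_add_distrib]
    field_simp
    ring
  rw [hexp]
  ring

end densities
end QD

namespace QD
section tonelli
open Matrix
variable {V : Type} [Fintype V] [DecidableEq V]

lemma lint_sum_unit (F : (V ⊕ Unit → ℝ) → ENNReal) (hF : Measurable F) :
    ∫⁻ B, F B = ∫⁻ B' : V → ℝ, ∫⁻ b : ℝ, F (Sum.elim B' fun _ => b) := by
  have h1 := (volume_measurePreserving_sumPiEquivProdPi (fun _ : V ⊕ Unit => ℝ)).symm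
  rw [← h1.lintegral_comp hF]
  rw [Measure.volume_eq_prod, lintegral_prod]
  swap
  · exact (hF.comp h1.measurable).aemeasurable
  congr 1; ext B'
  have h2 := (volume_preserving_funUnique Unit ℝ).symm
  rw [← h2.lintegral_comp]
  · congr 1
  · exact (hF.comp h1.measurable).comp (measurable_const.prodMk measurable_id)

lemma tonelli_bord (W : V ⊕ Unit → V ⊕ Unit → ℝ) (hW : ∀ i j, W i j = W j i) (η : V → ℝ) (ηy : ℝ)
    (Φ : ℝ × ℝ → ENNReal) (hΦ : Measurable Φ) (w : V → ℝ) (hw : w = fun i => W (Sum.inl i) (Sum.inr ())) :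
    ∫⁻ B, ENNReal.ofReal (dens W (Sum.elim η fun _ => ηy) B) *
        Φ (((Hm W B)⁻¹ *ᵥ (Sum.elim η fun _ => ηy)) (Sum.inr ()), (Hm W B)⁻¹ (Sum.inr ()) (Sum.inr ())) =
      ∫⁻ B, ENNReal.ofReal (dens (fun i j => W (Sum.inl i) (Sum.inl j)) (η + w) B) *
        ∫⁻ s in Set.Ioi 0,
          ENNReal.ofReal (rd (ηy + w ⬝ᵥ (Hm (fun i j => W (Sum.inl i) (Sum.inl j)) B)⁻¹ *ᵥ η) s) *
            Φ ((ηy + w ⬝ᵥ (Hm (fun i j => W (Sum.inl i) (Sum.inl j)) B)⁻¹ *ᵥ η) / s, 1 / s) := by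
  rw [lint_sum_unit]
  swap
  · exact (dens_meas W hW _).ennreal_ofReal.mul (hΦ.comp ((Hm_invVec_meas W _ _).prodMk (Hm_inv_meas W _ _)))
  congr 1; ext B
  set H := Hm (fun i j => W (Sum.inl i) (Sum.inl j)) B with hH
  by_cases hA : H.PosDef
  swap
  · have h0 : dens (fun i j => W (Sum.inl i) (Sum.inl j)) (η + w) B = 0 := by
      rw [dens, if_neg hA]
    simp_rw [dens_bord W hW η B ηy _ H hH w hw, h0]
    simp
  set c := w ⬝ᵥ H⁻¹ *ᵥ w with hc
  set d := ηy + w ⬝ᵥ H⁻¹ *ᵥ η with hd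
  rw [← lintegral_indicator measurableSet_Ioi, ← lintegral_const_mul' _ _ ENNReal.ofReal_ne_top]
  conv_rhs => rw [← lintegral_sub_right_eq_self _ c]
  congr 1; ext b
  rw [dens_bord W hW η B ηy _ H hH w hw, ← hc, ← hd]
  by_cases hs : 0 < b - c
  swap
  · rw [if_neg hs, Set.indicator_of_notMem (by simpa using hs)]; simp
  rw [if_pos hs, Set.indicator_of_mem (by simpa using hs), ENNReal.ofReal_mul (dens_nonneg _ _ _), mul_assoc]
  congr 3
  rw [Hm_bord W hW, ← hH, ← hw, bord_solve H hA w b hs, bord_inv_yy H hA w b hs]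
  simp [← hc, ← hd]

lemma lint_reindex {U : Type} [Fintype U] [DecidableEq U] (e : U ≃ V) (F : (V → ℝ) → ENNReal) (hF : Measurable F) :
    ∫⁻ B, F B = ∫⁻ B : U → ℝ, F (B ∘ e.symm) := by
  have h := volume_measurePreserving_piCongrLeft (fun _ : V => ℝ) e
  rw [← h.lintegral_comp hF]
  congr 1; ext B; congr 1; ext i
  obtain ⟨j, rfl⟩ := e.surjective i
  rw [MeasurableEquiv.coe_piCongrLeft, Equiv.piCongrLeft_apply_apply]; simp

lemma e_lower (W : V → V → ℝ) (hW0 : ∀ i j, 0 ≤ W i j) (B η w : V → ℝ)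
    (hη : ∀ i, 0 ≤ η i) (hw : ∀ i, 0 ≤ w i) (hA : (Hm W B).PosDef) :
    0 ≤ w ⬝ᵥ (Hm W B)⁻¹ *ᵥ η := by
  refine Finset.sum_nonneg fun i _ => mul_nonneg (hw i) ?_
  refine pos_of_mulVec_nonneg _ hA ?_ _ ?_ i
  · intro i j hij; simp [Hm, hij, hW0]
  · intro i
    rw [mulVec_mulVec, mul_nonsing_inv _ ((isUnit_iff_isUnit_det _).1 hA.isUnit), one_mulVec]
    exact hη i

/-- general decomposition with a distinguished vertex -/
lemma tonelli_gen (W : V → V → ℝ) (hW : ∀ i j, W i j = W j i) (hW0 : ∀ i j, 0 ≤ W i j)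
    (η : V → ℝ) (hη : ∀ i, 0 < η i) (y : V) :
    ∃ (W' : {v : V // v ≠ y} → {v : V // v ≠ y} → ℝ) (η' : {v : V // v ≠ y} → ℝ)
      (ef : ({v : V // v ≠ y} → ℝ) → ℝ),
      (∀ i j, W' i j = W' j i) ∧ (∀ i j, 0 ≤ W' i j) ∧ (∀ i, 0 < η' i) ∧
      (∀ B, (Hm W' B).PosDef → η y ≤ ef B) ∧
      ∀ Φ : ℝ × ℝ → ENNReal, Measurable Φ →
        ∫⁻ B, ENNReal.ofReal (dens W η B) * Φ (((Hm W B)⁻¹ *ᵥ η) y, (Hm W B)⁻¹ y y) =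
        ∫⁻ B, ENNReal.ofReal (dens W' η' B) *
          ∫⁻ s in Set.Ioi 0, ENNReal.ofReal (rd (ef B) s) * Φ (ef B / s, 1 / s) := by
  set e : {v : V // v ≠ y} ⊕ Unit ≃ V :=
    (Equiv.optionEquivSumPUnit _).symm.trans (Equiv.optionSubtypeNe y) with he
  have hey : e (Sum.inr ()) = y := by simp [he]
  set W1 : {v : V // v ≠ y} ⊕ Unit → {v : V // v ≠ y} ⊕ Unit → ℝ := fun i j => W (e i) (e j) with hW1
  set w : {v : V // v ≠ y} → ℝ := fun i => W1 (Sum.inl i) (Sum.inr ()) with hw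
  set η0 : {v : V // v ≠ y} → ℝ := fun i => η (e (Sum.inl i)) with hη0
  set W' : {v : V // v ≠ y} → {v : V // v ≠ y} → ℝ := fun i j => W1 (Sum.inl i) (Sum.inl j) with hW'
  refine ⟨W', η0 + w, fun B => η y + w ⬝ᵥ (Hm W' B)⁻¹ *ᵥ η0, fun i j => hW _ _, fun i j => hW0 _ _,
    fun i => add_pos_of_pos_of_nonneg (hη _) (hW0 _ _), ?_, ?_⟩
  · intro B hB
    have := e_lower W' (fun _ _ => hW0 _ _) B η0 w (fun _ => (hη _).le) (fun _ => hW0 _ _) hB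
    linarith
  · intro Φ hΦ
    have h1 := tonelli_bord W1 (fun i j => hW _ _) η0 (η y) Φ hΦ w hw
    rw [← h1, lint_reindex e]
    swap
    · exact (dens_meas W hW _).ennreal_ofReal.mul (hΦ.comp ((Hm_invVec_meas W _ _).prodMk (Hm_inv_meas W _ _)))
    congr 1; ext B
    have hηe : (Sum.elim η0 fun _ => η y) = η ∘ e := by
      ext i; rcases i with i | i
      · rfl
      · change η y = η (e (Sum.inr ())); rw [hey]
    have hB : B = (B ∘ e.symm) ∘ e := by ext i; simp
    rw [hηe]
    conv_rhs => rw [hB]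
    rw [hW1, dens_reindex, Hm_reindex, invVec_reindex, inv_reindex]
    simp [hey]

theorem mass_one : ∀ (n : ℕ) (V : Type) [Fintype V] [DecidableEq V], Fintype.card V = n →
    ∀ (W : V → V → ℝ), (∀ i j, W i j = W j i) → (∀ i j, 0 ≤ W i j) →
    ∀ (η : V → ℝ), (∀ i, 0 < η i) → ∫⁻ B, ENNReal.ofReal (dens W η B) = 1 := by
  intro n
  induction n with
  | zero =>
    intro V _ _ hV W hW hW0 η hη
    have : IsEmpty V := Fintype.card_eq_zero_iff.1 hV
    have h1 : ∀ B, dens W η B = 1 := by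
      intro B
      have hpd : (Hm W B).PosDef := by
        rw [posDef_iff_dotProduct_mulVec]
        refine ⟨Hm_herm W hW B, fun x hx => (hx (Subsingleton.elim _ _)).elim⟩
      rw [dens, if_pos hpd]
      simp [dotProduct]
    simp only [h1, ENNReal.ofReal_one, lintegral_one]
    rw [volume_pi, Measure.pi_of_empty]; simp
  | succ n ih =>
    intro V _ _ hV W hW hW0 η hη
    have : Nonempty V := Fintype.card_pos_iff.1 (by omega)
    obtain ⟨y⟩ := this
    obtain ⟨W', η', ef, h1, h2, h3, h4, h5⟩ := tonelli_gen W hW hW0 η hη y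
    have h6 := h5 (fun _ => 1) measurable_const
    simp only [mul_one] at h6
    rw [h6, ← ih {v : V // v ≠ y} (by
      have := Fintype.card_subtype_compl (fun v => v = y)
      simp only [Fintype.card_subtype_eq] at this
      rw [show Fintype.card {v : V // v ≠ y} = Fintype.card {v : V // ¬ v = y} from rfl, this]; omega)
      W' h1 h2 η' h3]
    congr 1; ext B
    by_cases hB : (Hm W' B).PosDef
    · have he : 0 < ef B := (hη y).trans_le (h4 B hB)
      have := rd_mom 0 he (φ := fun _ => 1) (by simp)
      rw [Im_zero he] at this
      simp only [mul_one] at this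
      rw [this]; simp
    · rw [dens, if_neg hB]; simp

/-- comparison principle -/
theorem compare (W : V → V → ℝ) (hW : ∀ i j, W i j = W j i) (hW0 : ∀ i j, 0 ≤ W i j)
    (η : V → ℝ) (hη : ∀ i, 0 < η i) (y : V) (Φ Ψ : ℝ × ℝ → ENNReal) (hΦ : Measurable Φ) (hΨ : Measurable Ψ)
    (h : ∀ e, η y ≤ e → ∫⁻ s in Set.Ioi 0, ENNReal.ofReal (rd e s) * Φ (e / s, 1 / s) ≤
      ∫⁻ s in Set.Ioi 0, ENNReal.ofReal (rd e s) * Ψ (e / s, 1 / s)) :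
    ∫⁻ B, ENNReal.ofReal (dens W η B) * Φ (((Hm W B)⁻¹ *ᵥ η) y, (Hm W B)⁻¹ y y) ≤
    ∫⁻ B, ENNReal.ofReal (dens W η B) * Ψ (((Hm W B)⁻¹ *ᵥ η) y, (Hm W B)⁻¹ y y) := by
  obtain ⟨W', η', ef, h1, h2, h3, h4, h5⟩ := tonelli_gen W hW hW0 η hη y
  rw [h5 Φ hΦ, h5 Ψ hΨ]
  refine lintegral_mono fun B => ?_
  by_cases hB : (Hm W' B).PosDef
  · exact mul_le_mul_right (h _ (h4 B hB)) _
  · simp only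
    rw [dens, if_neg hB]; simp

end tonelli
end QD

namespace QD
section chvar
open Matrix
variable {V : Type} [Fintype V] [DecidableEq V]

/-! ### Part C: change of variables -/

def Bt (W : V → V → ℝ) (η t : V → ℝ) : V → ℝ :=
  fun j => (∑ k, W j k * Real.exp (t k - t j)) + η j * Real.exp (-t j)

lemma Hm_mulVec (W : V → V → ℝ) (hd : ∀ i, W i i = 0) (B v : V → ℝ) (j : V) :
    (Hm W B *ᵥ v) j = B j * v j - ∑ k, W j k * v k := by
  have : ∀ k, Hm W B j k * v k = (if j = k then B j * v k else 0) - W j k * v k := by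
    intro k
    by_cases h : j = k
    · subst h; simp [Hm, hd]
    · simp [Hm, h]
  simp only [mulVec, dotProduct, this, Finset.sum_sub_distrib]
  simp

lemma Bt_mul_exp (W : V → V → ℝ) (η t : V → ℝ) (j : V) :
    Bt W η t j * Real.exp (t j) = (∑ k, W j k * Real.exp (t k)) + η j := by
  have h1 : Real.exp (- t j) * Real.exp (t j) = 1 := by rw [← Real.exp_add]; simp
  rw [Bt, add_mul, Finset.sum_mul, mul_assoc, h1, mul_one]
  congr 1
  refine Finset.sum_congr rfl fun k _ => ?_
  rw [mul_assoc, ← Real.exp_add]; ring_nf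

lemma Hm_Bt_psi (W : V → V → ℝ) (hd : ∀ i, W i i = 0) (η t : V → ℝ) :
    Hm W (Bt W η t) *ᵥ (fun k => Real.exp (t k)) = η := by
  ext j
  rw [Hm_mulVec W hd, Bt_mul_exp]; ring

lemma Hm_Bt_quad (W : V → V → ℝ) (hW : ∀ i j, W i j = W j i) (hd : ∀ i, W i i = 0) (η t v : V → ℝ) :
    v ⬝ᵥ Hm W (Bt W η t) *ᵥ v =
      (1/2) * (∑ j, ∑ k, W j k * (Real.exp (t j) * Real.exp (t k)) * (v j * Real.exp (-t j) - v k * Real.exp (-t k))^2)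
       + ∑ j, η j * Real.exp (-t j) * (v j)^2 := by
  have hL : v ⬝ᵥ Hm W (Bt W η t) *ᵥ v =
     (∑ j, ∑ k, W j k * (Real.exp (t k - t j) * (v j)^2)) + (∑ j, η j * Real.exp (-t j) * (v j)^2)
      - ∑ j, ∑ k, W j k * (v j * v k) := by
    simp only [dotProduct, Hm_mulVec W hd, Bt]
    rw [← Finset.sum_add_distrib, ← Finset.sum_sub_distrib]
    refine Finset.sum_congr rfl fun j _ => ?_
    rw [mul_sub, add_mul, mul_add, Finset.sum_mul, Finset.mul_sum, Finset.mul_sum]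
    congr 1
    · congr 1
      · refine Finset.sum_congr rfl fun k _ => ?_; ring
      · ring
    · refine Finset.sum_congr rfl fun k _ => ?_; ring
  have hsw : (∑ j, ∑ k, W j k * (Real.exp (t k - t j) * (v j)^2)) =
      ∑ j, ∑ k, W j k * (Real.exp (t j - t k) * (v k)^2) := by
    rw [Finset.sum_comm]
    refine Finset.sum_congr rfl fun j _ => Finset.sum_congr rfl fun k _ => ?_
    rw [hW]
  have hR : (∑ j, ∑ k, W j k * (Real.exp (t j) * Real.exp (t k)) * (v j * Real.exp (-t j) - v k * Real.exp (-t k))^2) =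
     (∑ j, ∑ k, W j k * (Real.exp (t k - t j) * (v j)^2)) + (∑ j, ∑ k, W j k * (Real.exp (t j - t k) * (v k)^2))
      - 2 * ∑ j, ∑ k, W j k * (v j * v k) := by
    simp only [Finset.mul_sum, ← Finset.sum_add_distrib, ← Finset.sum_sub_distrib]
    refine Finset.sum_congr rfl fun j _ => Finset.sum_congr rfl fun k _ => ?_
    rw [sub_eq_add_neg (t k), sub_eq_add_neg (t j), Real.exp_add, Real.exp_add, Real.exp_neg, Real.exp_neg]
    have h1 := Real.exp_ne_zero (t j)
    have h2 := Real.exp_ne_zero (t k)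
    field_simp
    ring
  rw [hL, hR, ← hsw]; ring

lemma Hm_Bt_posDef (W : V → V → ℝ) (hW : ∀ i j, W i j = W j i) (hW0 : ∀ i j, 0 ≤ W i j)
    (hd : ∀ i, W i i = 0) (η : V → ℝ) (hη : ∀ i, 0 < η i) (t : V → ℝ) :
    (Hm W (Bt W η t)).PosDef := by
  rw [posDef_iff_dotProduct_mulVec]
  refine ⟨Hm_herm W hW _, fun v hv => ?_⟩
  rw [star_trivial, Hm_Bt_quad W hW hd]
  obtain ⟨i, hi⟩ := Function.ne_iff.1 hv
  have hi : v i ≠ 0 := hi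
  refine add_pos_of_nonneg_of_pos ?_ ?_
  · refine mul_nonneg (by norm_num) (Finset.sum_nonneg fun j _ => Finset.sum_nonneg fun k _ => ?_)
    have := hW0 j k
    positivity
  · refine Finset.sum_pos' (fun j _ => ?_) ⟨i, Finset.mem_univ _, ?_⟩
    · have := hη j; positivity
    · have := hη i; positivity

lemma psi_eq (W : V → V → ℝ) (hW : ∀ i j, W i j = W j i) (hW0 : ∀ i j, 0 ≤ W i j)
    (hd : ∀ i, W i i = 0) (η : V → ℝ) (hη : ∀ i, 0 < η i) (t : V → ℝ) :
    (Hm W (Bt W η t))⁻¹ *ᵥ η = fun k => Real.exp (t k) := by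
  have h := Hm_Bt_posDef W hW hW0 hd η hη t
  conv_lhs => rw [← Hm_Bt_psi W hd η t]
  rw [mulVec_mulVec, Hm_Bt_psi W hd η t, nonsing_inv_mul _ ((isUnit_iff_isUnit_det _).1 h.isUnit), one_mulVec]

lemma Bt_inj (W : V → V → ℝ) (hW : ∀ i j, W i j = W j i) (hW0 : ∀ i j, 0 ≤ W i j)
    (hd : ∀ i, W i i = 0) (η : V → ℝ) (hη : ∀ i, 0 < η i) : Function.Injective (Bt W η) := by
  intro t t' h
  have h1 := psi_eq W hW hW0 hd η hη t
  have h2 := psi_eq W hW hW0 hd η hη t'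
  rw [h] at h1
  ext k
  exact Real.exp_injective (congrFun (h1.symm.trans h2) k)

lemma Bt_range (W : V → V → ℝ) (hW : ∀ i j, W i j = W j i) (hW0 : ∀ i j, 0 ≤ W i j)
    (hd : ∀ i, W i i = 0) (η : V → ℝ) (hη : ∀ i, 0 < η i) :
    Set.image (Bt W η) Set.univ = {B | (Hm W B).PosDef} := by
  ext B
  simp only [Set.image_univ, Set.mem_range]
  constructor
  · rintro ⟨t, rfl⟩
    exact Hm_Bt_posDef W hW hW0 hd η hη t
  · intro hB
    have hB : (Hm W B).PosDef := hB
    set ψ := (Hm W B)⁻¹ *ᵥ η with hψ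
    have hs : Hm W B *ᵥ ψ = η := by
      rw [hψ, mulVec_mulVec, mul_nonsing_inv _ ((isUnit_iff_isUnit_det _).1 hB.isUnit), one_mulVec]
    have h0 : ∀ i, 0 ≤ ψ i := by
      refine pos_of_mulVec_nonneg _ hB ?_ _ ?_
      · intro i j hij; simp [Hm, hij, hW0]
      · intro i; rw [hs]; exact (hη i).le
    have hj : ∀ j, B j * ψ j = (∑ k, W j k * ψ k) + η j := by
      intro j
      have := congrFun hs j
      rw [Hm_mulVec W hd] at this
      linarith
    have hp : ∀ j, 0 < ψ j := by
      intro j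
      refine lt_of_le_of_ne (h0 j) fun h => ?_
      have h1 := hj j
      rw [← h, mul_zero] at h1
      have h2 : 0 ≤ ∑ k, W j k * ψ k := Finset.sum_nonneg fun k _ => mul_nonneg (hW0 _ _) (h0 k)
      have := hη j
      linarith
    refine ⟨fun k => Real.log (ψ k), ?_⟩
    ext j
    have h1 := Bt_mul_exp W η (fun k => Real.log (ψ k)) j
    simp only [Real.exp_log (hp _)] at h1
    rw [← hj j] at h1
    exact mul_right_cancel₀ (hp j).ne' h1

/-- Jacobian matrix -/
def Jac (W : V → V → ℝ) (η t : V → ℝ) : Matrix V V ℝ :=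
  -(diagonal (fun k => Real.exp (-t k)) * Hm W (Bt W η t) * diagonal (fun k => Real.exp (t k)))

lemma Jac_abs_det (W : V → V → ℝ) (hW : ∀ i j, W i j = W j i) (hW0 : ∀ i j, 0 ≤ W i j)
    (hd : ∀ i, W i i = 0) (η : V → ℝ) (hη : ∀ i, 0 < η i) (t : V → ℝ) :
    |(Jac W η t).det| = (Hm W (Bt W η t)).det := by
  have h := (Hm_Bt_posDef W hW hW0 hd η hη t).det_pos
  rw [Jac, det_neg, det_mul, det_mul, det_diagonal, det_diagonal, abs_mul, abs_pow, abs_neg, abs_one, one_pow, one_mul,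
    mul_right_comm, ← Finset.prod_mul_distrib]
  have : ∀ i, Real.exp (-t i) * Real.exp (t i) = 1 := fun i => by rw [← Real.exp_add]; simp
  simp [this, abs_of_pos h]

lemma Bt_hasFDeriv (W : V → V → ℝ) (hd : ∀ i, W i i = 0) (η t : V → ℝ) :
    HasFDerivAt (Bt W η) (LinearMap.toContinuousLinearMap (Matrix.toLin' (Jac W η t))) t := by
  rw [hasFDerivAt_pi']
  intro j
  have hpr : ∀ k, HasFDerivAt (fun s : V → ℝ => s k) (ContinuousLinearMap.proj (R := ℝ) (φ := fun _ : V => ℝ) k) t :=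
    fun k => hasFDerivAt_apply k t
  have h1 : HasFDerivAt (fun s => Bt W η s j)
      ((∑ k, W j k • (Real.exp (t k - t j) • (ContinuousLinearMap.proj (R := ℝ) (φ := fun _ : V => ℝ) k - ContinuousLinearMap.proj (R := ℝ) (φ := fun _ : V => ℝ) j))) +
        η j • (Real.exp (-t j) • (-(ContinuousLinearMap.proj (R := ℝ) (φ := fun _ : V => ℝ) j)))) t := by
    unfold Bt
    refine HasFDerivAt.add ?_ ?_
    · refine HasFDerivAt.fun_sum fun k _ => ?_
      exact (((hpr k).sub (hpr j)).exp).const_mul _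
    · exact ((hpr j).neg.exp).const_mul _
  refine h1.congr_fderiv ?_
  ext v
  simp only [ContinuousLinearMap.add_apply, ContinuousLinearMap.sum_apply, ContinuousLinearMap.smul_apply,
    ContinuousLinearMap.sub_apply, ContinuousLinearMap.neg_apply, ContinuousLinearMap.proj_apply, smul_eq_mul,
    ContinuousLinearMap.comp_apply, LinearMap.coe_toContinuousLinearMap', Matrix.toLin'_apply]
  rw [Jac, neg_mulVec, Pi.neg_apply, ← mulVec_mulVec, ← mulVec_mulVec, mulVec_diagonal, Hm_mulVec W hd]
  simp only [mulVec_diagonal]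
  rw [← mul_assoc (Bt W η t j), Bt_mul_exp]
  have e : ∀ k, W j k * (Real.exp (t k - t j) * (v k - v j)) =
    Real.exp (- t j) * (W j k * (Real.exp (t k) * v k)) - Real.exp (-t j) * ((W j k * Real.exp (t k)) * v j) := by
    intro k
    rw [sub_eq_add_neg (t k), Real.exp_add]; ring
  simp only [e, Finset.sum_sub_distrib, ← Finset.mul_sum, ← Finset.sum_mul]
  ring

/-- weight in the `t` coordinates -/
def wt (W : V → V → ℝ) (η t : V → ℝ) : ℝ := (Hm W (Bt W η t)).det * dens W η (Bt W η t)

lemma change_var (W : V → V → ℝ) (hW : ∀ i j, W i j = W j i) (hW0 : ∀ i j, 0 ≤ W i j)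
    (hd : ∀ i, W i i = 0) (η : V → ℝ) (hη : ∀ i, 0 < η i) (Θ : (V → ℝ) → ENNReal) :
    ∫⁻ B, ENNReal.ofReal (dens W η B) * Θ B = ∫⁻ t, ENNReal.ofReal (wt W η t) * Θ (Bt W η t) := by
  have hms := Hm_posDef_meas W hW
  have h1 : ∫⁻ B, ENNReal.ofReal (dens W η B) * Θ B =
      ∫⁻ B in {B | (Hm W B).PosDef}, ENNReal.ofReal (dens W η B) * Θ B := by
    rw [← lintegral_indicator hms]
    congr 1; ext B
    by_cases hB : (Hm W B).PosDef
    · rw [Set.indicator_of_mem]; exact hB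
    · rw [Set.indicator_of_notMem (by exact hB), dens, if_neg hB]; simp
  rw [h1, ← Bt_range W hW hW0 hd η hη,
    lintegral_image_eq_lintegral_abs_det_fderiv_mul volume MeasurableSet.univ
      (fun t _ => (Bt_hasFDeriv W hd η t).hasFDerivWithinAt) (Bt_inj W hW hW0 hd η hη).injOn, Measure.restrict_univ]
  congr 1; ext t
  rw [← mul_assoc, ← ENNReal.ofReal_mul (abs_nonneg _)]
  have : (LinearMap.toContinuousLinearMap (Matrix.toLin' (Jac W η t))).det = (Jac W η t).det := by
    rw [ContinuousLinearMap.det, LinearMap.coe_toContinuousLinearMap, LinearMap.det_toLin']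
  rw [this, Jac_abs_det W hW hW0 hd η hη, wt]

lemma wt_eq (W : V → V → ℝ) (hW : ∀ i j, W i j = W j i) (hW0 : ∀ i j, 0 ≤ W i j)
    (hd : ∀ i, W i i = 0) (η : V → ℝ) (hη : ∀ i, 0 < η i) (t : V → ℝ) :
    wt W η t = Real.exp (-((1/2) * ∑ j, ∑ k, W j k * (Real.cosh (t j - t k) - 1)) - ∑ k, (η k * Real.cosh (t k) - η k))
      * Real.sqrt (Hm W (Bt W η t)).det * ((Real.sqrt (2 * Real.pi))⁻¹) ^ (Fintype.card V) := by
  have hp := Hm_Bt_posDef W hW hW0 hd η hη t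
  have hdp := hp.det_pos
  rw [wt, dens, if_pos hp, psi_eq W hW hW0 hd η hη]
  have hs : ∑ i, ∑ j, Hm W (Bt W η t) i j = (∑ j, ∑ k, W j k * (Real.cosh (t j - t k) - 1)) + ∑ j, η j * Real.exp (-t j) := by
    have h1 : ∀ j, ∑ k, Hm W (Bt W η t) j k = (∑ k, W j k * (Real.exp (t k - t j) - 1)) + η j * Real.exp (-t j) := by
      intro j
      have := Hm_mulVec W hd (Bt W η t) (fun _ => 1) j
      simp only [mulVec, dotProduct, mul_one] at this
      rw [this, Bt]
      simp only [mul_sub, mul_one, Finset.sum_sub_distrib]; ring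
    simp only [h1, Finset.sum_add_distrib]
    congr 1
    have hsw : ∑ j, ∑ k, W j k * (Real.exp (t k - t j) - 1) = ∑ j, ∑ k, W j k * (Real.exp (t j - t k) - 1) := by
      rw [Finset.sum_comm]
      refine Finset.sum_congr rfl fun j _ => Finset.sum_congr rfl fun k _ => ?_
      rw [hW]
    have hav : ∑ j, ∑ k, W j k * (Real.cosh (t j - t k) - 1) =
       (1/2) * (∑ j, ∑ k, W j k * (Real.exp (t k - t j) - 1)) + (1/2) * ∑ j, ∑ k, W j k * (Real.exp (t j - t k) - 1) := by
      simp only [Finset.mul_sum, ← Finset.sum_add_distrib]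
      refine Finset.sum_congr rfl fun j _ => Finset.sum_congr rfl fun k _ => ?_
      rw [Real.cosh_eq, neg_sub]; ring
    rw [hav, ← hsw]; ring
  rw [hs]
  have hsq : (Hm W (Bt W η t)).det * (Real.sqrt (Hm W (Bt W η t)).det)⁻¹ = Real.sqrt (Hm W (Bt W η t)).det := by
    rw [← div_eq_mul_inv, Real.div_sqrt]
  have hexp : -(1/2) * ((∑ j, ∑ k, W j k * (Real.cosh (t j - t k) - 1)) + ∑ j, η j * Real.exp (-t j))
     - (1/2) * (η ⬝ᵥ fun k => Real.exp (t k)) + ∑ i, η i =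
     -((1/2) * ∑ j, ∑ k, W j k * (Real.cosh (t j - t k) - 1)) - ∑ k, (η k * Real.cosh (t k) - η k) := by
    have : ∑ k, (η k * Real.cosh (t k) - η k) = (1/2) * (∑ j, η j * Real.exp (-t j)) + (1/2) * (∑ k, η k * Real.exp (t k)) - ∑ i, η i := by
      simp only [Finset.mul_sum, ← Finset.sum_add_distrib, ← Finset.sum_sub_distrib]
      refine Finset.sum_congr rfl fun j _ => ?_
      rw [Real.cosh_eq]; ring
    rw [this, dotProduct]; ring
  rw [hexp]
  conv_rhs => rw [← hsq]
  ring

end chvar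
end QD

namespace QD
section torus
open Matrix

lemma NN_symm {x y : Torus L} : NN x y ↔ NN y x := by
  have : ∀ x y : Torus L, NN x y → NN y x := by
    rintro x y ⟨h, i, h1 | h1⟩
    · exact ⟨h.symm, i, Or.inr (by rw [h1]; simp)⟩
    · exact ⟨h.symm, i, Or.inl (by rw [h1]; simp)⟩
  exact ⟨this _ _, this _ _⟩

lemma NN_irrefl (x : Torus L) : ¬ NN x x := fun h => h.1 rfl

/-- the edge weights -/
def Wb (L : ℕ) (β : ℝ) (i j : Torus L) : ℝ := if NN i j then β else 0

lemma Wb_symm (β : ℝ) (i j : Torus L) : Wb L β i j = Wb L β j i := by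
  unfold Wb; simp only [NN_symm (x := i)]

lemma Wb_nonneg {β : ℝ} (hβ : 0 ≤ β) (i j : Torus L) : 0 ≤ Wb L β i j := by
  unfold Wb; split_ifs <;> simp [hβ]

lemma Wb_diag (β : ℝ) (i : Torus L) : Wb L β i i = 0 := by
  simp [Wb, NN_irrefl]

variable [NeZero L]

lemma Dmat_eq (β ε : ℝ) (t : Torus L → ℝ) :
    Dmat β ε t = diagonal (fun k => Real.exp (t k)) * Hm (Wb L β) (Bt (Wb L β) (fun _ => ε) t) *
      diagonal (fun k => Real.exp (t k)) := by
  ext j k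
  rw [mul_diagonal, diagonal_mul]
  by_cases h : j = k
  · subst h
    simp only [Dmat, Hm, of_apply, if_true]
    rw [mul_assoc, Bt_mul_exp, mul_add, Finset.mul_sum, Finset.mul_sum]
    congr 1
    · refine Finset.sum_congr rfl fun i _ => ?_
      rw [Wb, NN_symm (x := j)]
      split_ifs
      · rw [Real.exp_add]; ring
      · simp
    · ring
  · simp only [Dmat, Hm, of_apply, if_neg h, Wb]
    split_ifs
    · rw [Real.exp_add]; ring
    · simp

lemma Hm_eq (β ε : ℝ) (t : Torus L → ℝ) :
    Hm (Wb L β) (Bt (Wb L β) (fun _ => ε) t) = diagonal (fun k => Real.exp (-t k)) * Dmat β ε t *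
      diagonal (fun k => Real.exp (-t k)) := by
  ext j k
  rw [Dmat_eq, mul_diagonal, diagonal_mul, mul_diagonal, diagonal_mul]
  have h1 : ∀ k, Real.exp (t k) * Real.exp (-t k) = 1 := fun k => by rw [← Real.exp_add]; simp
  linear_combination (-(Hm (Wb L β) (Bt (Wb L β) (fun _ => ε) t) j k) * Real.exp (t j) * Real.exp (-t j)) * h1 k
    - (Hm (Wb L β) (Bt (Wb L β) (fun _ => ε) t) j k) * h1 j

lemma exp_neg_freeEnergy {β ε : ℝ} (hβ : 0 ≤ β) (hε : 0 < ε) (t : Torus L → ℝ) :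
    Real.exp (-(freeEnergy β ε t)) * ((Real.sqrt (2 * Real.pi))⁻¹) ^ (Fintype.card (Torus L)) =
      wt (Wb L β) (fun _ => ε) t := by
  rw [wt_eq _ (Wb_symm β) (Wb_nonneg hβ) (Wb_diag β) _ (fun _ => hε)]
  congr 1
  have hp := (Hm_Bt_posDef _ (Wb_symm (L := L) β) (Wb_nonneg hβ) (Wb_diag β) _ (fun _ => hε) t).det_pos
  set d := (Hm (Wb L β) (Bt (Wb L β) (fun _ => ε) t)).det with hd
  have hdet : (Dmat β ε t).det = Real.exp (∑ k, t k) ^ 2 * d := by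
    rw [Dmat_eq, det_mul, det_mul, det_diagonal, Real.exp_sum]; ring
  have hlog : Real.log (Dmat β ε t).det = 2 * (∑ k, t k) + Real.log d := by
    rw [hdet, Real.log_mul (by positivity) hp.ne', Real.log_pow, Real.log_exp]; norm_num
  have hsq : Real.sqrt d = Real.exp (1/2 * Real.log d) := by
    rw [Real.sqrt_eq_rpow, Real.rpow_def_of_pos hp]; ring_nf
  rw [hsq, ← Real.exp_add]
  congr 1
  have hnn : β * nnSum (fun i j => Real.cosh (t i - t j) - 1) =
      (1/2) * ∑ j, ∑ k, Wb L β j k * (Real.cosh (t j - t k) - 1) := by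
    rw [nnSum, mul_left_comm, Finset.mul_sum]
    congr 1
    refine Finset.sum_congr rfl fun j _ => ?_
    rw [Finset.mul_sum]
    refine Finset.sum_congr rfl fun k _ => ?_
    unfold Wb; split_ifs <;> simp
  rw [freeEnergy, hlog, hnn]
  have : ∑ k : Torus L, (t k - ε + ε * Real.cosh (t k)) = ∑ k, t k + ∑ k, (ε * Real.cosh (t k) - ε) := by
    rw [← Finset.sum_add_distrib]; refine Finset.sum_congr rfl fun k _ => ?_; ring
  rw [this]; ring

/-- the measure -/
def mu (L : ℕ) [NeZero L] (β ε : ℝ) : Measure (Torus L → ℝ) :=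
  volume.withDensity (fun t => ENNReal.ofReal (wt (Wb L β) (fun _ => ε) t))

lemma Bt_meas (W : Torus L → Torus L → ℝ) (η : Torus L → ℝ) : Measurable (Bt W η) := by
  have : Continuous (Bt W η) := by
    unfold Bt; fun_prop
  exact this.measurable

lemma wt_meas (β ε : ℝ) : Measurable (wt (Wb L β) (fun _ => ε)) := by
  have h1 := Bt_meas (Wb L β) (fun _ => ε)
  exact (((Hm_cont (Wb L β)).matrix_det.measurable).comp h1).mul ((dens_meas _ (Wb_symm β) _).comp h1)

lemma wt_nonneg {β ε : ℝ} (hβ : 0 ≤ β) (hε : 0 < ε) (t : Torus L → ℝ) : 0 ≤ wt (Wb L β) (fun _ => ε) t := by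
  rw [← exp_neg_freeEnergy hβ hε]; positivity

lemma expect_eq {β ε : ℝ} (hβ : 0 ≤ β) (hε : 0 < ε) (f : (Torus L → ℝ) → ℝ) :
    expect β ε f = ∫ t, f t ∂(mu L β ε) := by
  rw [mu, integral_withDensity_eq_integral_toReal_smul (wt_meas β ε).ennreal_ofReal (by simp), expect]
  congr 1; ext t
  rw [mul_assoc, exp_neg_freeEnergy hβ hε, ENNReal.toReal_ofReal (wt_nonneg hβ hε t), smul_eq_mul, mul_comm]

lemma lint_mu {β ε : ℝ} (hβ : 0 ≤ β) (hε : 0 < ε) (y : Torus L) (Φ : ℝ × ℝ → ENNReal) (hΦ : Measurable Φ) :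
    ∫⁻ t, Φ (Real.exp (t y), Real.exp (2 * t y) * (Dmat β ε t)⁻¹ y y) ∂(mu L β ε) =
    ∫⁻ B, ENNReal.ofReal (dens (Wb L β) (fun _ => ε) B) *
      Φ (((Hm (Wb L β) B)⁻¹ *ᵥ (fun _ => ε)) y, (Hm (Wb L β) B)⁻¹ y y) := by
  rw [change_var _ (Wb_symm β) (Wb_nonneg hβ) (Wb_diag β) _ (fun _ => hε)]
  have key : ∀ t : Torus L → ℝ, (Hm (Wb L β) (Bt (Wb L β) (fun _ => ε) t))⁻¹ y y =
      Real.exp (2 * t y) * (Dmat β ε t)⁻¹ y y := by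
    intro t
    rw [Hm_eq, Matrix.mul_inv_rev, Matrix.mul_inv_rev]
    have hdi : (diagonal (fun k => Real.exp (-t k)))⁻¹ = diagonal (fun k => Real.exp (t k)) := by
      apply inv_eq_left_inv
      rw [diagonal_mul_diagonal, ← diagonal_one]
      congr 1; ext k; rw [← Real.exp_add]; simp
    rw [hdi, ← Matrix.mul_assoc, mul_diagonal, diagonal_mul, two_mul, Real.exp_add]; ring
  have h2 : ∀ t : Torus L → ℝ, ((Hm (Wb L β) (Bt (Wb L β) (fun _ => ε) t))⁻¹ *ᵥ (fun _ => ε)) y = Real.exp (t y) := by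
    intro t
    rw [psi_eq _ (Wb_symm β) (Wb_nonneg hβ) (Wb_diag β) _ (fun _ => hε)]
  rw [mu, lintegral_withDensity_eq_lintegral_mul₀ (wt_meas β ε).ennreal_ofReal.aemeasurable]
  · simp only [Pi.mul_apply, key, h2]
  · simp only [← key, ← h2]
    have := (hΦ.comp ((Hm_invVec_meas (Wb L β) (fun _ => ε) y).prodMk (Hm_inv_meas (Wb L β) y y))).comp (Bt_meas (Wb L β) (fun _ => ε))
    exact this.aemeasurable

lemma mu_prob {β ε : ℝ} (hβ : 0 ≤ β) (hε : 0 < ε) : IsProbabilityMeasure (mu L β ε) := by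
  constructor
  have h := lint_mu hβ hε (0 : Torus L) (fun _ => 1) measurable_const
  simp only [mul_one, lintegral_one] at h
  rw [h]
  exact mass_one _ _ rfl _ (Wb_symm β) (Wb_nonneg hβ) _ (fun _ => hε)

lemma compare_mu {β ε : ℝ} (hβ : 0 ≤ β) (hε : 0 < ε) (y : Torus L) (Φ Ψ : ℝ × ℝ → ENNReal)
    (hΦ : Measurable Φ) (hΨ : Measurable Ψ)
    (h : ∀ e, ε ≤ e → ∫⁻ s in Set.Ioi 0, ENNReal.ofReal (rd e s) * Φ (e / s, 1 / s) ≤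
      ∫⁻ s in Set.Ioi 0, ENNReal.ofReal (rd e s) * Ψ (e / s, 1 / s)) :
    ∫⁻ t, Φ (Real.exp (t y), Real.exp (2 * t y) * (Dmat β ε t)⁻¹ y y) ∂(mu L β ε) ≤
    ∫⁻ t, Ψ (Real.exp (t y), Real.exp (2 * t y) * (Dmat β ε t)⁻¹ y y) ∂(mu L β ε) := by
  rw [lint_mu hβ hε y Φ hΦ, lint_mu hβ hε y Ψ hΨ]
  exact compare _ (Wb_symm β) (Wb_nonneg hβ) _ (fun _ => hε) y Φ Ψ hΦ hΨ h

end torus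
end QD

namespace QD
section moments
open Matrix

lemma exp_div (e u : ℝ) (he : 0 < e) : e / (e * Real.exp (-u)) = Real.exp u := by
  rw [Real.exp_neg]; field_simp

variable [NeZero L]

lemma mom_le {β ε : ℝ} (hβ : 0 ≤ β) (hε : 0 < ε) (y : Torus L) (p q : ℝ)
    (h : ∀ e, ε ≤ e → Im p e ≤ Im q e) :
    ∫⁻ t, ENNReal.ofReal (Real.exp (p * t y)) ∂(mu L β ε) ≤
      ∫⁻ t, ENNReal.ofReal (Real.exp (q * t y)) ∂(mu L β ε) := by
  have := compare_mu hβ hε y (fun a => ENNReal.ofReal (a.1 ^ p)) (fun a => ENNReal.ofReal (a.1 ^ q))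
    (by fun_prop) (by fun_prop) (by
      intro e he
      have he0 : 0 < e := hε.trans_le he
      have hm : ∀ p : ℝ, ∫⁻ s in Set.Ioi 0, ENNReal.ofReal (rd e s) * ENNReal.ofReal ((e / s) ^ p) = ENNReal.ofReal (Im p e) := by
        intro p
        refine rd_mom p he0 (φ := fun s => ENNReal.ofReal ((e / s) ^ p)) fun u => ?_
        rw [exp_div e u he0, ← Real.exp_mul, mul_comm]
      simp only [hm]
      exact ENNReal.ofReal_le_ofReal (h e he))
  simp only [← Real.exp_mul] at this
  simpa [mul_comm] using this

lemma mom_eq {β ε : ℝ} (hβ : 0 ≤ β) (hε : 0 < ε) (y : Torus L) (p q : ℝ)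
    (h : ∀ e, ε ≤ e → Im p e = Im q e) :
    ∫⁻ t, ENNReal.ofReal (Real.exp (p * t y)) ∂(mu L β ε) =
      ∫⁻ t, ENNReal.ofReal (Real.exp (q * t y)) ∂(mu L β ε) :=
  le_antisymm (mom_le hβ hε y p q fun e he => (h e he).le) (mom_le hβ hε y q p fun e he => (h e he).ge)

lemma mom_neg4_fin {β ε : ℝ} (hβ : 0 ≤ β) (hε : 0 < ε) (y : Torus L) :
    ∫⁻ t, ENNReal.ofReal (Real.exp (-4 * t y)) ∂(mu L β ε) < ⊤ := by
  have := mu_prob (L := L) hβ hε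
  have := compare_mu hβ hε y (fun a => ENNReal.ofReal (a.1 ^ (-4 : ℝ))) (fun _ => ENNReal.ofReal ((1 + 3 / ε * (1 + 1/ε)) + 7 / ε * ((1 + 1/ε) + 5 / ε * (1 + 3 / ε * (1 + 1/ε)))))
    (by fun_prop) (by fun_prop) (by
      intro e he
      have he0 : 0 < e := hε.trans_le he
      have hm : ∫⁻ s in Set.Ioi 0, ENNReal.ofReal (rd e s) * ENNReal.ofReal ((e / s) ^ (-4:ℝ)) = ENNReal.ofReal (Im (-4) e) := by
        refine rd_mom (-4) he0 (φ := fun s => ENNReal.ofReal ((e / s) ^ (-4:ℝ))) fun u => ?_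
        rw [exp_div e u he0, ← Real.exp_mul, mul_comm]
      have h1 := rd_mom 0 he0 (φ := fun _ => 1) (by simp)
      rw [Im_zero he0] at h1
      simp only [mul_one] at h1
      rw [hm, lintegral_mul_const' _ _ ENNReal.ofReal_ne_top, h1]
      simp only [ENNReal.ofReal_one, one_mul]
      exact ENNReal.ofReal_le_ofReal (Im_neg4_le hε he))
  simp only [← Real.exp_mul, lintegral_const, measure_univ, mul_one] at this
  refine lt_of_le_of_lt ?_ (lt_of_le_of_lt this ENNReal.ofReal_lt_top)
  refine le_of_eq ?_
  congr 1; ext t; ring_nf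

lemma mom_neg4_rec {β ε : ℝ} (hβ : 0 ≤ β) (hε : 0 < ε) (y : Torus L) :
    ∫⁻ t, ENNReal.ofReal (Real.exp (-4 * t y)) ∂(mu L β ε) ≤
    ∫⁻ t, (ENNReal.ofReal (Real.exp (-2 * t y)) + ENNReal.ofReal (7 * (Real.exp (-2 * t y) * (Dmat β ε t)⁻¹ y y))) ∂(mu L β ε) := by
  have := compare_mu hβ hε y (fun a => ENNReal.ofReal (a.1 ^ (-4 : ℝ)))
    (fun a => ENNReal.ofReal (a.1 ^ (-2 : ℝ)) + ENNReal.ofReal (7 * (a.1 ^ (-4 : ℝ) * a.2)))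
    (by fun_prop) (by fun_prop) (by
      intro e he
      have he0 : 0 < e := hε.trans_le he
      have hm : ∀ p : ℝ, ∫⁻ s in Set.Ioi 0, ENNReal.ofReal (rd e s) * ENNReal.ofReal ((e / s) ^ p) = ENNReal.ofReal (Im p e) := by
        intro p
        refine rd_mom p he0 (φ := fun s => ENNReal.ofReal ((e / s) ^ p)) fun u => ?_
        rw [exp_div e u he0, ← Real.exp_mul, mul_comm]
      have hm2 : ∫⁻ s in Set.Ioi 0, ENNReal.ofReal (rd e s) * ENNReal.ofReal (7 * ((e / s) ^ (-4 : ℝ) * (1/s))) = ENNReal.ofReal (7 / e * Im (-3) e) := by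
        rw [rd_link he0 (fun s => ENNReal.ofReal (7 * ((e / s) ^ (-4 : ℝ) * (1/s)))), ENNReal.ofReal_mul (by positivity),
          ← lint_gd _ he0, ← lintegral_const_mul' _ _ ENNReal.ofReal_ne_top]
        congr 1; ext u
        rw [exp_div e u he0, mul_left_comm (ENNReal.ofReal (7 / e)), ← ENNReal.ofReal_mul (p := 7 / e) (by positivity)]
        congr 2
        rw [← Real.exp_mul, one_div, mul_inv, ← Real.exp_neg, neg_neg]
        have : Real.exp (-3 * u) = Real.exp (u * -4) * Real.exp u := by rw [← Real.exp_add]; ring_nf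
        rw [this]; field_simp
      simp only [mul_add]
      rw [lintegral_add_left (by unfold rd; fun_prop)]
      rw [hm, hm, hm2, ← ENNReal.ofReal_add (Im_pos _ he0).le (mul_nonneg (by positivity) (Im_pos _ he0).le)]
      exact ENNReal.ofReal_le_ofReal (Im_neg4_rec he0).le)
  simp only [← Real.exp_mul] at this
  convert this using 4 with t t
  · ring_nf
  · congr 2; ring_nf
  · congr 2
    rw [← mul_assoc, ← Real.exp_add]; ring_nf

/-! real-valued versions -/

lemma exp_coord_meas (a : ℝ) (y : Torus L) : Measurable fun t : Torus L → ℝ => Real.exp (a * t y) := by fun_prop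

lemma integrable_of_lint {μ : Measure (Torus L → ℝ)} {a : ℝ} {y : Torus L}
    (h : ∫⁻ t, ENNReal.ofReal (Real.exp (a * t y)) ∂μ < ⊤) : Integrable (fun t => Real.exp (a * t y)) μ := by
  refine ⟨(exp_coord_meas a y).aestronglyMeasurable, ?_⟩
  rw [hasFiniteIntegral_iff_ofReal (Filter.Eventually.of_forall fun t => (Real.exp_pos _).le)]
  exact h

lemma int_neg4 {β ε : ℝ} (hβ : 0 ≤ β) (hε : 0 < ε) (y : Torus L) :
    Integrable (fun t => Real.exp (-4 * t y)) (mu L β ε) := integrable_of_lint (mom_neg4_fin hβ hε y)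

lemma int_neg_of {β ε : ℝ} (hβ : 0 ≤ β) (hε : 0 < ε) (y : Torus L) (a : ℝ) (h1 : 0 ≤ a) (h2 : a ≤ 4) :
    Integrable (fun t => Real.exp (-a * t y)) (mu L β ε) := by
  have := mu_prob (L := L) hβ hε
  refine ((integrable_const (1:ℝ)).add (int_neg4 hβ hε y)).mono' (exp_coord_meas _ y).aestronglyMeasurable
    (Filter.Eventually.of_forall fun t => ?_)
  rw [Real.norm_eq_abs, Real.abs_exp]
  simp only [Pi.add_apply]
  rcases le_total (t y) 0 with h | h
  · have : Real.exp (-a * t y) ≤ Real.exp (-4 * t y) := Real.exp_le_exp.2 (by nlinarith)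
    linarith
  · have : Real.exp (-a * t y) ≤ Real.exp 0 := Real.exp_le_exp.2 (by nlinarith)
    rw [Real.exp_zero] at this
    have := Real.exp_pos (-4 * t y)
    linarith

lemma pos4 {β ε : ℝ} (hβ : 0 ≤ β) (hε : 0 < ε) (y : Torus L) :
    Integrable (fun t => Real.exp (4 * t y)) (mu L β ε) ∧
    ∫ t, Real.exp (4 * t y) ∂(mu L β ε) = ∫ t, Real.exp (-3 * t y) ∂(mu L β ε) := by
  have h := mom_eq hβ hε y 4 (-3) (fun e he => by rw [← Im_symm]; norm_num)
  have hi := int_neg_of hβ hε y 3 (by norm_num) (by norm_num)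
  constructor
  · refine integrable_of_lint ?_
    rw [h]
    have := hi.2
    rw [hasFiniteIntegral_iff_ofReal (Filter.Eventually.of_forall fun t => (Real.exp_pos _).le)] at this
    exact this
  · rw [integral_eq_lintegral_of_nonneg_ae (Filter.Eventually.of_forall fun t => (Real.exp_pos _).le) (exp_coord_meas _ y).aestronglyMeasurable,
      integral_eq_lintegral_of_nonneg_ae (Filter.Eventually.of_forall fun t => (Real.exp_pos _).le) (exp_coord_meas _ y).aestronglyMeasurable, h]

lemma int_pos_of {β ε : ℝ} (hβ : 0 ≤ β) (hε : 0 < ε) (y : Torus L) (a : ℝ) (h1 : 0 ≤ a) (h2 : a ≤ 4) :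
    Integrable (fun t => Real.exp (a * t y)) (mu L β ε) := by
  have := mu_prob (L := L) hβ hε
  refine ((integrable_const (1:ℝ)).add (pos4 hβ hε y).1).mono' (exp_coord_meas _ y).aestronglyMeasurable
    (Filter.Eventually.of_forall fun t => ?_)
  rw [Real.norm_eq_abs, Real.abs_exp]
  simp only [Pi.add_apply]
  rcases le_total 0 (t y) with h | h
  · have : Real.exp (a * t y) ≤ Real.exp (4 * t y) := Real.exp_le_exp.2 (by nlinarith)
    linarith
  · have : Real.exp (a * t y) ≤ Real.exp 0 := Real.exp_le_exp.2 (by nlinarith)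
    rw [Real.exp_zero] at this
    have := Real.exp_pos (4 * t y)
    linarith

lemma exp_one_eq {β ε : ℝ} (hβ : 0 ≤ β) (hε : 0 < ε) (y : Torus L) :
    ∫ t, Real.exp (t y) ∂(mu L β ε) = 1 := by
  have := mu_prob (L := L) hβ hε
  have h := mom_eq hβ hε y 1 0 (fun e he => by rw [Im_one (hε.trans_le he), Im_zero (hε.trans_le he)])
  simp only [one_mul, zero_mul, Real.exp_zero, ENNReal.ofReal_one, lintegral_one, measure_univ] at h
  have hm : Measurable fun t : Torus L → ℝ => Real.exp (t y) := by fun_prop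
  rw [integral_eq_lintegral_of_nonneg_ae (Filter.Eventually.of_forall fun t => (Real.exp_pos _).le) hm.aestronglyMeasurable, h]
  simp

lemma neg4_le {β ε : ℝ} (hβ : 0 ≤ β) (hε : 0 < ε) (y : Torus L) (G : (Torus L → ℝ) → ℝ)
    (hG : Integrable G (mu L β ε)) (hG0 : ∀ t, 0 ≤ G t)
    (hGD : ∀ t, Real.exp (-2 * t y) * (Dmat β ε t)⁻¹ y y ≤ G t) :
    ∫ t, Real.exp (-4 * t y) ∂(mu L β ε) ≤ ∫ t, Real.exp (-2 * t y) ∂(mu L β ε) + 7 * ∫ t, G t ∂(mu L β ε) := by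
  have h2 := int_neg_of hβ hε y 2 (by norm_num) (by norm_num)
  have h3 : Integrable (fun t => Real.exp (-2 * t y) + 7 * G t) (mu L β ε) := h2.add (hG.const_mul 7)
  rw [← integral_const_mul, ← integral_add h2 (hG.const_mul 7)]
  rw [← ENNReal.ofReal_le_ofReal_iff (integral_nonneg fun t => add_nonneg (Real.exp_pos _).le (mul_nonneg (by norm_num) (hG0 t))),
    ofReal_integral_eq_lintegral_ofReal (int_neg4 hβ hε y) (Filter.Eventually.of_forall fun t => (Real.exp_pos _).le),
    ofReal_integral_eq_lintegral_ofReal h3 (Filter.Eventually.of_forall fun t => add_nonneg (Real.exp_pos _).le (mul_nonneg (by norm_num) (hG0 t)))]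
  refine (mom_neg4_rec hβ hε y).trans (lintegral_mono fun t => ?_)
  rw [ENNReal.ofReal_add (Real.exp_pos _).le (mul_nonneg (by norm_num) (hG0 t))]
  refine add_le_add le_rfl (ENNReal.ofReal_le_ofReal ?_)
  have := hGD t
  linarith

end moments
end QD

namespace QD
/-! ### Part D: kernels and flows -/
section oneD

def cnt (L : ℕ) (S : Finset ℤ) (z : ZMod L) : ℝ := ∑ j ∈ S, if ((j : ℤ) : ZMod L) = z then (1:ℝ) else 0

lemma cnt_nonneg (S : Finset ℤ) (z : ZMod L) : 0 ≤ cnt L S z :=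
  Finset.sum_nonneg fun j _ => by split_ifs <;> norm_num

lemma cnt_mono {S T : Finset ℤ} (h : S ⊆ T) (z : ZMod L) : cnt L S z ≤ cnt L T z :=
  Finset.sum_le_sum_of_subset_of_nonneg h fun j _ _ => by split_ifs <;> norm_num

lemma cnt_shift (S : Finset ℤ) (z : ZMod L) (c : ℤ) :
    cnt L S (z + c) = cnt L (S.image (fun j => j - c)) z := by
  unfold cnt
  rw [Finset.sum_image (by intro a _ b _ h; simpa using h)]
  refine Finset.sum_congr rfl fun j _ => ?_
  congr 1
  rw [Int.cast_sub, sub_eq_iff_eq_add]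

lemma cnt_shift_le {S T : Finset ℤ} (z : ZMod L) (c : ℤ) (h : ∀ j ∈ S, j - c ∈ T) :
    cnt L S (z + c) ≤ cnt L T z := by
  rw [cnt_shift]
  refine cnt_mono ?_ z
  intro j hj
  obtain ⟨i, hi, rfl⟩ := Finset.mem_image.1 hj
  exact h i hi

lemma cnt_sum [NeZero L] (S : Finset ℤ) (f : ZMod L → ℝ) : ∑ z, cnt L S z * f z = ∑ j ∈ S, f (j : ZMod L) := by
  simp only [cnt, Finset.sum_mul]
  rw [Finset.sum_comm]
  refine Finset.sum_congr rfl fun j _ => ?_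
  simp

def Sn (n : ℕ) : Finset ℤ := Finset.Ico 0 (2^n)
def Tn (n : ℕ) : Finset ℤ := Finset.Icc (-2^n) (2^n)

lemma Sn_card (n : ℕ) : (Sn n).card = 2^n := by
  unfold Sn; rw [Int.card_Ico]
  have : ((2:ℤ)^n - 0) = ((2^n : ℕ) : ℤ) := by push_cast; ring
  rw [this, Int.toNat_natCast]
lemma Tn_card_le (n : ℕ) : ((Tn n).card : ℝ) ≤ 3 * 2^n := by
  unfold Tn; rw [Int.card_Icc]
  have h1 : ((2:ℤ)^n + 1 - -2^n).toNat = 2^n + 1 + 2^n := by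
    have : ((2:ℤ)^n + 1 - -2^n) = ((2^n + 1 + 2^n : ℕ) : ℤ) := by push_cast; ring
    rw [this, Int.toNat_natCast]
  rw [h1]
  have : (1:ℝ) ≤ 2^n := one_le_pow₀ (by norm_num)
  push_cast; linarith

def An (L n : ℕ) (z : ZMod L) : ℝ := (2^n)⁻¹ * cnt L (Sn n) z
def Pn (L n : ℕ) (z : ZMod L) : ℝ := (2^n)⁻¹ * cnt L (Tn n) z
def Fn (L n : ℕ) (z : ZMod L) : ℝ := (4^n)⁻¹ * ∑ j ∈ Sn n, cnt L (Sn n) (z + (j : ℤ))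
def tau (L n : ℕ) (z : ZMod L) : ℝ := (1/2) * (2^n)⁻¹ * ∑ i ∈ Sn n, cnt L (Sn n) (z - (i : ℤ))

lemma An_nonneg (n : ℕ) (z : ZMod L) : 0 ≤ An L n z := mul_nonneg (by positivity) (cnt_nonneg _ _)
lemma Pn_nonneg (n : ℕ) (z : ZMod L) : 0 ≤ Pn L n z := mul_nonneg (by positivity) (cnt_nonneg _ _)
lemma Fn_nonneg (n : ℕ) (z : ZMod L) : 0 ≤ Fn L n z :=
  mul_nonneg (by positivity) (Finset.sum_nonneg fun _ _ => cnt_nonneg _ _)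
lemma tau_nonneg (n : ℕ) (z : ZMod L) : 0 ≤ tau L n z :=
  mul_nonneg (by positivity) (Finset.sum_nonneg fun _ _ => cnt_nonneg _ _)

lemma two_pow_pos' (n : ℕ) : (0:ℤ) < 2^n := by positivity

lemma An_le_Pn (n : ℕ) (z : ZMod L) : An L n z ≤ Pn L n z := by
  refine mul_le_mul_of_nonneg_left (cnt_mono ?_ z) (by positivity)
  intro j hj
  simp only [Sn, Tn, Finset.mem_Ico, Finset.mem_Icc] at hj ⊢
  have := two_pow_pos' n
  omega

lemma Tn_sub (n : ℕ) : Tn n ⊆ Tn (n+1) := by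
  intro j hj
  simp only [Tn, Finset.mem_Icc, pow_succ] at hj ⊢
  have := two_pow_pos' n
  omega

lemma Pn_le_succ (n : ℕ) (z : ZMod L) : Pn L n z ≤ 2 * Pn L (n+1) z := by
  unfold Pn
  have h := cnt_mono (Tn_sub n) z
  have : 2 * ((2^(n+1))⁻¹ * cnt L (Tn (n+1)) z) = (2^n)⁻¹ * cnt L (Tn (n+1)) z := by
    rw [pow_succ, mul_inv]; ring
  rw [this]
  exact mul_le_mul_of_nonneg_left h (by positivity)

lemma Fn_le_Pn (n : ℕ) (z : ZMod L) : Fn L n z ≤ Pn L n z := by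
  unfold Fn Pn
  have h : ∑ j ∈ Sn n, cnt L (Sn n) (z + (j : ℤ)) ≤ ∑ j ∈ Sn n, cnt L (Tn n) z := by
    refine Finset.sum_le_sum fun j hj => cnt_shift_le z j fun i hi => ?_
    simp only [Sn, Tn, Finset.mem_Ico, Finset.mem_Icc] at hj hi ⊢
    omega
  rw [Finset.sum_const, Sn_card, nsmul_eq_mul] at h
  calc _ ≤ ((4:ℝ)^n)⁻¹ * (((2^n : ℕ) : ℝ) * cnt L (Tn n) z) := mul_le_mul_of_nonneg_left h (by positivity)
    _ = _ := by
      rw [show (4:ℝ) = 2 * 2 by norm_num, mul_pow]; push_cast; field_simp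

lemma tau_le (n : ℕ) (z : ZMod L) : tau L n z ≤ 2^n * Pn L (n+1) z := by
  unfold tau Pn
  have h : ∑ i ∈ Sn n, cnt L (Sn n) (z - (i : ℤ)) ≤ ∑ j ∈ Sn n, cnt L (Tn (n+1)) z := by
    refine Finset.sum_le_sum fun j hj => ?_
    have := cnt_shift_le (L := L) (S := Sn n) (T := Tn (n+1)) z (-j) (fun i hi => by
      simp only [Sn, Tn, Finset.mem_Ico, Finset.mem_Icc, pow_succ] at hj hi ⊢
      omega)
    simpa [sub_eq_add_neg] using this
  rw [Finset.sum_const, Sn_card, nsmul_eq_mul] at h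
  calc _ ≤ (1/2) * ((2:ℝ)^n)⁻¹ * (((2^n : ℕ) : ℝ) * cnt L (Tn (n+1)) z) := mul_le_mul_of_nonneg_left h (by positivity)
    _ = _ := by
      push_cast; rw [pow_succ]; field_simp

lemma Pn_neg (n : ℕ) (z : ZMod L) : Pn L n (-z) = Pn L n z := by
  unfold Pn cnt
  congr 1
  refine Finset.sum_nbij' (fun j => -j) (fun j => -j) ?_ ?_ ?_ ?_ ?_
  · intro j hj; simp only [Tn, Finset.mem_Icc] at hj ⊢; omega
  · intro j hj; simp only [Tn, Finset.mem_Icc] at hj ⊢; omega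
  · intro j _; simp
  · intro j _; simp
  · intro j _
    congr 1
    rw [Int.cast_neg, neg_eq_iff_eq_neg]

lemma Fn_neg (n : ℕ) (z : ZMod L) : Fn L n (-z) = Fn L n z := by
  unfold Fn cnt
  congr 1
  rw [Finset.sum_comm]
  refine Finset.sum_congr rfl fun j _ => Finset.sum_congr rfl fun k _ => ?_
  congr 1
  apply propext
  constructor
  · intro h; rw [h]; ring
  · intro h; rw [h]; ring

lemma Pn_conv [NeZero L] {m n : ℕ} (hmn : m ≤ n) (x x' : ZMod L) :
    ∑ z, Pn L n (z - x) * Pn L m (z - x') ≤ 6 * Pn L (n+1) (x' - x) := by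
  have h1 : ∑ z, Pn L n (z - x) * Pn L m (z - x') = (2^m)⁻¹ * ∑ k ∈ Tn m, Pn L n (x' - x + k) := by
    rw [← cnt_sum (Tn m) (fun z => Pn L n (x' - x + z)), ← Equiv.sum_comp (Equiv.addRight x')]
    rw [Finset.mul_sum]
    refine Finset.sum_congr rfl fun z _ => ?_
    simp only [Equiv.coe_addRight, add_sub_cancel_right]
    rw [show z + x' - x = x' - x + z by ring, Pn, Pn]; ring
  have h2 : ∑ k ∈ Tn m, Pn L n (x' - x + k) ≤ ∑ k ∈ Tn m, 2 * Pn L (n+1) (x' - x) := by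
    refine Finset.sum_le_sum fun k hk => ?_
    unfold Pn
    have : 2 * ((2^(n+1))⁻¹ * cnt L (Tn (n+1)) (x' - x)) = (2^n)⁻¹ * cnt L (Tn (n+1)) (x' - x) := by
      rw [pow_succ, mul_inv]; ring
    rw [this]
    refine mul_le_mul_of_nonneg_left (cnt_shift_le _ k fun i hi => ?_) (by positivity)
    have hp : (2:ℤ)^m ≤ 2^n := pow_le_pow_right₀ (by norm_num) hmn
    simp only [Tn, Finset.mem_Icc, pow_succ] at hk hi ⊢
    omega
  rw [h1]
  rw [Finset.sum_const, nsmul_eq_mul] at h2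
  have h3 := Tn_card_le m
  have hP := Pn_nonneg (L := L) (n+1) (x' - x)
  calc _ ≤ ((2:ℝ)^m)⁻¹ * ((3 * 2^m) * (2 * Pn L (n+1) (x' - x))) := by
        refine mul_le_mul_of_nonneg_left (h2.trans ?_) (by positivity)
        exact mul_le_mul_of_nonneg_right h3 (by positivity)
    _ = _ := by field_simp; ring

lemma Pn_le_Fn (n : ℕ) (z : ZMod L) : Pn L n z ≤ 4 * Fn L (n+1) z := by
  have key : 2^n * cnt L (Tn n) z ≤ ∑ j ∈ Sn (n+1), cnt L (Sn (n+1)) (z + (j : ℤ)) := by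
    have h1 : (2:ℝ)^n * cnt L (Tn n) z = ∑ p ∈ Sn n ×ˢ Tn n, if ((p.2 : ℤ) : ZMod L) = z then (1:ℝ) else 0 := by
      rw [Finset.sum_product]
      change _ = ∑ _x ∈ Sn n, cnt L (Tn n) z
      rw [Finset.sum_const, Sn_card, nsmul_eq_mul]; push_cast; rfl
    have h2 : ∑ j ∈ Sn (n+1), cnt L (Sn (n+1)) (z + (j : ℤ)) =
        ∑ p ∈ Sn (n+1) ×ˢ Sn (n+1), if ((p.2 : ℤ) : ZMod L) = z + ((p.1 : ℤ) : ZMod L) then (1:ℝ) else 0 := by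
      rw [Finset.sum_product]; rfl
    have hinj : Set.InjOn (fun p : ℤ × ℤ => (p.1 + max (-p.2) 0, p.1 + max p.2 0)) (Sn n ×ˢ Tn n : Finset (ℤ × ℤ)) := by
      rintro ⟨a, b⟩ _ ⟨c, d⟩ _ h
      simp only [Prod.mk.injEq] at h ⊢
      omega
    rw [h1, h2]
    calc _ = ∑ p ∈ (Sn n ×ˢ Tn n).image (fun p : ℤ × ℤ => (p.1 + max (-p.2) 0, p.1 + max p.2 0)),
          (if ((p.2 : ℤ) : ZMod L) = z + ((p.1 : ℤ) : ZMod L) then (1:ℝ) else 0) := by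
          rw [Finset.sum_image hinj]
          refine Finset.sum_congr rfl fun p _ => ?_
          congr 1
          apply propext
          have : p.2 = (p.1 + max p.2 0) - (p.1 + max (-p.2) 0) := by omega
          conv_lhs => rw [this, Int.cast_sub]
          exact sub_eq_iff_eq_add
      _ ≤ _ := by
          refine Finset.sum_le_sum_of_subset_of_nonneg ?_ fun p _ _ => by split_ifs <;> norm_num
          intro p hp
          obtain ⟨⟨a, b⟩, hq, rfl⟩ := Finset.mem_image.1 hp
          simp only [Finset.mem_product, Sn, Tn, Finset.mem_Ico, Finset.mem_Icc, pow_succ] at hq ⊢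
          omega
  unfold Pn Fn
  calc _ = ((4:ℝ)^n)⁻¹ * (2^n * cnt L (Tn n) z) := by
        rw [show (4:ℝ) = 2 * 2 by norm_num, mul_pow]; field_simp
    _ ≤ ((4:ℝ)^n)⁻¹ * _ := mul_le_mul_of_nonneg_left key (by positivity)
    _ = _ := by rw [pow_succ, mul_inv]; ring

lemma Fn_grad (n : ℕ) (z : ZMod L) : |Fn L n (z + 1) - Fn L n z| ≤ 2 * (2^n)⁻¹ * Pn L n z := by
  have h1 : ∑ j ∈ Sn n, cnt L (Sn n) (z + 1 + (j : ℤ)) - ∑ j ∈ Sn n, cnt L (Sn n) (z + (j : ℤ)) =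
      cnt L (Sn n) (z + ((2^n : ℤ) : ZMod L)) - cnt L (Sn n) z := by
    have : ∀ M : ℕ, ∑ j ∈ Finset.Ico (0:ℤ) M, (cnt L (Sn n) (z + 1 + (j : ℤ)) - cnt L (Sn n) (z + (j : ℤ))) =
       cnt L (Sn n) (z + ((M : ℤ) : ZMod L)) - cnt L (Sn n) z := by
      intro M
      induction M with
      | zero => simp
      | succ M ih =>
        have : Finset.Ico (0:ℤ) ((M+1 : ℕ) : ℤ) = insert (M : ℤ) (Finset.Ico (0:ℤ) M) := by
          ext j; simp only [Finset.mem_Ico, Finset.mem_insert]; push_cast; omega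
        rw [this, Finset.sum_insert (by simp), ih]
        push_cast
        rw [show z + 1 + (M : ZMod L) = z + ((M : ZMod L) + 1) by ring]
        ring
    rw [← Finset.sum_sub_distrib]
    have h := this (2^n)
    push_cast at h ⊢
    exact h
  have h2 : cnt L (Sn n) (z + ((2^n : ℤ) : ZMod L)) ≤ cnt L (Tn n) z := by
    refine cnt_shift_le z (2^n) fun i hi => ?_
    simp only [Sn, Tn, Finset.mem_Ico, Finset.mem_Icc] at hi ⊢
    omega
  have h3 : cnt L (Sn n) z ≤ cnt L (Tn n) z := by
    refine cnt_mono ?_ z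
    intro j hj
    simp only [Sn, Tn, Finset.mem_Ico, Finset.mem_Icc] at hj ⊢
    have := two_pow_pos' n
    omega
  have h4 := cnt_nonneg (Sn n) z
  have h5 := cnt_nonneg (Sn n) (z + ((2^n : ℤ) : ZMod L))
  have h6 : |Fn L n (z + 1) - Fn L n z| = (4^n)⁻¹ * |cnt L (Sn n) (z + ((2^n : ℤ) : ZMod L)) - cnt L (Sn n) z| := by
    unfold Fn; rw [← mul_sub, h1, abs_mul, abs_of_pos (by positivity)]
  rw [h6]
  have h7 : |cnt L (Sn n) (z + ((2^n : ℤ) : ZMod L)) - cnt L (Sn n) z| ≤ 2 * cnt L (Tn n) z := by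
    rw [abs_le]; constructor <;> linarith
  calc _ ≤ ((4:ℝ)^n)⁻¹ * (2 * cnt L (Tn n) z) := mul_le_mul_of_nonneg_left h7 (by positivity)
    _ = _ := by
      unfold Pn
      rw [show (4:ℝ) = 2 * 2 by norm_num, mul_pow]; field_simp

lemma periodic_double [NeZero L] (f : ZMod L → ℝ) (hf : ∀ z, 0 ≤ f z) (n : ℕ) (hn : L ≤ 2^n) :
    ∑ j ∈ Sn (n+1), f (j : ℤ) ≤ 3 * ∑ j ∈ Sn n, f (j : ℤ) := by
  set q : ℤ := L * ((2^n) / (L:ℤ)) with hq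
  have hL : (0:ℤ) < L := by exact_mod_cast NeZero.pos L
  have hn' : (L:ℤ) ≤ 2^n := by exact_mod_cast hn
  have hq1 : q ≤ 2^n := Int.mul_ediv_self_le hL.ne'
  have hq2 : 2^n < q + L := Int.lt_mul_ediv_self_add hL
  have hq3 : (L:ℤ) ≤ q := by
    have : 1 ≤ (2^n : ℤ) / L := (Int.le_ediv_iff_mul_le hL).2 (by linarith)
    nlinarith
  have hqc : ((q : ℤ) : ZMod L) = 0 := by rw [hq]; simp
  have hsh : ∀ c : ℤ, ((c : ℤ) : ZMod L) = 0 → ∑ j ∈ (Sn n).image (fun j => j + c), f (j : ℤ) = ∑ j ∈ Sn n, f (j : ℤ) := by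
    intro c hc
    rw [Finset.sum_image (by intro a _ b _ h; simpa using h)]
    refine Finset.sum_congr rfl fun j _ => ?_
    rw [Int.cast_add, hc, add_zero]
  have hsub : Sn (n+1) ⊆ (Sn n ∪ (Sn n).image (fun j => j + q)) ∪ (Sn n).image (fun j => j + 2 * q) := by
    intro j hj
    simp only [Sn, Finset.mem_union, Finset.mem_image, Finset.mem_Ico, pow_succ] at hj ⊢
    by_cases h1 : j < 2^n
    · left; left; omega
    · by_cases h2 : j < 2^n + q
      · left; right; exact ⟨j - q, by omega, by omega⟩
      · right; exact ⟨j - 2*q, by omega, by omega⟩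
  have hU : ∀ S T : Finset ℤ, ∑ j ∈ S ∪ T, f (j : ℤ) ≤ ∑ j ∈ S, f (j : ℤ) + ∑ j ∈ T, f (j : ℤ) := by
    intro S T
    rw [← Finset.sum_union_inter]
    have : 0 ≤ ∑ j ∈ S ∩ T, f (j : ℤ) := Finset.sum_nonneg fun _ _ => hf _
    linarith
  have e1 := Finset.sum_le_sum_of_subset_of_nonneg hsub (f := fun j => f (j : ℤ)) (fun j _ _ => hf _)
  have e2 := hU (Sn n ∪ (Sn n).image (fun j => j + q)) ((Sn n).image (fun j => j + 2 * q))
  have e3 := hU (Sn n) ((Sn n).image (fun j => j + q))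
  rw [hsh q hqc] at e3
  rw [hsh (2*q) (by rw [Int.cast_mul, hqc, mul_zero])] at e2
  linarith

lemma Fn_top [NeZero L] (n : ℕ) (hn : L ≤ 2^n) (z : ZMod L) : Fn L (n+1) z ≤ (9/4) * Fn L n z := by
  unfold Fn
  have hc : ∀ w, cnt L (Sn (n+1)) w ≤ 3 * cnt L (Sn n) w := fun w =>
    periodic_double (fun z => if z = w then (1:ℝ) else 0) (fun z => by split_ifs <;> norm_num) n hn
  have h1 := periodic_double (fun w => cnt L (Sn (n+1)) (z + w)) (fun _ => cnt_nonneg _ _) n hn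
  have h2 : ∑ j ∈ Sn n, cnt L (Sn (n+1)) (z + (j:ℤ)) ≤ 3 * ∑ j ∈ Sn n, cnt L (Sn n) (z + (j:ℤ)) := by
    rw [Finset.mul_sum]; exact Finset.sum_le_sum fun j _ => hc _
  rw [pow_succ, mul_inv]
  have h3 : ∑ j ∈ Sn (n+1), cnt L (Sn (n+1)) (z + (j:ℤ)) ≤ 9 * ∑ j ∈ Sn n, cnt L (Sn n) (z + (j:ℤ)) := by linarith
  calc _ ≤ ((4:ℝ)^n)⁻¹ * 4⁻¹ * (9 * ∑ j ∈ Sn n, cnt L (Sn n) (z + (j:ℤ))) := mul_le_mul_of_nonneg_left h3 (by positivity)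
    _ = _ := by ring

lemma cnt_Sn_le [NeZero L] (n : ℕ) (z : ZMod L) : cnt L (Sn n) z ≤ 2^n / L + 1 := by
  have hL : (0:ℤ) < L := by exact_mod_cast NeZero.pos L
  have h1 : cnt L (Sn n) z = (((Sn n).filter (fun j : ℤ => ((j:ℤ) : ZMod L) = z)).card : ℝ) := by
    rw [cnt, Finset.sum_ite]; simp
  -- injection j ↦ j / L on the filtered set
  have h2 : ((Sn n).filter (fun j : ℤ => ((j:ℤ) : ZMod L) = z)).card ≤ (Finset.Icc (0:ℤ) ((2^n - 1) / L)).card := by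
    refine Finset.card_le_card_of_injOn (fun j => j / (L:ℤ)) ?_ ?_
    · intro j hj
      simp only [Finset.coe_filter, Sn, Finset.mem_Ico, Set.mem_setOf_eq] at hj
      simp only [Finset.coe_Icc, Set.mem_Icc]
      exact ⟨Int.ediv_nonneg hj.1.1 hL.le, Int.ediv_le_ediv hL (by omega)⟩
    · intro a ha b hb hab
      simp only [Finset.coe_filter, Set.mem_setOf_eq] at ha hb
      have h : ((a:ℤ) : ZMod L) = ((b:ℤ) : ZMod L) := ha.2.trans hb.2.symm
      rw [ZMod.intCast_eq_intCast_iff] at h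
      have h' : a % L = b % L := h
      have e1 := Int.emod_add_mul_ediv a L
      have e2 := Int.emod_add_mul_ediv b L
      simp only at hab
      rw [← e1, ← e2, h', hab]
  rw [Int.card_Icc] at h2
  have h0 : (0:ℤ) ≤ (2^n - 1) / (L:ℤ) := Int.ediv_nonneg (by have := two_pow_pos' n; omega) hL.le
  have h3 : (((Sn n).filter (fun j : ℤ => ((j:ℤ) : ZMod L) = z)).card : ℤ) ≤ (2^n - 1) / (L:ℤ) + 1 := by omega
  have h4 : (2^n - 1) / (L:ℤ) * L ≤ 2^n := by
    have := Int.ediv_mul_le (2^n - 1) hL.ne'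
    omega
  have h5 : (((2^n - 1) / (L:ℤ) : ℤ) : ℝ) ≤ 2^n / L := by
    rw [le_div_iff₀ (by exact_mod_cast hL)]
    exact_mod_cast h4
  have h6 : (((Sn n).filter (fun j : ℤ => ((j:ℤ) : ZMod L) = z)).card : ℝ) ≤ (((2^n - 1) / (L:ℤ) : ℤ) : ℝ) + 1 := by
    exact_mod_cast h3
  rw [h1]; linarith

lemma Fn_zero_le [NeZero L] (n : ℕ) (z : ZMod L) : Fn L n z ≤ 1 / L + (2^n)⁻¹ := by
  unfold Fn
  have hL : (0:ℝ) < L := by exact_mod_cast NeZero.pos L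
  have h : ∑ j ∈ Sn n, cnt L (Sn n) (z + (j : ℤ)) ≤ ∑ j ∈ Sn n, ((2:ℝ)^n / L + 1) :=
    Finset.sum_le_sum fun j _ => cnt_Sn_le n _
  rw [Finset.sum_const, Sn_card, nsmul_eq_mul] at h
  calc _ ≤ ((4:ℝ)^n)⁻¹ * (((2^n : ℕ) : ℝ) * (2^n / L + 1)) := mul_le_mul_of_nonneg_left h (by positivity)
    _ = _ := by
      rw [show (4:ℝ) = 2 * 2 by norm_num, mul_pow]; push_cast; field_simp

lemma An_zero (z : ZMod L) : An L 0 z = if z = 0 then 1 else 0 := by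
  have : Sn 0 = {0} := by ext j; simp only [Sn, Finset.mem_Ico, Finset.mem_singleton]; omega
  unfold An cnt
  rw [this, Finset.sum_singleton]
  simp [eq_comm]

/-- one-dimensional flow identity -/
lemma tau_flow [NeZero L] (n : ℕ) (f : ZMod L → ℝ) :
    ∑ z, An L n z * f z - ∑ z, An L (n+1) z * f z = ∑ z, tau L n z * (f z - f (z+1)) := by
  have hA : ∀ m, ∑ z, An L m z * f z = (2^m)⁻¹ * ∑ j ∈ Sn m, f (j : ℤ) := by
    intro m
    rw [← cnt_sum, Finset.mul_sum]
    refine Finset.sum_congr rfl fun z _ => ?_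
    rw [An]; ring
  have hT : ∑ z, tau L n z * (f z - f (z+1)) =
      (1/2) * (2^n)⁻¹ * ∑ i ∈ Sn n, ∑ j ∈ Sn n, (f ((j:ℤ) + (i:ℤ)) - f ((j:ℤ) + (i:ℤ) + 1)) := by
    unfold tau
    have : ∀ i : ℤ, ∑ j ∈ Sn n, (f ((j:ℤ) + (i:ℤ)) - f ((j:ℤ) + (i:ℤ) + 1)) =
        ∑ z : ZMod L, cnt L (Sn n) (z - (i:ℤ)) * (f z - f (z+1)) := by
      intro i
      rw [← cnt_sum (Sn n) (fun z : ZMod L => f (z + ((i:ℤ) : ZMod L)) - f (z + ((i:ℤ) : ZMod L) + 1))]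
      rw [← Equiv.sum_comp (Equiv.addRight ((i:ℤ) : ZMod L)) (fun z : ZMod L => cnt L (Sn n) (z - (i:ℤ)) * (f z - f (z+1)))]
      simp
    simp only [this]
    rw [Finset.sum_comm, Finset.mul_sum]
    refine Finset.sum_congr rfl fun z _ => ?_
    rw [← Finset.sum_mul]; ring
  have hS : ∀ j : ℤ, ∑ i ∈ Sn n, (f ((j:ℤ) + (i:ℤ)) - f ((j:ℤ) + (i:ℤ) + 1)) = f (j:ℤ) - f ((j + 2^n : ℤ) : ZMod L) := by
    intro j
    have : ∀ M : ℕ, ∑ i ∈ Finset.Ico (0:ℤ) M, (f ((j:ℤ) + (i:ℤ)) - f ((j:ℤ) + (i:ℤ) + 1)) =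
       f (j:ℤ) - f ((j + (M:ℤ) : ℤ) : ZMod L) := by
      intro M
      induction M with
      | zero => simp
      | succ M ih =>
        have : Finset.Ico (0:ℤ) ((M+1 : ℕ) : ℤ) = insert (M : ℤ) (Finset.Ico (0:ℤ) M) := by
          ext j; simp only [Finset.mem_Ico, Finset.mem_insert]; push_cast; omega
        rw [this, Finset.sum_insert (by simp), ih]
        push_cast
        rw [add_assoc]
        ring
    have h := this (2^n)
    push_cast at h ⊢
    exact h
  have hU : ∑ j ∈ Sn (n+1), f (j : ℤ) = ∑ j ∈ Sn n, f (j : ℤ) + ∑ j ∈ Sn n, f ((j + 2^n : ℤ) : ZMod L) := by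
    have : Sn (n+1) = Sn n ∪ (Sn n).image (fun j => j + 2^n) := by
      ext j
      simp only [Sn, Finset.mem_union, Finset.mem_image, Finset.mem_Ico, pow_succ]
      constructor
      · intro h
        by_cases h1 : j < 2^n
        · left; omega
        · right; exact ⟨j - 2^n, by omega, by omega⟩
      · rintro (h | ⟨i, hi, rfl⟩) <;> omega
    rw [this, Finset.sum_union, Finset.sum_image (by intro a _ b _ h; simpa using h)]
    rw [Finset.disjoint_left]
    intro j h1 h2
    simp only [Sn, Finset.mem_image, Finset.mem_Ico] at h1 h2
    obtain ⟨i, hi, rfl⟩ := h2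
    omega
  rw [hT, Finset.sum_comm]
  simp only [hS]
  rw [hA, hA, hU, Finset.sum_sub_distrib, pow_succ, mul_inv]
  ring

end oneD
end QD

namespace QD
section threeD

def KP (L n : ℕ) (w : Torus L) : ℝ := ∏ i, Pn L n (w i)
def KF (L n : ℕ) (w : Torus L) : ℝ := ∏ i, Fn L n (w i)
def KU (L n : ℕ) (w : Torus L) : ℝ := ∏ i, An L n (w i)

lemma KP_nonneg (n : ℕ) (w : Torus L) : 0 ≤ KP L n w := Finset.prod_nonneg fun _ _ => Pn_nonneg _ _
lemma KF_nonneg (n : ℕ) (w : Torus L) : 0 ≤ KF L n w := Finset.prod_nonneg fun _ _ => Fn_nonneg _ _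
lemma KU_nonneg (n : ℕ) (w : Torus L) : 0 ≤ KU L n w := Finset.prod_nonneg fun _ _ => An_nonneg _ _
lemma KF_neg (n : ℕ) (w : Torus L) : KF L n (-w) = KF L n w :=
  Finset.prod_congr rfl fun i _ => by rw [Pi.neg_apply, Fn_neg]

lemma prod3_le (c : ℝ) (p q : Fin 3 → ℝ) (hp : ∀ i, 0 ≤ p i) (h : ∀ i, p i ≤ c * q i) :
    ∏ i, p i ≤ c^3 * ∏ i, q i := by
  calc ∏ i, p i ≤ ∏ i, (c * q i) := Finset.prod_le_prod (fun i _ => hp i) (fun i _ => h i)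
    _ = _ := by rw [Finset.prod_mul_distrib]; simp

lemma KP_le_succ (n : ℕ) (w : Torus L) : KP L n w ≤ 8 * KP L (n+1) w :=
  (prod3_le 2 _ _ (fun _ => Pn_nonneg _ _) (fun i => Pn_le_succ n (w i))).trans (le_of_eq (by norm_num [KP]))
lemma KU_le_KP (n : ℕ) (w : Torus L) : KU L n w ≤ KP L n w :=
  Finset.prod_le_prod (fun _ _ => An_nonneg _ _) (fun _ _ => An_le_Pn _ _)
lemma KF_le_KP (n : ℕ) (w : Torus L) : KF L n w ≤ KP L n w :=
  Finset.prod_le_prod (fun _ _ => Fn_nonneg _ _) (fun _ _ => Fn_le_Pn _ _)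
lemma KP_le_KF (n : ℕ) (w : Torus L) : KP L n w ≤ 64 * KF L (n+1) w :=
  (prod3_le 4 _ _ (fun _ => Pn_nonneg _ _) (fun i => Pn_le_Fn n (w i))).trans (le_of_eq (by norm_num [KF]))
lemma KF_top [NeZero L] (n : ℕ) (hn : L ≤ 2^n) (w : Torus L) : KF L (n+1) w ≤ 12 * KF L n w := by
  refine (prod3_le (9/4) _ _ (fun _ => Fn_nonneg _ _) (fun i => Fn_top n hn (w i))).trans ?_
  exact mul_le_mul_of_nonneg_right (by norm_num) (KF_nonneg n w)

lemma KP_conv [NeZero L] {m n : ℕ} (hmn : m ≤ n) (x x' : Torus L) :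
    ∑ z, KP L n (z - x) * KP L m (z - x') ≤ 216 * KP L (n+1) (x' - x) := by
  have h : ∑ z : Torus L, KP L n (z - x) * KP L m (z - x') =
      ∏ i : Fin 3, ∑ z : ZMod L, Pn L n (z - x i) * Pn L m (z - x' i) := by
    rw [Finset.prod_univ_sum]
    simp only [Fintype.piFinset_univ, KP, Pi.sub_apply, ← Finset.prod_mul_distrib]
  rw [h]
  refine (prod3_le 6 _ (fun i => Pn L (n+1) (x' i - x i)) (fun i => Finset.sum_nonneg fun z _ =>
    mul_nonneg (Pn_nonneg _ _) (Pn_nonneg _ _)) (fun i => Pn_conv hmn _ _)).trans (le_of_eq ?_)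
  norm_num [KP]

lemma KF_zero [NeZero L] (n : ℕ) : KF L n 0 ≤ (1 / L + (2^n)⁻¹)^3 := by
  have : KF L n 0 ≤ ∏ _i : Fin 3, (1 / (L:ℝ) + (2^n)⁻¹) :=
    Finset.prod_le_prod (fun _ _ => Fn_nonneg _ _) (fun _ _ => Fn_zero_le _ _)
  simpa using this

lemma unit_add_self (i : Fin 3) (w : Torus L) : (w + unitVec L i) i = w i + 1 := by simp [unitVec]
lemma unit_add_succ (i : Fin 3) (j : Fin 2) (w : Torus L) :
    (w + unitVec L i) (i.succAbove j) = w (i.succAbove j) := by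
  simp [unitVec, Fin.succAbove_ne]

lemma KF_grad (n : ℕ) (i : Fin 3) (w : Torus L) :
    |KF L n (w + unitVec L i) - KF L n w| ≤ 2 * (2^n)⁻¹ * KP L n w := by
  unfold KF KP
  rw [Fin.prod_univ_succAbove _ i, Fin.prod_univ_succAbove (fun j => Fn L n (w j)) i,
    Fin.prod_univ_succAbove (fun j => Pn L n (w j)) i]
  simp only [unit_add_self, unit_add_succ]
  rw [← sub_mul, abs_mul, ← mul_assoc]
  have h0 : 0 ≤ ∏ j, Fn L n (w (i.succAbove j)) := Finset.prod_nonneg fun _ _ => Fn_nonneg _ _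
  rw [abs_of_nonneg h0]
  refine mul_le_mul (Fn_grad n (w i)) (Finset.prod_le_prod (fun _ _ => Fn_nonneg _ _) (fun _ _ => Fn_le_Pn _ _)) h0 ?_
  exact mul_nonneg (by positivity) (Pn_nonneg _ _)

/-- one-coordinate replacement -/
lemma replace_coord [NeZero L] (A A' τ : ZMod L → ℝ)
    (h : ∀ f : ZMod L → ℝ, ∑ z, A z * f z - ∑ z, A' z * f z = ∑ z, τ z * (f z - f (z+1)))
    (i : Fin 3) (p : Fin 2 → ZMod L → ℝ) (v : Torus L → ℝ) :
    ∑ w : Torus L, (A (w i) * ∏ j, p j (w (i.succAbove j))) * v w -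
      ∑ w : Torus L, (A' (w i) * ∏ j, p j (w (i.succAbove j))) * v w =
    ∑ w : Torus L, (τ (w i) * ∏ j, p j (w (i.succAbove j))) * (v w - v (w + unitVec L i)) := by
  have key : ∀ g : Torus L → ℝ, ∑ w, g w = ∑ u : Fin 2 → ZMod L, ∑ z : ZMod L,
      g (Fin.insertNthEquiv (fun _ => ZMod L) i (z, u)) := by
    intro g
    rw [← Equiv.sum_comp (Fin.insertNthEquiv (fun _ => ZMod L) i), Fintype.sum_prod_type, Finset.sum_comm]
  rw [key, key, key, ← Finset.sum_sub_distrib]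
  refine Finset.sum_congr rfl fun u _ => ?_
  have hv : ∀ z : ZMod L, (Fin.insertNthEquiv (fun _ => ZMod L) i (z, u)) + unitVec L i =
      Fin.insertNthEquiv (fun _ => ZMod L) i (z + 1, u) := by
    intro z
    ext j
    rcases Fin.eq_self_or_eq_succAbove i j with rfl | ⟨k, rfl⟩
    · rw [unit_add_self]; simp
    · rw [unit_add_succ]; simp
  simp only [hv]
  simp only [Fin.insertNthEquiv_apply, Fin.insertNth_apply_same, Fin.insertNth_apply_succAbove]
  have := h (fun z => (∏ j, p j (u j)) * v (Fin.insertNthEquiv (fun _ => ZMod L) i (z, u)))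
  simp only [mul_assoc]
  rw [this]
  refine Finset.sum_congr rfl fun z _ => ?_
  ring

def Th3 (L n : ℕ) (i : Fin 3) (w : Torus L) : ℝ :=
  ∏ j : Fin 3, if j < i then An L (n+1) (w j) else if j = i then tau L n (w j) else An L n (w j)

lemma Th3_nonneg (n : ℕ) (i : Fin 3) (w : Torus L) : 0 ≤ Th3 L n i w := by
  refine Finset.prod_nonneg fun j _ => ?_
  split_ifs
  · exact An_nonneg _ _
  · exact tau_nonneg _ _
  · exact An_nonneg _ _

lemma Th3_le (n : ℕ) (i : Fin 3) (w : Torus L) : Th3 L n i w ≤ 4 * 2^n * KP L (n+1) w := by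
  unfold Th3 KP
  rw [Fin.prod_univ_succAbove _ i, Fin.prod_univ_succAbove (fun j => Pn L (n+1) (w j)) i]
  have h1 : ∏ j : Fin 2, (if i.succAbove j < i then An L (n+1) (w (i.succAbove j)) else
      if i.succAbove j = i then tau L n (w (i.succAbove j)) else An L n (w (i.succAbove j)))
      ≤ ∏ j : Fin 2, (2 * Pn L (n+1) (w (i.succAbove j))) := by
    refine Finset.prod_le_prod (fun j _ => ?_) (fun j _ => ?_)
    · split_ifs
      · exact An_nonneg _ _
      · exact tau_nonneg _ _
      · exact An_nonneg _ _
    · have hne : i.succAbove j ≠ i := Fin.succAbove_ne i j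
      rw [if_neg hne]
      have hP := Pn_nonneg (L := L) (n+1) (w (i.succAbove j))
      split_ifs
      · linarith [An_le_Pn (L := L) (n+1) (w (i.succAbove j))]
      · exact (An_le_Pn n _).trans (Pn_le_succ n _)
  simp only [lt_self_iff_false, if_false, if_true]
  calc _ ≤ (2^n * Pn L (n+1) (w i)) * ∏ j : Fin 2, (2 * Pn L (n+1) (w (i.succAbove j))) := by
        refine mul_le_mul (tau_le n _) h1 (Finset.prod_nonneg fun j _ => ?_) (mul_nonneg (by positivity) (Pn_nonneg _ _))
        split_ifs
        · exact An_nonneg _ _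
        · exact tau_nonneg _ _
        · exact An_nonneg _ _
    _ = _ := by rw [Finset.prod_mul_distrib]; simp; ring

lemma step_flow [NeZero L] (n : ℕ) (v : Torus L → ℝ) :
    ∑ w, KU L n w * v w - ∑ w, KU L (n+1) w * v w =
      ∑ i, ∑ w, Th3 L n i w * (v w - v (w + unitVec L i)) := by
  have h0 := replace_coord _ _ _ (tau_flow (L := L) n) 0 ![An L n, An L n] v
  have h1 := replace_coord _ _ _ (tau_flow (L := L) n) 1 ![An L (n+1), An L n] v
  have h2 := replace_coord _ _ _ (tau_flow (L := L) n) 2 ![An L (n+1), An L (n+1)] v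
  have e1 : (1 : Fin 3).succAbove 0 = 0 := by decide
  have e2 : (1 : Fin 3).succAbove 1 = 2 := by decide
  have e3 : (2 : Fin 3).succAbove 0 = 0 := by decide
  have e4 : (2 : Fin 3).succAbove 1 = 1 := by decide
  have e5 : (0 : Fin 3).succAbove 0 = 1 := by decide
  have e6 : (0 : Fin 3).succAbove 1 = 2 := by decide
  simp only [Fin.prod_univ_two, e1, e2, e3, e4, e5, e6, Matrix.cons_val_zero, Matrix.cons_val_one] at h0 h1 h2
  have g0 : ∀ w : Torus L, Th3 L n 0 w = tau L n (w 0) * (An L n (w 1) * An L n (w 2)) := by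
    intro w; simp [Th3, Fin.prod_univ_three]; ring
  have g1 : ∀ w : Torus L, Th3 L n 1 w = tau L n (w 1) * (An L (n+1) (w 0) * An L n (w 2)) := by
    intro w; simp [Th3, Fin.prod_univ_three, show ¬ ((2:Fin 3) < 1) by decide]; ring
  have g2 : ∀ w : Torus L, Th3 L n 2 w = tau L n (w 2) * (An L (n+1) (w 0) * An L (n+1) (w 1)) := by
    intro w; simp [Th3, Fin.prod_univ_three, show ((1:Fin 3) < 2) by decide]; ring
  rw [Fin.sum_univ_three]
  simp only [g0, g1, g2, ← h0, ← h1, ← h2]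
  simp only [KU, Fin.prod_univ_three]
  have q : ∀ a b c d e f : ℝ, b = c → d = e → a - f = (a - b) + (c - d) + (e - f) := by intros; subst_vars; ring
  have hfin := q (∑ w : Torus L, An L n (w 0) * (An L n (w 1) * An L n (w 2)) * v w)
   (∑ w : Torus L, An L (n+1) (w 0) * (An L n (w 1) * An L n (w 2)) * v w)
   (∑ w : Torus L, An L n (w 1) * (An L (n+1) (w 0) * An L n (w 2)) * v w)
   (∑ w : Torus L, An L (n+1) (w 1) * (An L (n+1) (w 0) * An L n (w 2)) * v w)
   (∑ w : Torus L, An L n (w 2) * (An L (n+1) (w 0) * An L (n+1) (w 1)) * v w)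
   (∑ w : Torus L, An L (n+1) (w 2) * (An L (n+1) (w 0) * An L (n+1) (w 1)) * v w)
   (Finset.sum_congr rfl fun w _ => by ring) (Finset.sum_congr rfl fun w _ => by ring)
  rw [← hfin]
  congr 1 <;> exact Finset.sum_congr rfl fun w _ => by ring

lemma KU_zero_sum [NeZero L] (v : Torus L → ℝ) : ∑ w, KU L 0 w * v w = v 0 := by
  have : ∀ w : Torus L, KU L 0 w = if w = 0 then 1 else 0 := by
    intro w
    unfold KU
    simp only [An_zero]
    split_ifs with h
    · subst h; simp
    · obtain ⟨i, hi⟩ := Function.ne_iff.1 h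
      exact Finset.prod_eq_zero (Finset.mem_univ i) (if_neg hi)
  simp [this]

end threeD
end QD

namespace QD
section scales

def sq (ε : ℝ) (n : ℕ) : ℝ := 1 / (1 + 4^n * ε)^2
def aq (ε : ℝ) (n : ℕ) : ℝ := 4^n * sq ε n
def bq (ε : ℝ) (n : ℕ) : ℝ := 2^n * sq ε n

lemma sq_nonneg' {ε : ℝ} (n : ℕ) : 0 ≤ sq ε n := by unfold sq; positivity
lemma aq_nonneg {ε : ℝ} (n : ℕ) : 0 ≤ aq ε n := mul_nonneg (by positivity) (sq_nonneg' n)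
lemma bq_nonneg {ε : ℝ} (n : ℕ) : 0 ≤ bq ε n := mul_nonneg (by positivity) (sq_nonneg' n)

lemma sq_le_one {ε : ℝ} (hε : 0 < ε) (n : ℕ) : sq ε n ≤ 1 := by
  unfold sq
  have : 0 < 4^n * ε := by positivity
  rw [div_le_one (by positivity)]
  nlinarith

lemma sq_succ {ε : ℝ} (hε : 0 < ε) (n : ℕ) : sq ε n ≤ 16 * sq ε (n+1) := by
  unfold sq
  have hx : 0 < 4^n * ε := by positivity
  rw [show (4:ℝ)^(n+1) * ε = 4 * (4^n*ε) by rw [pow_succ]; ring]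
  set x := 4^n * ε
  rw [mul_one_div, div_le_div_iff₀ (by positivity) (by positivity)]
  nlinarith

lemma aq_succ {ε : ℝ} (hε : 0 < ε) (n : ℕ) : aq ε n ≤ 4 * aq ε (n+1) := by
  have h := mul_le_mul_of_nonneg_left (sq_succ hε n) (by positivity : (0:ℝ) ≤ 4^n)
  unfold aq; rw [pow_succ]; linarith

lemma bq_succ {ε : ℝ} (hε : 0 < ε) (n : ℕ) : bq ε n ≤ 8 * bq ε (n+1) := by
  have h := mul_le_mul_of_nonneg_left (sq_succ hε n) (by positivity : (0:ℝ) ≤ 2^n)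
  unfold bq; rw [pow_succ]; linarith

lemma sq_diff {ε : ℝ} (hε : 0 < ε) (n : ℕ) : sq ε n - sq ε (n+1) ≤ 3 * ε * aq ε (n+1) := by
  unfold aq sq
  have hx : 0 < 4^n * ε := by positivity
  have e : (3:ℝ) * ε * (4^(n+1) * (1 / (1 + 4^(n+1) * ε)^2)) = 12 * (4^n*ε) * (1 / (1 + 4 * (4^n * ε))^2) := by
    rw [pow_succ]; ring_nf
  rw [e, show (4:ℝ)^(n+1) * ε = 4 * (4^n*ε) by rw [pow_succ]; ring]
  set x := 4^n * ε
  rw [div_sub_div _ _ (by positivity) (by positivity), mul_one_div, div_le_div_iff₀ (by positivity) (by positivity)]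
  have : (1 * (1 + 4 * x)^2 - (1+x)^2 * 1) ≤ 12 * x * (1+x)^2 := by nlinarith [pow_pos hx 3, pow_pos hx 2]
  calc _ ≤ (12 * x * (1+x)^2) * (1 + 4 * x)^2 := mul_le_mul_of_nonneg_right this (by positivity)
    _ = _ := by ring

lemma sq_anti {ε : ℝ} (hε : 0 < ε) (n : ℕ) : sq ε (n+1) ≤ sq ε n := by
  unfold sq
  have hx : 0 < 4^n * ε := by positivity
  rw [show (4:ℝ)^(n+1) * ε = 4 * (4^n*ε) by rw [pow_succ]; ring]
  apply one_div_le_one_div_of_le (by positivity)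
  exact pow_le_pow_left₀ (by positivity) (by linarith) 2

lemma sq_zero {ε : ℝ} (hε : 0 < ε) (h1 : ε ≤ 1) : 1 - sq ε 0 ≤ 3 * ε * aq ε 0 := by
  unfold aq sq
  simp only [pow_zero, one_mul]
  rw [mul_one_div, one_sub_div (by positivity)]
  gcongr
  nlinarith

lemma sq_last {ε : ℝ} (N : ℕ) (h : 1 ≤ 4^N * ε) : sq ε N ≤ ε * aq ε N := by
  have := mul_le_mul_of_nonneg_right h (sq_nonneg' (ε := ε) N)
  unfold aq; linarith

lemma aq_sum {ε : ℝ} (hε : 0 < ε) (n : ℕ) : ε * ∑ m ∈ Finset.range (n+1), aq ε m ≤ 4/3 := by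
  have key : ∀ n : ℕ, ε * ∑ m ∈ Finset.range n, aq ε m ≤ (4/3) * (4^n * ε / (1 + 4^n * ε)) := by
    intro n
    induction n with
    | zero => simp; positivity
    | succ n ih =>
      rw [Finset.sum_range_succ, mul_add]
      have hx : 0 < 4^n * ε := by positivity
      have h1 : ε * aq ε n = (4^n*ε) / (1 + 4^n*ε)^2 := by unfold aq sq; ring
      rw [h1, show (4:ℝ)^(n+1) * ε = 4 * (4^n*ε) by rw [pow_succ]; ring]
      set x := 4^n * ε
      have : x / (1+x)^2 ≤ (4/3) * (4 * x / (1 + 4 * x)) - (4/3) * (x / (1+x)) := by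
        rw [← mul_sub, div_sub_div _ _ (by positivity) (by positivity), ← mul_div_assoc,
          div_le_div_iff₀ (by positivity) (by positivity)]
        nlinarith [pow_pos hx 3, pow_pos hx 2]
      linarith
  refine (key (n+1)).trans ?_
  have hx : 0 < 4^(n+1) * ε := by positivity
  have : 4^(n+1) * ε / (1 + 4^(n+1)*ε) ≤ 1 := by rw [div_le_one (by positivity)]; linarith
  linarith

lemma bq_sum {ε : ℝ} (hε : 0 < ε) (n : ℕ) : ∑ m ∈ Finset.range (n+1), bq ε m ≤ 2 * 2^n := by
  have key : ∀ n : ℕ, ∑ m ∈ Finset.range n, bq ε m ≤ 2^n := by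
    intro n
    induction n with
    | zero => simp
    | succ n ih =>
      rw [Finset.sum_range_succ, pow_succ]
      have h2 : bq ε n ≤ 2^n * 1 := mul_le_mul_of_nonneg_left (sq_le_one hε n) (by positivity)
      linarith
  exact (key (n+1)).trans (le_of_eq (by ring))

lemma double_sum (c : ℕ → ℝ) (hc : ∀ n, 0 ≤ c n) (Y : ℕ → ℕ → ℝ) (X Γ : ℕ → ℝ) (hX : ∀ n, 0 ≤ X n)
    (hY : ∀ n m, Y n m ≤ X (max n m)) (hΓ : ∀ n, ∑ m ∈ Finset.range (n+1), c m ≤ Γ n) (M : ℕ) :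
    ∑ n ∈ Finset.range M, ∑ m ∈ Finset.range M, c n * c m * Y n m ≤
      2 * ∑ n ∈ Finset.range M, c n * Γ n * X n := by
  have h1 : ∀ n m, c n * c m * Y n m ≤ (if m ≤ n then c n * c m * X n else 0) + (if n ≤ m then c n * c m * X m else 0) := by
    intro n m
    have h := mul_le_mul_of_nonneg_left (hY n m) (mul_nonneg (hc n) (hc m))
    have p1 := mul_nonneg (mul_nonneg (hc n) (hc m)) (hX n)
    have p2 := mul_nonneg (mul_nonneg (hc n) (hc m)) (hX m)
    rcases le_total m n with hmn | hmn
    · rw [max_eq_left hmn] at h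
      rw [if_pos hmn]; split_ifs <;> linarith
    · rw [max_eq_right hmn] at h
      rw [if_pos hmn]; split_ifs <;> linarith
  have h2 : ∀ n, n < M → ∑ m ∈ Finset.range M, (if m ≤ n then c n * c m * X n else 0) ≤ c n * Γ n * X n := by
    intro n hn
    rw [← Finset.sum_filter]
    have : (Finset.range M).filter (fun m => m ≤ n) = Finset.range (n+1) := by
      ext m; simp only [Finset.mem_filter, Finset.mem_range]; omega
    rw [this, ← Finset.sum_mul, ← Finset.mul_sum]
    exact mul_le_mul_of_nonneg_right (mul_le_mul_of_nonneg_left (hΓ n) (hc n)) (hX n)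
  calc _ ≤ ∑ n ∈ Finset.range M, ∑ m ∈ Finset.range M, ((if m ≤ n then c n * c m * X n else 0) + (if n ≤ m then c n * c m * X m else 0)) :=
        Finset.sum_le_sum fun n _ => Finset.sum_le_sum fun m _ => h1 n m
    _ = ∑ n ∈ Finset.range M, ∑ m ∈ Finset.range M, (if m ≤ n then c n * c m * X n else 0)
        + ∑ n ∈ Finset.range M, ∑ m ∈ Finset.range M, (if m ≤ n then c n * c m * X n else 0) := by
        simp only [Finset.sum_add_distrib]
        congr 1
        rw [Finset.sum_comm]
        refine Finset.sum_congr rfl fun n _ => Finset.sum_congr rfl fun m _ => ?_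
        rw [mul_comm (c m)]
    _ ≤ _ := by
        rw [← two_mul]
        refine mul_le_mul_of_nonneg_left ?_ (by norm_num)
        exact Finset.sum_le_sum fun n hn => h2 n (Finset.mem_range.1 hn)

lemma shift_sum {ε : ℝ} (hε : 0 < ε) (N : ℕ) (X : ℕ → ℝ) (hX : ∀ n, 0 ≤ X n) (h : X (N+1) ≤ 12 * X N) :
    ∑ n ∈ Finset.range (N+1), aq ε n * X (n+1) ≤ 16 * ∑ n ∈ Finset.range (N+1), aq ε n * X n := by
  have h0 : ∀ n, 0 ≤ aq ε n * X n := fun n => mul_nonneg (aq_nonneg n) (hX n)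
  have h1 : ∑ n ∈ Finset.range N, aq ε n * X (n+1) ≤ 4 * ∑ n ∈ Finset.range (N+1), aq ε n * X n := by
    rw [Finset.sum_range_succ' _ N, mul_add, Finset.mul_sum]
    have : ∑ n ∈ Finset.range N, aq ε n * X (n+1) ≤ ∑ n ∈ Finset.range N, 4 * (aq ε (n+1) * X (n+1)) :=
      Finset.sum_le_sum fun n _ => by
        have := mul_le_mul_of_nonneg_right (aq_succ hε n) (hX (n+1)); linarith
    linarith [h0 0]
  have h2 : aq ε N * X (N+1) ≤ 12 * ∑ n ∈ Finset.range (N+1), aq ε n * X n := by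
    have h3 := mul_le_mul_of_nonneg_left h (aq_nonneg (ε := ε) N)
    have h4 : aq ε N * X N ≤ ∑ n ∈ Finset.range (N+1), aq ε n * X n :=
      Finset.single_le_sum (f := fun n => aq ε n * X n) (fun n _ => h0 n) (Finset.self_mem_range_succ N)
    linarith
  rw [Finset.sum_range_succ]
  linarith

def kk (L : ℕ) (ε : ℝ) (N : ℕ) (w : Torus L) : ℝ := ∑ n ∈ Finset.range (N+1), aq ε n * KF L n w
def kP (L : ℕ) (ε : ℝ) (N : ℕ) (w : Torus L) : ℝ := ∑ n ∈ Finset.range (N+1), aq ε n * KP L n w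
def Tk (L : ℕ) (ε : ℝ) (N : ℕ) (w : Torus L) : ℝ := ∑ n ∈ Finset.range (N+1), bq ε n * KP L n w

lemma kk_nonneg {ε : ℝ} (N : ℕ) (w : Torus L) : 0 ≤ kk L ε N w :=
  Finset.sum_nonneg fun n _ => mul_nonneg (aq_nonneg n) (KF_nonneg n w)
lemma kP_nonneg {ε : ℝ} (N : ℕ) (w : Torus L) : 0 ≤ kP L ε N w :=
  Finset.sum_nonneg fun n _ => mul_nonneg (aq_nonneg n) (KP_nonneg n w)
lemma Tk_nonneg {ε : ℝ} (N : ℕ) (w : Torus L) : 0 ≤ Tk L ε N w :=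
  Finset.sum_nonneg fun n _ => mul_nonneg (bq_nonneg n) (KP_nonneg n w)
lemma kk_neg {ε : ℝ} (N : ℕ) (w : Torus L) : kk L ε N (-w) = kk L ε N w := by simp only [kk, KF_neg]
lemma kk_le_kP {ε : ℝ} (N : ℕ) (w : Torus L) : kk L ε N w ≤ kP L ε N w :=
  Finset.sum_le_sum fun n _ => mul_le_mul_of_nonneg_left (KF_le_KP n w) (aq_nonneg n)

lemma kk_grad {ε : ℝ} (N : ℕ) (i : Fin 3) (w : Torus L) :
    |kk L ε N (w + unitVec L i) - kk L ε N w| ≤ 2 * Tk L ε N w := by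
  unfold kk Tk
  rw [← Finset.sum_sub_distrib, Finset.mul_sum]
  refine (Finset.abs_sum_le_sum_abs _ _).trans (Finset.sum_le_sum fun n _ => ?_)
  rw [← mul_sub, abs_mul, abs_of_nonneg (aq_nonneg n)]
  refine (mul_le_mul_of_nonneg_left (KF_grad n i w) (aq_nonneg n)).trans (le_of_eq ?_)
  unfold aq bq
  rw [show (4:ℝ) = 2 * 2 by norm_num, mul_pow]
  field_simp

lemma KP_conv_max [NeZero L] (n m : ℕ) (x x' : Torus L) :
    ∑ z, KP L n (z - x) * KP L m (z - x') ≤ 216 * KP L (max n m + 1) (x' - x) := by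
  rcases le_total m n with h | h
  · rw [max_eq_left h]; exact KP_conv h x x'
  · rw [max_eq_right h]
    have := KP_conv (L := L) h x' x
    have hs : KP L (m+1) (x' - x) = KP L (m+1) (x - x') := by
      unfold KP
      refine Finset.prod_congr rfl fun i _ => ?_
      rw [← Pn_neg]; simp
    rw [hs]
    refine le_trans (le_of_eq ?_) this
    exact Finset.sum_congr rfl fun z _ => mul_comm _ _

lemma shift_KP [NeZero L] {ε : ℝ} (hε : 0 < ε) (N : ℕ) (hN : L ≤ 2^N) (w : Torus L) :
    ∑ n ∈ Finset.range (N+1), aq ε n * KP L (n+1) w ≤ 16384 * kk L ε N w := by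
  have h1 : ∑ n ∈ Finset.range (N+1), aq ε n * KP L (n+1) w ≤ 64 * ∑ n ∈ Finset.range (N+1), aq ε n * KF L (n+1+1) w := by
    rw [Finset.mul_sum]
    refine Finset.sum_le_sum fun n _ => ?_
    have := mul_le_mul_of_nonneg_left (KP_le_KF (L := L) (n+1) w) (aq_nonneg (ε := ε) n)
    linarith
  have h2 := shift_sum hε N (fun n => KF L (n+1) w) (fun n => KF_nonneg _ w)
    (KF_top (N+1) (hN.trans (Nat.pow_le_pow_right (by norm_num) (by omega))) w)
  have h3 := shift_sum hε N (fun n => KF L n w) (fun n => KF_nonneg _ w) (KF_top N hN w)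
  unfold kk
  linarith

lemma conv_expand [NeZero L] (c : ℕ → ℝ) (M : ℕ) (x x' : Torus L) :
    ∑ z, (∑ n ∈ Finset.range M, c n * KP L n (z - x)) * (∑ n ∈ Finset.range M, c n * KP L n (z - x')) =
    ∑ n ∈ Finset.range M, ∑ m ∈ Finset.range M, c n * c m * ∑ z, KP L n (z - x) * KP L m (z - x') := by
  simp only [Finset.sum_mul_sum]
  rw [Finset.sum_comm]
  refine Finset.sum_congr rfl fun n _ => ?_
  rw [Finset.sum_comm]
  refine Finset.sum_congr rfl fun m _ => ?_
  rw [Finset.mul_sum]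
  exact Finset.sum_congr rfl fun z _ => by ring

lemma K1 [NeZero L] {ε : ℝ} (hε : 0 < ε) (N : ℕ) (hN : L ≤ 2^N) (x x' : Torus L) :
    ∑ z, Tk L ε N (z - x) * Tk L ε N (z - x') ≤ 864 * 16384 * kk L ε N (x' - x) := by
  unfold Tk
  rw [conv_expand]
  have h := double_sum (bq ε) (fun n => bq_nonneg n) (fun n m => ∑ z, KP L n (z - x) * KP L m (z - x'))
    (fun n => 216 * KP L (n+1) (x' - x)) (fun n => 2 * 2^n) (fun n => mul_nonneg (by norm_num) (KP_nonneg _ _))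
    (fun n m => KP_conv_max n m x x') (fun n => bq_sum hε n) (N+1)
  refine h.trans ?_
  have h2 := shift_KP hε N hN (x' - x)
  refine le_trans (le_of_eq ?_) ((mul_le_mul_of_nonneg_left h2 (by norm_num : (0:ℝ) ≤ 864)).trans (le_of_eq (by ring)))
  rw [Finset.mul_sum, Finset.mul_sum]
  refine Finset.sum_congr rfl fun n _ => ?_
  unfold aq bq
  rw [show (4:ℝ) = 2 * 2 by norm_num, mul_pow]
  ring

lemma K2 [NeZero L] {ε : ℝ} (hε : 0 < ε) (N : ℕ) (hN : L ≤ 2^N) (x x' : Torus L) :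
    ε * ∑ z, kP L ε N (z - x) * kP L ε N (z - x') ≤ 576 * 16384 * kk L ε N (x' - x) := by
  unfold kP
  rw [conv_expand]
  have h := double_sum (aq ε) (fun n => aq_nonneg n) (fun n m => ∑ z, KP L n (z - x) * KP L m (z - x'))
    (fun n => 216 * KP L (n+1) (x' - x)) (fun n => (4/3) / ε) (fun n => mul_nonneg (by norm_num) (KP_nonneg _ _))
    (fun n m => KP_conv_max n m x x') (fun n => by rw [le_div_iff₀ hε, mul_comm]; exact aq_sum hε n) (N+1)
  refine (mul_le_mul_of_nonneg_left h hε.le).trans ?_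
  have h2 := shift_KP hε N hN (x' - x)
  refine le_trans (le_of_eq ?_) ((mul_le_mul_of_nonneg_left h2 (by norm_num : (0:ℝ) ≤ 576)).trans (le_of_eq (by ring)))
  rw [Finset.mul_sum, Finset.mul_sum, Finset.mul_sum]
  refine Finset.sum_congr rfl fun n _ => ?_
  field_simp
  ring

lemma kk_zero [NeZero L] {ε : ℝ} (hε : 0 < ε) (N : ℕ) (hL : 1 ≤ ε * (L:ℝ)^3) : kk L ε N 0 ≤ 14 := by
  have hL0 : (0:ℝ) < L := by exact_mod_cast NeZero.pos L
  have h1 : ∀ n, aq ε n * KF L n 0 ≤ (4 * ε) * aq ε n + 4 * (1/2)^n := by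
    intro n
    have h2 : KF L n 0 ≤ 4 * (ε + (2^n)⁻¹^3) := by
      refine (KF_zero n).trans ?_
      have hp : (0:ℝ) < (2^n)⁻¹ := by positivity
      have hq : 0 < 1 / (L:ℝ) := by positivity
      have h3 : (1/(L:ℝ))^3 ≤ ε := by
        rw [div_pow, one_pow, div_le_iff₀ (by positivity)]; exact hL
      have : (1/(L:ℝ) + (2^n)⁻¹)^3 ≤ 4 * ((1/(L:ℝ))^3 + (2^n)⁻¹^3) := by
        nlinarith [mul_nonneg (add_pos hp hq).le (sq_nonneg (1/(L:ℝ) - (2^n)⁻¹))]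
      linarith
    have h4 := mul_le_mul_of_nonneg_left h2 (aq_nonneg (ε := ε) n)
    have h5 : aq ε n * (2^n)⁻¹^3 ≤ (1/2)^n := by
      unfold aq
      have : (4:ℝ)^n * sq ε n * (2^n)⁻¹^3 = sq ε n * (1/2)^n := by
        rw [show (4:ℝ) = 2 * 2 by norm_num, mul_pow, div_pow, one_pow]; field_simp
      rw [this]
      exact (mul_le_mul_of_nonneg_right (sq_le_one hε n) (by positivity)).trans (le_of_eq (one_mul _))
    linarith
  have h2 : ∑ n ∈ Finset.range (N+1), ((1:ℝ)/2)^n ≤ 2 := sum_geometric_two_le _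
  have h3 := aq_sum hε N
  unfold kk
  calc _ ≤ ∑ n ∈ Finset.range (N+1), ((4 * ε) * aq ε n + 4 * (1/2)^n) := Finset.sum_le_sum fun n _ => h1 n
    _ = 4 * (ε * ∑ n ∈ Finset.range (N+1), aq ε n) + 4 * ∑ n ∈ Finset.range (N+1), ((1:ℝ)/2)^n := by
      rw [Finset.sum_add_distrib, ← Finset.mul_sum, ← Finset.mul_sum]; ring
    _ ≤ 14 := by linarith

def thq (L : ℕ) (ε : ℝ) (N : ℕ) (i : Fin 3) (w : Torus L) : ℝ := ∑ n ∈ Finset.range N, sq ε n * Th3 L n i w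
def rhq (L : ℕ) (ε : ℝ) (N : ℕ) (w : Torus L) : ℝ :=
  (1 - sq ε 0) * KU L 0 w + ∑ n ∈ Finset.range N, (sq ε n - sq ε (n+1)) * KU L (n+1) w + sq ε N * KU L N w

lemma thq_nonneg {ε : ℝ} (N : ℕ) (i : Fin 3) (w : Torus L) : 0 ≤ thq L ε N i w :=
  Finset.sum_nonneg fun n _ => mul_nonneg (sq_nonneg' n) (Th3_nonneg n i w)

lemma thq_le {ε : ℝ} (hε : 0 < ε) (N : ℕ) (i : Fin 3) (w : Torus L) : thq L ε N i w ≤ 32 * Tk L ε N w := by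
  unfold thq Tk
  rw [Finset.sum_range_succ' _ N, mul_add, Finset.mul_sum]
  have h0 : 0 ≤ bq ε 0 * KP L 0 w := mul_nonneg (bq_nonneg 0) (KP_nonneg 0 w)
  have : ∑ n ∈ Finset.range N, sq ε n * Th3 L n i w ≤ ∑ n ∈ Finset.range N, 32 * (bq ε (n+1) * KP L (n+1) w) := by
    refine Finset.sum_le_sum fun n _ => ?_
    have h1 := mul_le_mul_of_nonneg_left (Th3_le n i w) (sq_nonneg' (ε := ε) n)
    have h2 := mul_le_mul_of_nonneg_right (bq_succ hε n) (KP_nonneg (n+1) w)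
    have h3 : sq ε n * (4 * 2^n * KP L (n+1) w) = 4 * (bq ε n * KP L (n+1) w) := by unfold bq; ring
    linarith
  linarith

lemma rhq_nonneg {ε : ℝ} (hε : 0 < ε) (N : ℕ) (w : Torus L) : 0 ≤ rhq L ε N w := by
  unfold rhq
  refine add_nonneg (add_nonneg (mul_nonneg ?_ (KU_nonneg _ _)) (Finset.sum_nonneg fun n _ => mul_nonneg ?_ (KU_nonneg _ _)))
    (mul_nonneg (sq_nonneg' _) (KU_nonneg _ _))
  · linarith [sq_le_one hε 0]
  · linarith [sq_anti hε n]

lemma rhq_le {ε : ℝ} (hε : 0 < ε) (h1 : ε ≤ 1) (N : ℕ) (hN : 1 ≤ 4^N * ε) (w : Torus L) :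
    rhq L ε N w ≤ 4 * ε * kP L ε N w := by
  have hU : ∑ n ∈ Finset.range (N+1), aq ε n * KU L n w ≤ kP L ε N w :=
    Finset.sum_le_sum fun n _ => mul_le_mul_of_nonneg_left (KU_le_KP n w) (aq_nonneg n)
  have a1 : (1 - sq ε 0) * KU L 0 w ≤ 3 * ε * (aq ε 0 * KU L 0 w) := by
    have := mul_le_mul_of_nonneg_right (sq_zero hε h1) (KU_nonneg 0 w); linarith
  have a2 : ∑ n ∈ Finset.range N, (sq ε n - sq ε (n+1)) * KU L (n+1) w ≤
      ∑ n ∈ Finset.range N, 3 * ε * (aq ε (n+1) * KU L (n+1) w) :=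
    Finset.sum_le_sum fun n _ => by
      have := mul_le_mul_of_nonneg_right (sq_diff hε n) (KU_nonneg (n+1) w); linarith
  have a3 : sq ε N * KU L N w ≤ ε * (aq ε N * KU L N w) := by
    have := mul_le_mul_of_nonneg_right (sq_last N hN) (KU_nonneg N w); linarith
  have a4 : aq ε N * KU L N w ≤ ∑ n ∈ Finset.range (N+1), aq ε n * KU L n w :=
    Finset.single_le_sum (f := fun n => aq ε n * KU L n w) (fun n _ => mul_nonneg (aq_nonneg n) (KU_nonneg n w)) (Finset.self_mem_range_succ N)
  have a5 := mul_le_mul_of_nonneg_left a4 hε.le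
  have a6 := mul_le_mul_of_nonneg_left hU (by positivity : (0:ℝ) ≤ 4 * ε)
  rw [← Finset.mul_sum] at a2
  have a7 := Finset.sum_range_succ' (fun n => aq ε n * KU L n w) N
  unfold rhq
  have a8 : 3 * ε * ∑ n ∈ Finset.range (N+1), aq ε n * KU L n w = 3 * ε * ∑ n ∈ Finset.range N, aq ε (n+1) * KU L (n+1) w + 3 * ε * (aq ε 0 * KU L 0 w) := by
    rw [a7]; ring
  linarith

lemma flow_id [NeZero L] (ε : ℝ) (N : ℕ) (v : Torus L → ℝ) :
    v 0 = ∑ i, ∑ w, thq L ε N i w * (v w - v (w + unitVec L i)) + ∑ w, rhq L ε N w * v w := by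
  have e1 : ∑ i, ∑ w, thq L ε N i w * (v w - v (w + unitVec L i)) =
      ∑ n ∈ Finset.range N, sq ε n * (∑ w, KU L n w * v w - ∑ w, KU L (n+1) w * v w) := by
    simp only [step_flow, thq, Finset.sum_mul, Finset.mul_sum]
    simp only [mul_assoc]
    conv_lhs => enter [2, i]; rw [Finset.sum_comm]
    rw [Finset.sum_comm]
  have e2 : ∑ w, rhq L ε N w * v w = (1 - sq ε 0) * (∑ w, KU L 0 w * v w) +
      ∑ n ∈ Finset.range N, (sq ε n - sq ε (n+1)) * (∑ w, KU L (n+1) w * v w) + sq ε N * ∑ w, KU L N w * v w := by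
    simp only [rhq, add_mul, Finset.sum_add_distrib, Finset.sum_mul, Finset.mul_sum, mul_assoc]
    congr 2
    rw [Finset.sum_comm]
  rw [e1, e2, ← KU_zero_sum v]
  have tel : ∀ (g : ℕ → ℝ) (N : ℕ), g 0 = ∑ n ∈ Finset.range N, sq ε n * (g n - g (n+1)) +
      ((1 - sq ε 0) * g 0 + ∑ n ∈ Finset.range N, (sq ε n - sq ε (n+1)) * g (n+1) + sq ε N * g N) := by
    intro g N
    induction N with
    | zero => simp; ring
    | succ N ih =>
      rw [Finset.sum_range_succ, Finset.sum_range_succ]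
      linarith
  exact tel (fun n => ∑ w, KU L n w * v w) N

/-- Existence of flows and kernels. -/
theorem kernels : ∃ C : ℝ, 1 ≤ C ∧ ∀ (L : ℕ) [NeZero L] (ε : ℝ), 0 < ε → 1 ≤ ε * (L:ℝ)^3 →
    ∃ (θ : Fin 3 → Torus L → ℝ) (ρ k : Torus L → ℝ),
      (∀ i w, 0 ≤ θ i w) ∧ (∀ w, 0 ≤ ρ w) ∧ (∀ w, 0 ≤ k w) ∧ (∀ w, k (-w) = k w) ∧
      (∀ v : Torus L → ℝ, v 0 = ∑ i, ∑ w, θ i w * (v w - v (w + unitVec L i)) + ∑ w, ρ w * v w) ∧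
      (∀ i x x', ∑ z, θ i (z - x) * θ i (z - x') ≤ C * k (x' - x)) ∧
      (∀ x x', ∑ z, ρ (z - x) * ρ (z - x') ≤ ε * (C * k (x' - x))) ∧
      (∀ i x x', ∑ z, |k (z + unitVec L i - x) - k (z - x)| * |k (z + unitVec L i - x') - k (z - x')| ≤ C * k (x' - x)) ∧
      (∀ x x', ε * ∑ z, k (z - x) * k (z - x') ≤ C * k (x' - x)) ∧ k 0 ≤ C := by
  refine ⟨1024 * 864 * 16384, by norm_num, ?_⟩
  intro L _ ε hε hL
  have mono2 : ∀ (p q : Torus L → ℝ), (∀ z, 0 ≤ p z) → (∀ z, p z ≤ q z) → ∀ x x' : Torus L,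
      ∑ z, p (z - x) * p (z - x') ≤ ∑ z, q (z - x) * q (z - x') := by
    intro p q hp hpq x x'
    exact Finset.sum_le_sum fun z _ => mul_le_mul (hpq _) (hpq _) (hp _) ((hp _).trans (hpq _))
  have scal : ∀ (c : ℝ) (p : Torus L → ℝ) (x x' : Torus L),
      ∑ z, (c * p (z - x)) * (c * p (z - x')) = c^2 * ∑ z, p (z - x) * p (z - x') := by
    intro c p x x'
    rw [Finset.mul_sum]
    exact Finset.sum_congr rfl fun z _ => by ring
  have grad : ∀ (ε : ℝ) (N : ℕ) (i : Fin 3) (x x' : Torus L), 0 < ε → L ≤ 2^N →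
      ∑ z, |kk L ε N (z + unitVec L i - x) - kk L ε N (z - x)| * |kk L ε N (z + unitVec L i - x') - kk L ε N (z - x')|
      ≤ 4 * (864 * 16384 * kk L ε N (x' - x)) := by
    intro ε N i x x' hε hN
    have h := mono2 (fun w => |kk L ε N (w + unitVec L i) - kk L ε N w|) (fun w => 2 * Tk L ε N w)
      (fun _ => abs_nonneg _) (fun w => kk_grad N i w) x x'
    have e : ∀ z x : Torus L, z + unitVec L i - x = z - x + unitVec L i := fun z x => by abel
    simp only [e]
    refine h.trans ?_
    rw [scal]
    have := K1 hε N hN x x'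
    linarith
  by_cases h1 : ε ≤ 1
  · obtain ⟨N, hN, hN'⟩ : ∃ N : ℕ, L ≤ 2^N ∧ 1 ≤ 4^N * ε := by
      obtain ⟨N₁, hN₁⟩ := pow_unbounded_of_one_lt (1/ε) (by norm_num : (1:ℝ) < 4)
      refine ⟨max L N₁, ?_, ?_⟩
      · exact (Nat.lt_two_pow_self.le).trans (Nat.pow_le_pow_right (by norm_num) (le_max_left _ _))
      · have : (4:ℝ)^N₁ ≤ 4^(max L N₁) := pow_le_pow_right₀ (by norm_num) (le_max_right _ _)
        rw [div_lt_iff₀ hε] at hN₁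
        nlinarith
    refine ⟨thq L ε N, rhq L ε N, kk L ε N, thq_nonneg N, rhq_nonneg hε N, kk_nonneg N, kk_neg N,
      flow_id ε N, ?_, ?_, ?_, ?_, ?_⟩
    · intro i x x'
      have h := mono2 (thq L ε N i) (fun w => 32 * Tk L ε N w) (thq_nonneg N i) (thq_le hε N i) x x'
      refine h.trans ?_
      rw [scal]
      have := K1 hε N hN x x'
      linarith
    · intro x x'
      have h := mono2 (rhq L ε N) (fun w => 4 * ε * kP L ε N w) (rhq_nonneg hε N) (rhq_le hε h1 N hN') x x'
      refine h.trans ?_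
      rw [scal]
      have h2 := mul_le_mul_of_nonneg_left (K2 hε N hN x x') (by positivity : 0 ≤ 16 * ε)
      have h3 := mul_nonneg hε.le (kk_nonneg (ε := ε) N (x' - x))
      linarith
    · intro i x x'
      have := grad ε N i x x' hε hN
      have h3 := kk_nonneg (ε := ε) N (x' - x)
      linarith
    · intro x x'
      have h := mono2 (kk L ε N) (kP L ε N) (kk_nonneg N) (kk_le_kP N) x x'
      have h2 := mul_le_mul_of_nonneg_left h hε.le
      have h4 := K2 hε N hN x x'
      have h3 := kk_nonneg (ε := ε) N (x' - x)
      linarith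
    · have := kk_zero hε N hL
      linarith
  · push Not at h1
    have hN : L ≤ 2^L := Nat.lt_two_pow_self.le
    have hL1 : (1:ℝ) ≤ 1 * (L:ℝ)^3 := by
      rw [one_mul]; exact one_le_pow₀ (by exact_mod_cast NeZero.one_le)
    have hinv : 0 < ε⁻¹ := inv_pos.2 hε
    have hinv1 : ε⁻¹ ≤ 1 := inv_le_one_of_one_le₀ h1.le
    refine ⟨fun _ _ => 0, fun w => if w = 0 then 1 else 0, fun w => ε⁻¹ * kk L 1 L w, fun _ _ => le_rfl,
      fun w => by dsimp only; split_ifs <;> norm_num, fun w => mul_nonneg hinv.le (kk_nonneg L w),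
      fun w => by dsimp only; rw [kk_neg], fun v => by simp, ?_, ?_, ?_, ?_, ?_⟩
    · intro i x x'
      have := mul_nonneg hinv.le (kk_nonneg (ε := 1) L (x' - x))
      simp only [mul_zero, Finset.sum_const_zero]
      linarith
    · intro x x'
      have hk := kk_nonneg (ε := 1) L (x' - x)
      rw [show ε * (1024 * 864 * 16384 * (ε⁻¹ * kk L 1 L (x' - x))) = 1024 * 864 * 16384 * kk L 1 L (x' - x) by field_simp]
      have : ∑ z : Torus L, (if z - x = 0 then (1:ℝ) else 0) * (if z - x' = 0 then 1 else 0) = if x' - x = 0 then 1 else 0 := by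
        simp only [sub_eq_zero]
        simp [eq_comm]
      rw [this]
      split_ifs with h
      · rw [h]
        have h0 : aq 1 0 * KF L 0 0 ≤ kk L 1 L 0 :=
          Finset.single_le_sum (f := fun n => aq 1 n * KF L n 0) (fun n _ => mul_nonneg (aq_nonneg n) (KF_nonneg n 0)) (by simp)
        have hF : KF L 0 0 = 1 := by
          have h00 : Sn 0 = {0} := by ext j; simp only [Sn, Finset.mem_Ico, Finset.mem_singleton]; omega
          unfold KF Fn cnt
          simp only [h00, Finset.sum_singleton]
          simp
        have ha : aq 1 0 = 1/4 := by norm_num [aq, sq]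
        rw [hF, ha] at h0
        linarith
      · positivity
    · intro i x x'
      have h := grad 1 L i x x' one_pos hN
      have hk := kk_nonneg (ε := 1) L (x' - x)
      simp only [← mul_sub, abs_mul, abs_of_pos hinv]
      have e : ∀ a b : ℝ, ε⁻¹ * a * (ε⁻¹ * b) = ε⁻¹^2 * (a * b) := fun a b => by ring
      simp only [e]
      rw [← Finset.mul_sum]
      have h2 := mul_le_mul_of_nonneg_left h (sq_nonneg ε⁻¹)
      have h3 : ε⁻¹^2 ≤ ε⁻¹ := by nlinarith
      have h4 := mul_le_mul_of_nonneg_right h3 hk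
      have h5 := mul_nonneg hinv.le hk
      linarith
    · intro x x'
      have h := mono2 (kk L 1 L) (kP L 1 L) (kk_nonneg L) (kk_le_kP L) x x'
      have h4 := K2 one_pos L hN x x'
      have hk := kk_nonneg (ε := 1) L (x' - x)
      rw [scal]
      have h6 : ε * (ε⁻¹^2 * ∑ z, kk L 1 L (z - x) * kk L 1 L (z - x')) = ε⁻¹ * ∑ z, kk L 1 L (z - x) * kk L 1 L (z - x') := by
        field_simp
      rw [h6]
      have h7 : ∑ z, kk L 1 L (z - x) * kk L 1 L (z - x') ≤ 576 * 16384 * kk L 1 L (x' - x) := by linarith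
      have h8 := mul_le_mul_of_nonneg_left h7 hinv.le
      have h5 := mul_nonneg hinv.le hk
      linarith
    · have h := kk_zero (L := L) one_pos L hL1
      have hk := kk_nonneg (ε := 1) L (0 : Torus L)
      have : ε⁻¹ * kk L 1 L 0 ≤ 1 * kk L 1 L 0 := mul_le_mul_of_nonneg_right hinv1 hk
      linarith

end scales
end QD

namespace QD
section determ
open Matrix
variable [NeZero L]

lemma Dmat_quad (β ε : ℝ) (t v : Torus L → ℝ) :
    v ⬝ᵥ Dmat β ε t *ᵥ v =
      (1/2) * (∑ j, ∑ k, if NN j k then β * (Real.exp (t j) * Real.exp (t k)) * (v j - v k)^2 else 0)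
       + ∑ j, ε * Real.exp (t j) * (v j)^2 := by
  have h1 : v ⬝ᵥ Dmat β ε t *ᵥ v = (fun k => Real.exp (t k) * v k) ⬝ᵥ
      Hm (Wb L β) (Bt (Wb L β) (fun _ => ε) t) *ᵥ (fun k => Real.exp (t k) * v k) := by
    rw [Dmat_eq, ← mulVec_mulVec, ← mulVec_mulVec]
    have e1 : (diagonal fun k => Real.exp (t k)) *ᵥ v = fun k => Real.exp (t k) * v k := by
      ext k; rw [mulVec_diagonal]
    rw [e1]
    simp only [dotProduct, mulVec_diagonal]
    exact Finset.sum_congr rfl fun k _ => by ring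
  rw [h1, Hm_Bt_quad _ (Wb_symm β) (Wb_diag β)]
  have h2 : ∀ k, Real.exp (t k) * v k * Real.exp (-t k) = v k := by
    intro k
    rw [mul_right_comm, ← Real.exp_add]; simp
  simp only [h2]
  congr 1
  · congr 1
    refine Finset.sum_congr rfl fun j _ => Finset.sum_congr rfl fun k _ => ?_
    unfold Wb
    split_ifs <;> simp
  · refine Finset.sum_congr rfl fun j _ => ?_
    have := h2 j
    calc _ = ε * Real.exp (t j) * v j * (Real.exp (t j) * v j * Real.exp (-t j)) := by ring
      _ = _ := by rw [this]; ring

lemma Dmat_symm (β ε : ℝ) (t : Torus L → ℝ) : (Dmat β ε t)ᵀ = Dmat β ε t := by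
  ext j k
  simp only [Dmat, transpose_apply, of_apply]
  by_cases h : j = k
  · subst h; simp
  · rw [if_neg h, if_neg (Ne.symm h), NN_symm (x := k), add_comm (t k)]

lemma Dmat_posDef {β ε : ℝ} (hβ : 0 ≤ β) (hε : 0 < ε) (t : Torus L → ℝ) : (Dmat β ε t).PosDef := by
  rw [posDef_iff_dotProduct_mulVec]
  refine ⟨?_, fun v hv => ?_⟩
  · rw [IsHermitian, conjTranspose_eq_transpose_of_trivial]; exact Dmat_symm β ε t
  · rw [star_trivial, Dmat_quad]
    obtain ⟨i, hi⟩ := Function.ne_iff.1 hv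
    have hi : v i ≠ 0 := hi
    refine add_pos_of_nonneg_of_pos ?_ ?_
    · refine mul_nonneg (by norm_num) (Finset.sum_nonneg fun j _ => Finset.sum_nonneg fun k _ => ?_)
      split_ifs <;> positivity
    · refine Finset.sum_pos' (fun j _ => by positivity) ⟨i, Finset.mem_univ _, by positivity⟩

lemma nn_le (g : Torus L → Torus L → ℝ) (hg : ∀ x y, 0 ≤ g x y) (hs : ∀ x y, g x y = g y x) :
    (1/2) * (∑ j, ∑ k, if NN j k then g j k else 0) ≤ ∑ i, ∑ z, g z (z + unitVec L i) := by
  have h1 : ∀ j k : Torus L, (if NN j k then g j k else 0) ≤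
      ∑ i, ((if k = j + unitVec L i then g j k else 0) + (if k = j - unitVec L i then g j k else 0)) := by
    intro j k
    have h0 : ∀ i : Fin 3, 0 ≤ ((if k = j + unitVec L i then g j k else 0) + (if k = j - unitVec L i then g j k else 0)) := by
      intro i
      have := hg j k
      split_ifs <;> linarith
    split_ifs with h
    · obtain ⟨_, i, hi⟩ := h
      refine le_trans ?_ (Finset.single_le_sum (fun i _ => h0 i) (Finset.mem_univ i))
      have := hg j k
      rcases hi with hi | hi
      · rw [if_pos hi]; split_ifs <;> linarith
      · rw [if_pos hi]; split_ifs <;> linarith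
    · exact Finset.sum_nonneg fun i _ => h0 i
  have h2 : ∑ j, ∑ k, (if NN j k then g j k else 0) ≤
      ∑ j, ∑ k, ∑ i, ((if k = j + unitVec L i then g j k else 0) + (if k = j - unitVec L i then g j k else 0)) :=
    Finset.sum_le_sum fun j _ => Finset.sum_le_sum fun k _ => h1 j k
  have h3 : ∑ j, ∑ k, ∑ i, ((if k = j + unitVec L i then g j k else 0) + (if k = j - unitVec L i then g j k else 0))
      = ∑ i, ∑ j, (g j (j + unitVec L i) + g j (j - unitVec L i)) := by
    rw [Finset.sum_comm' (t' := Finset.univ) (s' := fun _ => Finset.univ) (by simp)]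
    conv_lhs => enter [2, y]; rw [Finset.sum_comm]
    rw [Finset.sum_comm]
    refine Finset.sum_congr rfl fun i _ => ?_
    rw [Finset.sum_comm]
    refine Finset.sum_congr rfl fun j _ => ?_
    rw [Finset.sum_add_distrib]
    simp
  have h4 : ∀ i, ∑ j : Torus L, g j (j - unitVec L i) = ∑ j, g j (j + unitVec L i) := by
    intro i
    rw [← Equiv.sum_comp (Equiv.addRight (unitVec L i))]
    refine Finset.sum_congr rfl fun j _ => ?_
    simp [hs]
  rw [h3] at h2
  simp only [Finset.sum_add_distrib, h4] at h2
  linarith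

lemma unit_ne (h1 : (1 : ZMod L) ≠ 0) (i : Fin 3) : unitVec L i ≠ 0 := by
  intro h
  have := congrFun h i
  simp [unitVec] at this
  exact h1 this

lemma unit_inj (h1 : (1 : ZMod L) ≠ 0) : Function.Injective (unitVec L) := by
  intro i j h
  by_contra hij
  have := congrFun h i
  simp [unitVec, hij] at this
  exact h1 this

lemma le_nn (h1 : (1 : ZMod L) ≠ 0) (g : Torus L → Torus L → ℝ) (hg : ∀ x y, 0 ≤ g x y) :
    ∑ i, ∑ z, g z (z + unitVec L i) ≤ ∑ j, ∑ k, if NN j k then g j k else 0 := by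
  rw [Finset.sum_comm]
  refine Finset.sum_le_sum fun z _ => ?_
  have hinj : Function.Injective fun i => z + unitVec L i := fun i j h => unit_inj h1 (add_left_cancel h)
  have hNN : ∀ i, NN z (z + unitVec L i) := fun i => ⟨fun h => unit_ne h1 i (by simpa using h), i, Or.inl rfl⟩
  calc ∑ i, g z (z + unitVec L i) = ∑ i, (fun k => if NN z k then g z k else 0) (z + unitVec L i) :=
        Finset.sum_congr rfl fun i _ => by simp [hNN i]
    _ = ∑ k ∈ Finset.univ.image (fun i => z + unitVec L i), (fun k => if NN z k then g z k else 0) k := by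
        rw [Finset.sum_image (fun a _ b _ h => hinj h)]
    _ ≤ _ := Finset.sum_le_sum_of_subset_of_nonneg (Finset.subset_univ _) fun k _ _ => by
        have := hg z k
        split_ifs <;> linarith

lemma quad_upper {β ε : ℝ} (hβ : 0 ≤ β) (t v : Torus L → ℝ) :
    v ⬝ᵥ Dmat β ε t *ᵥ v ≤ β * (∑ i, ∑ z, Real.exp (t z) * Real.exp (t (z + unitVec L i)) * (v z - v (z + unitVec L i))^2)
      + ε * ∑ z, Real.exp (t z) * (v z)^2 := by
  rw [Dmat_quad]
  have := nn_le (fun j k => β * (Real.exp (t j) * Real.exp (t k)) * (v j - v k)^2)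
    (fun j k => by positivity) (fun j k => by ring)
  simp only [Finset.mul_sum, mul_assoc] at this ⊢
  linarith

lemma quad_lower {β ε : ℝ} (h1 : (1 : ZMod L) ≠ 0) (hβ : 0 ≤ β) (t v : Torus L → ℝ) :
    (β / 2) * (∑ i, ∑ z, Real.exp (t z) * Real.exp (t (z + unitVec L i)) * (v z - v (z + unitVec L i))^2)
      + ε * ∑ z, Real.exp (t z) * (v z)^2 ≤ v ⬝ᵥ Dmat β ε t *ᵥ v := by
  rw [Dmat_quad]
  have := le_nn h1 (fun j k => β * (Real.exp (t j) * Real.exp (t k)) * (v j - v k)^2)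
    (fun j k => by positivity)
  have e : ∑ i, ∑ z, β * (Real.exp (t z) * Real.exp (t (z + unitVec L i))) * (v z - v (z + unitVec L i))^2 =
    β * ∑ i, ∑ z, Real.exp (t z) * Real.exp (t (z + unitVec L i)) * (v z - v (z + unitVec L i))^2 := by
    simp only [Finset.mul_sum, mul_assoc]
  rw [e] at this
  have e2 : ∑ j, ε * Real.exp (t j) * (v j)^2 = ε * ∑ z, Real.exp (t z) * (v z)^2 := by
    simp only [Finset.mul_sum, mul_assoc]
  rw [e2]
  linarith

lemma inv_lower {A : Matrix (Torus L) (Torus L) ℝ} (hA : A.PosDef) (h φ : Torus L → ℝ) :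
    2 * (φ ⬝ᵥ h) - φ ⬝ᵥ A *ᵥ φ ≤ h ⬝ᵥ A⁻¹ *ᵥ h := by
  have hu : A *ᵥ (A⁻¹ *ᵥ h) = h := by
    rw [mulVec_mulVec, mul_nonsing_inv _ (isUnit_iff_ne_zero.2 hA.det_pos.ne'), one_mulVec]
  set u := A⁻¹ *ᵥ h
  have hs : Aᵀ = A := by
    have := hA.isHermitian
    rwa [IsHermitian, conjTranspose_eq_transpose_of_trivial] at this
  have h0 := hA.posSemidef.dotProduct_mulVec_nonneg (u - φ)
  rw [star_trivial, mulVec_sub, hu, sub_dotProduct, dotProduct_sub, dotProduct_sub] at h0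
  have h2 : u ⬝ᵥ A *ᵥ φ = φ ⬝ᵥ h := by
    rw [dotProduct_mulVec, ← mulVec_transpose, hs, hu, dotProduct_comm]
  rw [h2, dotProduct_comm u h] at h0
  linarith

lemma flow_at (θ : Fin 3 → Torus L → ℝ) (ρ : Torus L → ℝ)
    (hfl : ∀ v : Torus L → ℝ, v 0 = ∑ i, ∑ w, θ i w * (v w - v (w + unitVec L i)) + ∑ w, ρ w * v w)
    (v : Torus L → ℝ) (x : Torus L) :
    v x = ∑ i, ∑ z, θ i (z - x) * (v z - v (z + unitVec L i)) + ∑ z, ρ (z - x) * v z := by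
  have h := hfl (fun w => v (w + x))
  rw [zero_add] at h
  rw [h]
  congr 1
  · refine Finset.sum_congr rfl fun i _ => ?_
    rw [← Equiv.sum_comp (Equiv.addRight x) (fun z => θ i (z - x) * (v z - v (z + unitVec L i)))]
    refine Finset.sum_congr rfl fun w _ => ?_
    simp [add_right_comm]
  · rw [← Equiv.sum_comp (Equiv.addRight x) (fun z => ρ (z - x) * v z)]
    simp

lemma thomson {β ε : ℝ} (hβ : 0 < β) (hε : 0 < ε) (h1 : (1 : ZMod L) ≠ 0)
    (θ : Fin 3 → Torus L → ℝ) (ρ : Torus L → ℝ)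
    (hfl : ∀ v : Torus L → ℝ, v 0 = ∑ i, ∑ w, θ i w * (v w - v (w + unitVec L i)) + ∑ w, ρ w * v w)
    (t h : Torus L → ℝ) :
    h ⬝ᵥ (Dmat β ε t)⁻¹ *ᵥ h ≤ 2 * (β⁻¹ * (∑ i, ∑ z, (∑ x, h x * θ i (z - x))^2 * Real.exp (- t z - t (z + unitVec L i)))
      + ε⁻¹ * ∑ z, (∑ x, h x * ρ (z - x))^2 * Real.exp (- t z)) := by
  have hA := Dmat_posDef hβ.le hε t
  have hu : Dmat β ε t *ᵥ ((Dmat β ε t)⁻¹ *ᵥ h) = h := by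
    rw [mulVec_mulVec, mul_nonsing_inv _ (isUnit_iff_ne_zero.2 hA.det_pos.ne'), one_mulVec]
  set u := (Dmat β ε t)⁻¹ *ᵥ h
  have hE : u ⬝ᵥ Dmat β ε t *ᵥ u = h ⬝ᵥ u := by rw [hu, dotProduct_comm]
  have hq := quad_lower (ε := ε) h1 hβ.le t u
  rw [hE] at hq
  have e1 : h ⬝ᵥ u = ∑ i, ∑ z, (∑ x, h x * θ i (z - x)) * (u z - u (z + unitVec L i)) +
      ∑ z, (∑ x, h x * ρ (z - x)) * u z := by
    have : ∀ x, h x * u x = ∑ i, ∑ z, h x * θ i (z - x) * (u z - u (z + unitVec L i)) + ∑ z, h x * ρ (z - x) * u z := by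
      intro x
      rw [flow_at θ ρ hfl u x]
      simp only [mul_add, Finset.mul_sum, mul_assoc]
    simp only [dotProduct, this, Finset.sum_add_distrib, Finset.sum_mul]
    congr 1
    · rw [Finset.sum_comm]
      refine Finset.sum_congr rfl fun i _ => ?_
      rw [Finset.sum_comm]
    · rw [Finset.sum_comm]
  have am : ∀ c Θ d : ℝ, 0 < c → Θ * d ≤ Θ^2 * c⁻¹ + (1/4) * (c * d^2) := by
    intro c Θ d hc
    have : 0 ≤ c⁻¹ * (Θ - c * d / 2)^2 := by positivity
    have e : c⁻¹ * (Θ - c * d / 2)^2 = Θ^2 * c⁻¹ + (1/4) * (c * d^2) - Θ * d := by field_simp; ring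
    linarith
  have b1 : ∑ i, ∑ z, (∑ x, h x * θ i (z - x)) * (u z - u (z + unitVec L i)) ≤
      ∑ i, ∑ z, (β⁻¹ * ((∑ x, h x * θ i (z - x))^2 * Real.exp (- t z - t (z + unitVec L i))) +
       (1/4) * β * (Real.exp (t z) * Real.exp (t (z + unitVec L i)) * (u z - u (z + unitVec L i))^2)) := by
    refine Finset.sum_le_sum fun i _ => Finset.sum_le_sum fun z _ => ?_
    refine (am (β * (Real.exp (t z) * Real.exp (t (z + unitVec L i)))) _ _ (by positivity)).trans (le_of_eq ?_)
    rw [mul_inv, mul_inv, ← Real.exp_neg, ← Real.exp_neg, ← Real.exp_add, ← sub_eq_add_neg]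
    ring
  have b2 : ∑ z, (∑ x, h x * ρ (z - x)) * u z ≤
      ∑ z, (ε⁻¹ * ((∑ x, h x * ρ (z - x))^2 * Real.exp (- t z)) + (1/4) * ε * (Real.exp (t z) * (u z)^2)) := by
    refine Finset.sum_le_sum fun z _ => ?_
    refine (am (ε * Real.exp (t z)) _ _ (by positivity)).trans (le_of_eq ?_)
    rw [mul_inv, ← Real.exp_neg]
    ring
  simp only [Finset.sum_add_distrib, ← Finset.mul_sum] at b1 b2
  have pos : 0 ≤ ε * ∑ z, Real.exp (t z) * (u z)^2 := mul_nonneg hε.le (Finset.sum_nonneg fun z _ => by positivity)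
  linarith

lemma Dinv_diag_le {β ε : ℝ} (hβ : 0 < β) (hε : 0 < ε) (h1 : (1 : ZMod L) ≠ 0) (t : Torus L → ℝ) (y : Torus L) :
    (Dmat β ε t)⁻¹ y y ≤ 2 * ε⁻¹ * Real.exp (-t y) := by
  have h := thomson hβ hε h1 (fun _ _ => 0) (fun w => if w = 0 then 1 else 0) (fun v => by simp) t (Pi.single y 1)
  have e : ∀ F : Torus L → ℝ, ∑ x, (Pi.single y (1:ℝ) : Torus L → ℝ) x * F x = F y := by
    intro F; simp [Pi.single_apply]
  simp only [e] at h
  simpa [sub_eq_zero, mul_assoc] using h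

lemma Dinv_entry_le {β ε : ℝ} (hβ : 0 < β) (hε : 0 < ε) (h1 : (1 : ZMod L) ≠ 0) (t : Torus L → ℝ) (i j : Torus L) :
    |Real.exp (t i + t j) * (Dmat β ε t)⁻¹ i j| ≤ ε⁻¹ * (Real.exp (t i) + Real.exp (t j)) := by
  have hA := (Dmat_posDef hβ.le hε t).inv
  have hs : (Dmat β ε t)⁻¹ j i = (Dmat β ε t)⁻¹ i j := by
    have : ((Dmat β ε t)⁻¹)ᵀ = (Dmat β ε t)⁻¹ := by rw [transpose_nonsing_inv, Dmat_symm]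
    exact congrFun (congrFun this i) j
  have p1 := hA.posSemidef.dotProduct_mulVec_nonneg (Pi.single i 1 + Pi.single j 1)
  have p2 := hA.posSemidef.dotProduct_mulVec_nonneg (Pi.single i 1 - Pi.single j 1)
  simp only [star_trivial, mulVec_add, mulVec_sub, add_dotProduct, sub_dotProduct, dotProduct_add, dotProduct_sub,
    single_dotProduct, mulVec_single, one_mul, MulOpposite.op_one, one_smul, col_apply, hs] at p1 p2
  have d1 := Dinv_diag_le hβ hε h1 t i
  have d2 := Dinv_diag_le hβ hε h1 t j
  have hab : |(Dmat β ε t)⁻¹ i j| ≤ ε⁻¹ * (Real.exp (-t i) + Real.exp (-t j)) := by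
    rw [abs_le]; constructor <;> linarith
  rw [abs_mul, abs_of_pos (Real.exp_pos _)]
  refine (mul_le_mul_of_nonneg_left hab (Real.exp_pos _).le).trans (le_of_eq ?_)
  have q1 : Real.exp (t i + t j) * Real.exp (-t i) = Real.exp (t j) := by rw [← Real.exp_add]; ring_nf
  have q2 : Real.exp (t i + t j) * Real.exp (-t j) = Real.exp (t i) := by rw [← Real.exp_add]; ring_nf
  linear_combination ε⁻¹ * q1 + ε⁻¹ * q2

lemma Dmat_cont (β ε : ℝ) : Continuous fun t : Torus L → ℝ => Dmat β ε t := by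
  refine continuous_matrix fun j k => ?_
  simp only [Dmat, of_apply]
  split_ifs
  · refine Continuous.add (continuous_const.mul (continuous_finsetSum _ fun i _ => ?_)) (by fun_prop)
    split_ifs <;> fun_prop
  · fun_prop
  · fun_prop

lemma Dinv_meas (β ε : ℝ) (i j : Torus L) : Measurable fun t : Torus L → ℝ => (Dmat β ε t)⁻¹ i j := by
  have : ∀ t : Torus L → ℝ, (Dmat β ε t)⁻¹ i j = ((Dmat β ε t).det)⁻¹ * (Dmat β ε t).adjugate i j := by
    intro t
    rw [inv_def, Ring.inverse_eq_inv', Matrix.smul_apply, smul_eq_mul]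
  simp only [this]
  have h1 : Continuous fun t : Torus L → ℝ => (Dmat β ε t).det := (Dmat_cont β ε).matrix_det
  have h2 : Continuous fun t : Torus L → ℝ => (Dmat β ε t).adjugate i j :=
    (Dmat_cont β ε).matrix_adjugate.matrix_elem i j
  exact h1.measurable.inv.mul h2.measurable

lemma corr_int {β ε : ℝ} (hβ : 0 < β) (hε : 0 < ε) (h1 : (1 : ZMod L) ≠ 0) (i j : Torus L) :
    Integrable (fun t => Real.exp (t i + t j) * (Dmat β ε t)⁻¹ i j) (mu L β ε) := by
  have h2 := int_pos_of (L := L) hβ.le hε i 1 (by norm_num) (by norm_num)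
  have h3 := int_pos_of (L := L) hβ.le hε j 1 (by norm_num) (by norm_num)
  simp only [one_mul] at h2 h3
  refine ((h2.add h3).const_mul ε⁻¹).mono' ?_ (Filter.Eventually.of_forall fun t => ?_)
  · exact (Measurable.mul (by fun_prop) (Dinv_meas β ε i j)).aestronglyMeasurable
  · exact Dinv_entry_le hβ hε h1 t i j

lemma corr_sum {β ε : ℝ} (hβ : 0 < β) (hε : 0 < ε) (h1 : (1 : ZMod L) ≠ 0) (f : Torus L → ℝ) :
    Integrable (fun t => (fun x => f x * Real.exp (t x)) ⬝ᵥ (Dmat β ε t)⁻¹ *ᵥ (fun x => f x * Real.exp (t x))) (mu L β ε) ∧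
    ∑ i, ∑ j, corr β ε i j * f i * f j =
      ∫ t, (fun x => f x * Real.exp (t x)) ⬝ᵥ (Dmat β ε t)⁻¹ *ᵥ (fun x => f x * Real.exp (t x)) ∂(mu L β ε) := by
  have e : ∀ t : Torus L → ℝ, (fun x => f x * Real.exp (t x)) ⬝ᵥ (Dmat β ε t)⁻¹ *ᵥ (fun x => f x * Real.exp (t x)) =
      ∑ i, ∑ j, (f i * f j) * (Real.exp (t i + t j) * (Dmat β ε t)⁻¹ i j) := by
    intro t
    simp only [dotProduct, mulVec, Finset.mul_sum]
    refine Finset.sum_congr rfl fun i _ => Finset.sum_congr rfl fun j _ => ?_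
    rw [Real.exp_add]; ring
  simp only [e]
  have hi : ∀ i j, Integrable (fun t => (f i * f j) * (Real.exp (t i + t j) * (Dmat β ε t)⁻¹ i j)) (mu L β ε) :=
    fun i j => (corr_int hβ hε h1 i j).const_mul _
  refine ⟨integrable_finsetSum _ fun i _ => integrable_finsetSum _ fun j _ => hi i j, ?_⟩
  rw [integral_finsetSum _ fun i _ => integrable_finsetSum _ fun j _ => hi i j]
  refine Finset.sum_congr rfl fun i _ => ?_
  rw [integral_finsetSum _ fun j _ => hi i j]
  refine Finset.sum_congr rfl fun j _ => ?_
  rw [integral_const_mul, corr, expect_eq hβ.le hε]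
  ring

end determ
end QD

namespace QD
section prob
open Matrix

/-- integrable with integral at most `c` -/
def Bd {Ω : Type} [MeasurableSpace Ω] (μ : Measure Ω) (g : Ω → ℝ) (c : ℝ) : Prop := Integrable g μ ∧ ∫ t, g t ∂μ ≤ c

section bd
variable {Ω : Type} [MeasurableSpace Ω] {μ : Measure Ω}

lemma Bd.add {g h : Ω → ℝ} {c d : ℝ} (hg : Bd μ g c) (hh : Bd μ h d) : Bd μ (fun t => g t + h t) (c + d) :=
  ⟨hg.1.add hh.1, by rw [integral_add hg.1 hh.1]; exact add_le_add hg.2 hh.2⟩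
lemma Bd.smul {g : Ω → ℝ} {c : ℝ} (a : ℝ) (ha : 0 ≤ a) (hg : Bd μ g c) : Bd μ (fun t => a * g t) (a * c) :=
  ⟨hg.1.const_mul a, by rw [integral_const_mul]; exact mul_le_mul_of_nonneg_left hg.2 ha⟩
lemma Bd.sum {ι : Type} [Fintype ι] {g : ι → Ω → ℝ} {c : ι → ℝ} (hg : ∀ i, Bd μ (g i) (c i)) :
    Bd μ (fun t => ∑ i, g i t) (∑ i, c i) :=
  ⟨integrable_finsetSum _ fun i _ => (hg i).1, by
    rw [integral_finsetSum _ fun i _ => (hg i).1]; exact Finset.sum_le_sum fun i _ => (hg i).2⟩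
lemma Bd.le {g : Ω → ℝ} {c d : ℝ} (hg : Bd μ g c) (h : c ≤ d) : Bd μ g d := ⟨hg.1, hg.2.trans h⟩
lemma Bd.mono {g h : Ω → ℝ} {c : ℝ} (hh : Bd μ h c) (hm : Measurable g) (h0 : ∀ t, 0 ≤ g t) (hgh : ∀ t, g t ≤ h t) :
    Bd μ g c := by
  have hi : Integrable g μ := hh.1.mono' hm.aestronglyMeasurable (Filter.Eventually.of_forall fun t => by
    rw [Real.norm_eq_abs, abs_of_nonneg (h0 t)]; exact hgh t)
  exact ⟨hi, (integral_mono hi hh.1 hgh).trans hh.2⟩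
lemma Bd.const [IsProbabilityMeasure μ] (c : ℝ) : Bd μ (fun _ => c) c := ⟨integrable_const c, by simp⟩
end bd

lemma pw1 (A B C : ℝ) : A^2 * (B * C) ≤ (1/4) * (2 * A^4 + (B^4 + C^4)) := by
  nlinarith [sq_nonneg (B - C), sq_nonneg A, mul_nonneg (sq_nonneg A) (sq_nonneg (B - C)), sq_nonneg (A^2 - B^2), sq_nonneg (A^2 - C^2)]
lemma pw2 (A δ : ℝ) (hA : 0 ≤ A) (hδ : 0 < δ) : A^3 ≤ δ * A^4 + δ⁻¹^3 := by
  rcases le_total A δ⁻¹ with h | h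
  · have := pow_le_pow_left₀ hA h 3
    have h2 : 0 ≤ δ * A^4 := by positivity
    linarith
  · have h1 : 1 ≤ δ * A := by
      have := mul_le_mul_of_nonneg_left h hδ.le
      rwa [mul_inv_cancel₀ hδ.ne'] at this
    have h2 := mul_le_mul_of_nonneg_right h1 (by positivity : 0 ≤ A^3)
    have h3 : 0 ≤ δ⁻¹^3 := by positivity
    linarith
lemma pw3 (A B δ : ℝ) (hA : 0 ≤ A) (hB : 0 ≤ B) (hδ : 0 < δ) :
    A^2 * B ≤ δ * ((2/3) * A^4 + (1/3) * B^4) + δ⁻¹^3 := by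
  have h1 := pw2 A δ hA hδ
  have h2 := pw2 B δ hB hδ
  have h3 : 0 ≤ (A - B)^2 * (2 * A + B) := by positivity
  linarith
lemma pw4 (A B C D : ℝ) : A * B * (C * D) ≤ (1/4) * ((A^4 + B^4) + (C^4 + D^4)) := by
  nlinarith [sq_nonneg (A * B - C * D), sq_nonneg (A^2 - B^2), sq_nonneg (C^2 - D^2)]

lemma exp4 (a : ℝ) : Real.exp (-4 * a) = Real.exp (-a)^4 := by rw [← Real.exp_nat_mul]; congr 1; push_cast; ring
lemma exp4' (a : ℝ) : Real.exp (4 * a) = Real.exp a^4 := by rw [← Real.exp_nat_mul]; congr 1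
lemma exp3 (a : ℝ) : Real.exp (-3 * a) = Real.exp (-a)^3 := by rw [← Real.exp_nat_mul]; congr 1; push_cast; ring
lemma exp2 (a : ℝ) : Real.exp (-2 * a) = Real.exp (-a)^2 := by rw [← Real.exp_nat_mul]; congr 1; push_cast; ring

variable [NeZero L]

lemma moments_aux {β ε C : ℝ} (hβ : 0 < β) (hε : 0 < ε) (hC : 1 ≤ C) (hβC : 168 * C^2 ≤ β) (h1 : (1 : ZMod L) ≠ 0)
    (θ : Fin 3 → Torus L → ℝ) (ρ k : Torus L → ℝ)
    (hfl : ∀ v : Torus L → ℝ, v 0 = ∑ i, ∑ w, θ i w * (v w - v (w + unitVec L i)) + ∑ w, ρ w * v w)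
    (ha1 : ∀ i x x', ∑ z, θ i (z - x) * θ i (z - x') ≤ C * k (x' - x))
    (ha2 : ∀ x x', ∑ z, ρ (z - x) * ρ (z - x') ≤ ε * (C * k (x' - x))) (hk : k 0 ≤ C) :
    ∀ y : Torus L, ∫ t, Real.exp (-4 * t y) ∂(mu L β ε) ≤ 4 * (1 + 14 * C^2 * (56 * C^2)^3) := by
  have hC0 : 0 < C := by linarith
  have hpr := mu_prob (L := L) hβ.le hε
  obtain ⟨y0, hy0⟩ := Finite.exists_max (fun y : Torus L => ∫ t, Real.exp (-4 * t y) ∂(mu L β ε))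
  set M := ∫ t, Real.exp (-4 * t y0) ∂(mu L β ε) with hM
  have hM0 : 0 ≤ M := integral_nonneg fun t => (Real.exp_pos _).le
  suffices hs : M ≤ 4 * (1 + 14 * C^2 * (56 * C^2)^3) from fun y => (hy0 y).trans hs
  have b4 : ∀ y, Bd (mu L β ε) (fun t => Real.exp (-4 * t y)) M := fun y => ⟨int_neg4 hβ.le hε y, hy0 y⟩
  set δ := (56 * C^2)⁻¹ with hδ
  have hδ0 : 0 < δ := by positivity
  have bG : Bd (mu L β ε) (fun t => 2 * (β⁻¹ * (∑ i, ∑ z, (θ i (z - y0))^2 * ((1/4) * (2 * Real.exp (-4 * t y0) + (Real.exp (-4 * t z) + Real.exp (-4 * t (z + unitVec L i))))))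
      + ε⁻¹ * ∑ z, (ρ (z - y0))^2 * (δ * ((2/3) * Real.exp (-4 * t y0) + (1/3) * Real.exp (-4 * t z)) + δ⁻¹^3)))
      (2 * (β⁻¹ * (∑ i, ∑ z, (θ i (z - y0))^2 * ((1/4) * (2 * M + (M + M))))
      + ε⁻¹ * ∑ z, (ρ (z - y0))^2 * (δ * ((2/3) * M + (1/3) * M) + δ⁻¹^3))) := by
    refine Bd.smul _ (by norm_num) (Bd.add (Bd.smul _ (by positivity) (Bd.sum fun i => Bd.sum fun z => Bd.smul _ (sq_nonneg _) ?_))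
      (Bd.smul _ (by positivity) (Bd.sum fun z => Bd.smul _ (sq_nonneg _) ?_)))
    · exact Bd.smul _ (by norm_num) (((b4 y0).smul 2 (by norm_num)).add ((b4 z).add (b4 _)))
    · exact ((((b4 y0).smul _ (by norm_num)).add ((b4 z).smul _ (by norm_num))).smul _ hδ0.le).add (Bd.const _)
  have hmain := neg4_le hβ.le hε y0 _ bG.1 (fun t => by positivity) (fun t => by
    have h := thomson hβ hε h1 θ ρ hfl t (Pi.single y0 1)
    have e : ∀ F : Torus L → ℝ, ∑ x, (Pi.single y0 (1:ℝ) : Torus L → ℝ) x * F x = F y0 := by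
      intro F; simp [Pi.single_apply]
    simp only [e] at h
    have e2 : (Pi.single y0 (1:ℝ) : Torus L → ℝ) ⬝ᵥ (Dmat β ε t)⁻¹ *ᵥ (Pi.single y0 1) = (Dmat β ε t)⁻¹ y0 y0 := by simp
    rw [e2] at h
    refine (mul_le_mul_of_nonneg_left h (Real.exp_pos _).le).trans ?_
    rw [mul_left_comm, mul_add, mul_left_comm _ β⁻¹, mul_left_comm _ ε⁻¹]
    simp only [Finset.mul_sum (a := Real.exp (-2 * t y0))]
    refine mul_le_mul_of_nonneg_left (add_le_add (mul_le_mul_of_nonneg_left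
      (Finset.sum_le_sum fun i _ => Finset.sum_le_sum fun z _ => ?_) (by positivity))
      (mul_le_mul_of_nonneg_left (Finset.sum_le_sum fun z _ => ?_) (by positivity))) (by norm_num)
    · rw [mul_left_comm]
      refine mul_le_mul_of_nonneg_left ?_ (sq_nonneg _)
      rw [sub_eq_add_neg, Real.exp_add, exp2, exp4, exp4, exp4]
      exact pw1 _ _ _
    · rw [mul_left_comm]
      refine mul_le_mul_of_nonneg_left ?_ (sq_nonneg _)
      rw [exp2, exp4, exp4]
      exact pw3 _ _ _ (Real.exp_pos _).le (Real.exp_pos _).le hδ0)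
  rw [← hM] at hmain
  have b2 : Bd (mu L β ε) (fun t => Real.exp (-2 * t y0)) ((1/4) * M + 1) := by
    refine Bd.mono (((b4 y0).smul (1/4) (by norm_num)).add (Bd.const 1)) (exp_coord_meas _ _) (fun t => (Real.exp_pos _).le) fun t => ?_
    rw [exp2, exp4]
    nlinarith [sq_nonneg ((1/2) * Real.exp (-t y0)^2 - 1)]
  have hθ : ∀ i, ∑ z, (θ i (z - y0))^2 ≤ C^2 := by
    intro i
    have := ha1 i y0 y0
    rw [sub_self] at this
    simp only [← pow_two] at this
    nlinarith
  have hρ : ε⁻¹ * ∑ z, (ρ (z - y0))^2 ≤ C^2 := by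
    have := ha2 y0 y0
    rw [sub_self] at this
    simp only [← pow_two] at this
    rw [inv_mul_le_iff₀ hε]
    refine this.trans (mul_le_mul_of_nonneg_left (by nlinarith) hε.le)
  have hθ3 : ∑ i, ∑ z, (θ i (z - y0))^2 ≤ 3 * C^2 := by
    rw [Fin.sum_univ_three]; linarith [hθ 0, hθ 1, hθ 2]
  have g2 := bG.2
  simp only [← Finset.sum_mul] at g2
  have g3 : β⁻¹ * ((∑ i, ∑ z, (θ i (z - y0))^2) * ((1/4) * (2 * M + (M + M)))) ≤ M / 56 := by
    have hb : β⁻¹ * (3 * C^2) ≤ 1/56 := by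
      rw [inv_mul_le_iff₀ hβ]; linarith
    have := mul_le_mul_of_nonneg_left hθ3 (inv_nonneg.2 hβ.le)
    have := mul_le_mul_of_nonneg_right (this.trans hb) hM0
    linarith
  have g4 : ε⁻¹ * ((∑ z, (ρ (z - y0))^2) * (δ * ((2/3) * M + (1/3) * M) + δ⁻¹^3)) ≤ M / 56 + C^2 * (56 * C^2)^3 := by
    have hx : 0 ≤ δ * M + δ⁻¹^3 := by positivity
    have := mul_le_mul_of_nonneg_right hρ hx
    have e : C^2 * (δ * M + δ⁻¹^3) = M / 56 + C^2 * (56 * C^2)^3 := by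
      rw [hδ, inv_inv]; field_simp
    calc _ = ε⁻¹ * (∑ z, (ρ (z - y0))^2) * (δ * M + δ⁻¹^3) := by ring
      _ ≤ _ := by rw [← e]; exact this
  have := b2.2
  linarith

theorem moments : ∃ C : ℝ, 1 ≤ C ∧ ∃ M : ℝ, 1 ≤ M ∧ ∀ (L : ℕ) [NeZero L] (β ε : ℝ), (1 : ZMod L) ≠ 0 → 168 * C^2 ≤ β →
    0 < ε → 1 ≤ ε * (L:ℝ)^3 →
    (∀ y : Torus L, Bd (mu L β ε) (fun t => Real.exp (-t y)^4) M ∧ Bd (mu L β ε) (fun t => Real.exp (t y)^4) M) ∧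
    ∃ (θ : Fin 3 → Torus L → ℝ) (ρ k : Torus L → ℝ),
      (∀ i w, 0 ≤ θ i w) ∧ (∀ w, 0 ≤ ρ w) ∧ (∀ w, 0 ≤ k w) ∧ (∀ w, k (-w) = k w) ∧
      (∀ v : Torus L → ℝ, v 0 = ∑ i, ∑ w, θ i w * (v w - v (w + unitVec L i)) + ∑ w, ρ w * v w) ∧
      (∀ i x x', ∑ z, θ i (z - x) * θ i (z - x') ≤ C * k (x' - x)) ∧
      (∀ x x', ∑ z, ρ (z - x) * ρ (z - x') ≤ ε * (C * k (x' - x))) ∧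
      (∀ i x x', ∑ z, |k (z + unitVec L i - x) - k (z - x)| * |k (z + unitVec L i - x') - k (z - x')| ≤ C * k (x' - x)) ∧
      (∀ x x', ε * ∑ z, k (z - x) * k (z - x') ≤ C * k (x' - x)) := by
  obtain ⟨C, hC, hker⟩ := kernels
  refine ⟨C, hC, 1 + 4 * (1 + 14 * C^2 * (56 * C^2)^3), by have : 0 ≤ C := (by linarith); linarith [(by positivity : 0 ≤ 4 * (1 + 14 * C^2 * (56 * C^2)^3))], ?_⟩
  intro L _ β ε h1 hβC hε hL
  obtain ⟨θ, ρ, k, h01, h02, h03, hk, hfl, ha1, ha2, hb1, hb2, hc⟩ := hker L ε hε hL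
  have hβ : 0 < β := by nlinarith
  have hpr := mu_prob (L := L) hβ.le hε
  refine ⟨fun y => ?_, θ, ρ, k, h01, h02, h03, hk, hfl, ha1, ha2, hb1, hb2⟩
  have hm := moments_aux hβ hε hC hβC h1 θ ρ k hfl ha1 ha2 hc y
  have bm : Bd (mu L β ε) (fun t => Real.exp (-4 * t y)) (4 * (1 + 14 * C^2 * (56 * C^2)^3)) := ⟨int_neg4 hβ.le hε y, hm⟩
  have b3 : Bd (mu L β ε) (fun t => Real.exp (-3 * t y)) (1 + 4 * (1 + 14 * C^2 * (56 * C^2)^3)) := by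
    refine Bd.mono ((Bd.const 1).add bm) (exp_coord_meas _ _) (fun t => (Real.exp_pos _).le) fun t => ?_
    rw [exp3, exp4]
    have := pw2 (Real.exp (-t y)) 1 (Real.exp_pos _).le one_pos
    norm_num at this
    linarith
  have e1 : (fun t : Torus L → ℝ => Real.exp (-t y)^4) = fun t => Real.exp (-4 * t y) := by ext t; rw [exp4]
  have e2 : (fun t : Torus L → ℝ => Real.exp (t y)^4) = fun t => Real.exp (4 * t y) := by ext t; rw [exp4']
  rw [e1, e2]
  refine ⟨bm.le (by linarith), (pos4 hβ.le hε y).1, ?_⟩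
  rw [(pos4 hβ.le hε y).2]
  exact b3.2

end prob
end QD

namespace QD
section final
open Matrix
variable [NeZero L]

lemma lap_eq (β ε : ℝ) : (-β) • lap L + ε • (1 : Matrix (Torus L) (Torus L) ℝ) = Dmat β ε (fun _ => 0) := by
  ext i j
  by_cases h : i = j
  · subst h
    simp [lap, Dmat]
  · simp only [lap, Dmat, Matrix.add_apply, Matrix.smul_apply, Matrix.of_apply, Matrix.one_apply, h, if_false]
    split_ifs <;> simp

lemma qform_eq (G : Matrix (Torus L) (Torus L) ℝ) (u v : Torus L → ℝ) : qform G u v = u ⬝ᵥ G *ᵥ v := by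
  simp only [qform, dotProduct, Matrix.mulVec, Finset.mul_sum, mul_assoc]

lemma sq_expand (f ψ T : Torus L → ℝ) (E : ℝ) : (∑ x, f x * ψ x * T x)^2 * E =
    ∑ x, ∑ x', (f x * f x' * (T x * T x')) * (ψ x * ψ x' * E) := by
  rw [pow_two, Finset.sum_mul_sum, Finset.sum_mul]
  refine Finset.sum_congr rfl fun x _ => ?_
  rw [Finset.sum_mul]
  exact Finset.sum_congr rfl fun x' _ => by ring

lemma swap_bound {C : ℝ} (f k : Torus L → ℝ) (hf : ∀ x, 0 ≤ f x) (F : Torus L → Torus L → Torus L → ℝ)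
    (h : ∀ x x', ∑ z, F z x x' ≤ C * k (x' - x)) :
    ∑ z, ∑ x, ∑ x', f x * f x' * F z x x' ≤ C * ∑ x, ∑ x', f x * f x' * k (x' - x) := by
  rw [Finset.sum_comm, Finset.mul_sum]
  refine Finset.sum_le_sum fun x _ => ?_
  rw [Finset.sum_comm, Finset.mul_sum]
  refine Finset.sum_le_sum fun x' _ => ?_
  rw [← Finset.mul_sum, mul_left_comm]
  exact mul_le_mul_of_nonneg_left (h x x') (mul_nonneg (hf _) (hf _))

lemma Bd4 {β ε M : ℝ} {A B C D : (Torus L → ℝ) → ℝ}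
    (hA : Measurable A) (hB : Measurable B) (hC : Measurable C) (hD : Measurable D)
    (pA : ∀ t, 0 ≤ A t) (pB : ∀ t, 0 ≤ B t) (pC : ∀ t, 0 ≤ C t) (pD : ∀ t, 0 ≤ D t)
    (bA : Bd (mu L β ε) (fun t => A t ^ 4) M) (bB : Bd (mu L β ε) (fun t => B t ^ 4) M)
    (bC : Bd (mu L β ε) (fun t => C t ^ 4) M) (bD : Bd (mu L β ε) (fun t => D t ^ 4) M) :
    Bd (mu L β ε) (fun t => A t * B t * (C t * D t)) M := by
  have h := ((bA.add bB).add (bC.add bD)).smul (1/4) (by norm_num)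
  refine (Bd.mono h (by fun_prop) (fun t => mul_nonneg (mul_nonneg (pA t) (pB t)) (mul_nonneg (pC t) (pD t)))
    (fun t => pw4 _ _ _ _)).le (by linarith)

lemma upper {C M β ε : ℝ} (hC : 1 ≤ C) (hM : 1 ≤ M) (hβ : 1 ≤ β) (hε : 0 < ε) (h1 : (1 : ZMod L) ≠ 0)
    (hmom : ∀ y : Torus L, Bd (mu L β ε) (fun t => Real.exp (-t y)^4) M ∧ Bd (mu L β ε) (fun t => Real.exp (t y)^4) M)
    (θ : Fin 3 → Torus L → ℝ) (ρ k : Torus L → ℝ)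
    (h01 : ∀ i w, 0 ≤ θ i w) (h02 : ∀ w, 0 ≤ ρ w) (hk : ∀ w, k (-w) = k w)
    (hfl : ∀ v : Torus L → ℝ, v 0 = ∑ i, ∑ w, θ i w * (v w - v (w + unitVec L i)) + ∑ w, ρ w * v w)
    (ha1 : ∀ i x x', ∑ z, θ i (z - x) * θ i (z - x') ≤ C * k (x' - x))
    (ha2 : ∀ x x', ∑ z, ρ (z - x) * ρ (z - x') ≤ ε * (C * k (x' - x)))
    (hb1 : ∀ i x x', ∑ z, |k (z + unitVec L i - x) - k (z - x)| * |k (z + unitVec L i - x') - k (z - x')| ≤ C * k (x' - x))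
    (hb2 : ∀ x x', ε * ∑ z, k (z - x) * k (z - x') ≤ C * k (x' - x)) (h03 : ∀ w, 0 ≤ k w)
    (f : Torus L → ℝ) (hf : ∀ j, 0 ≤ f j) :
    ∑ i, ∑ j, corr β ε i j * f i * f j ≤ 32 * β * M * C^2 * (f ⬝ᵥ (Dmat β (ε/2) (fun _ : Torus L => 0))⁻¹ *ᵥ f) := by
  have hβ0 : 0 < β := by linarith
  have hpr := mu_prob (L := L) hβ0.le hε
  set κ := ∑ x, ∑ x', f x * f x' * k (x' - x) with hκ
  have hκ0 : 0 ≤ κ := Finset.sum_nonneg fun x _ => Finset.sum_nonneg fun x' _ => mul_nonneg (mul_nonneg (hf _) (hf _)) (h03 _)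
  have bone : Bd (mu L β ε) (fun _ => (1:ℝ)^4) M := (Bd.const _).le (by simpa using hM)
  -- step 1: the correlation sum against kappa
  have s1 : ∑ i, ∑ j, corr β ε i j * f i * f j ≤ 8 * M * C * κ := by
    obtain ⟨hintg, heq⟩ := corr_sum hβ0 hε h1 f
    rw [heq]
    have bG : Bd (mu L β ε) (fun t => 2 * (β⁻¹ * (∑ i, ∑ z, ∑ x, ∑ x', (f x * f x' * (θ i (z - x) * θ i (z - x'))) *
          (Real.exp (t x) * Real.exp (t x') * (Real.exp (-t z) * Real.exp (-t (z + unitVec L i)))))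
        + ε⁻¹ * ∑ z, ∑ x, ∑ x', (f x * f x' * (ρ (z - x) * ρ (z - x'))) * (Real.exp (t x) * Real.exp (t x') * (Real.exp (-t z) * 1))))
        (2 * (β⁻¹ * (∑ i : Fin 3, ∑ z, ∑ x, ∑ x', (f x * f x' * (θ i (z - x) * θ i (z - x'))) * M)
        + ε⁻¹ * ∑ z, ∑ x, ∑ x', (f x * f x' * (ρ (z - x) * ρ (z - x'))) * M)) := by
      refine Bd.smul _ (by norm_num) (Bd.add (Bd.smul _ (by positivity) (Bd.sum fun i => Bd.sum fun z => Bd.sum fun x => Bd.sum fun x' =>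
          Bd.smul _ (mul_nonneg (mul_nonneg (hf _) (hf _)) (mul_nonneg (h01 _ _) (h01 _ _))) ?_))
        (Bd.smul _ (by positivity) (Bd.sum fun z => Bd.sum fun x => Bd.sum fun x' =>
          Bd.smul _ (mul_nonneg (mul_nonneg (hf _) (hf _)) (mul_nonneg (h02 _) (h02 _))) ?_)))
      · exact Bd4 (by fun_prop) (by fun_prop) (by fun_prop) (by fun_prop) (fun t => (Real.exp_pos _).le) (fun t => (Real.exp_pos _).le)
          (fun t => (Real.exp_pos _).le) (fun t => (Real.exp_pos _).le) (hmom _).2 (hmom _).2 (hmom _).1 (hmom _).1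
      · exact Bd4 (by fun_prop) (by fun_prop) (by fun_prop) (by fun_prop) (fun t => (Real.exp_pos _).le) (fun t => (Real.exp_pos _).le)
          (fun t => (Real.exp_pos _).le) (fun t => zero_le_one) (hmom _).2 (hmom _).2 (hmom _).1 bone
    refine (integral_mono hintg bG.1 fun t => ?_).trans (bG.2.trans ?_)
    · refine (thomson hβ0 hε h1 θ ρ hfl t _).trans (le_of_eq ?_)
      simp only [sq_expand f (fun x => Real.exp (t x)), mul_one, sub_eq_add_neg, Real.exp_add]
    · simp only [← Finset.sum_mul]
      have q1 : ∀ i, ∑ z, ∑ x, ∑ x', f x * f x' * (θ i (z - x) * θ i (z - x')) ≤ C * κ := fun i =>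
        swap_bound f k hf (fun z x x' => θ i (z - x) * θ i (z - x')) (ha1 i)
      have q2 : ∑ z, ∑ x, ∑ x', f x * f x' * (ρ (z - x) * ρ (z - x')) ≤ (ε * C) * κ :=
        swap_bound f k hf (fun z x x' => ρ (z - x) * ρ (z - x')) (fun x x' => by rw [mul_assoc]; exact ha2 x x')
      have q3 : ∑ i : Fin 3, ∑ z, ∑ x, ∑ x', f x * f x' * (θ i (z - x) * θ i (z - x')) ≤ 3 * (C * κ) := by
        rw [Fin.sum_univ_three]; linarith [q1 0, q1 1, q1 2]
      have hCκ : 0 ≤ C * κ := mul_nonneg (by linarith) hκ0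
      have q4 : β⁻¹ * (∑ i : Fin 3, ∑ z, ∑ x, ∑ x', f x * f x' * (θ i (z - x) * θ i (z - x'))) ≤ 3 * (C * κ) := by
        rw [inv_mul_le_iff₀ hβ0]; nlinarith
      have q5 : ε⁻¹ * (∑ z, ∑ x, ∑ x', f x * f x' * (ρ (z - x) * ρ (z - x'))) ≤ C * κ := by
        rw [inv_mul_le_iff₀ hε]; linarith
      have q6 := mul_le_mul_of_nonneg_right (add_le_add q4 q5) (by linarith : 0 ≤ M)
      linarith
  -- step 2: kappa against the free Green function
  have s2 : κ ≤ 4 * β * C * (f ⬝ᵥ (Dmat β (ε/2) (fun _ : Torus L => 0))⁻¹ *ᵥ f) := by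
    set A := Dmat β (ε/2) (fun _ : Torus L => 0) with hA
    have hAp : A.PosDef := Dmat_posDef hβ0.le (by linarith) _
    set u : Torus L → ℝ := fun z => ∑ x, f x * k (z - x) with hu
    have huf : u ⬝ᵥ f = κ := by
      simp only [dotProduct, hu, Finset.sum_mul, hκ]
      rw [Finset.sum_comm]
      exact Finset.sum_congr rfl fun x _ => Finset.sum_congr rfl fun x' _ => by ring
    have huA : u ⬝ᵥ A *ᵥ u ≤ 4 * β * C * κ := by
      refine (quad_upper hβ0.le _ u).trans ?_
      simp only [Real.exp_zero, one_mul]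
      have e1 : ∀ i : Fin 3, ∑ z, (u z - u (z + unitVec L i))^2 ≤ C * κ := by
        intro i
        refine le_trans ?_ (swap_bound f k hf (fun z x x' => |k (z + unitVec L i - x) - k (z - x)| * |k (z + unitVec L i - x') - k (z - x')|) (hb1 i))
        refine Finset.sum_le_sum fun z _ => ?_
        have := sq_expand f (fun _ => 1) (fun x => k (z + unitVec L i - x) - k (z - x)) 1
        have e : u z - u (z + unitVec L i) = - ∑ x, f x * 1 * (k (z + unitVec L i - x) - k (z - x)) := by
          simp only [hu, mul_one, mul_sub, Finset.sum_sub_distrib]; ring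
        rw [e, neg_sq, ← mul_one ((_:ℝ)^2), this]
        refine Finset.sum_le_sum fun x _ => Finset.sum_le_sum fun x' _ => ?_
        rw [mul_one, mul_one, mul_one, ← abs_mul]
        exact mul_le_mul_of_nonneg_left (le_abs_self _) (mul_nonneg (hf _) (hf _))
      have e2 : ε * ∑ z, (u z)^2 ≤ C * κ := by
        have := swap_bound f k hf (fun z x x' => ε * (k (z - x) * k (z - x'))) (fun x x' => by rw [← Finset.mul_sum]; exact hb2 x x')
        refine le_trans (le_of_eq ?_) this
        rw [Finset.mul_sum]
        refine Finset.sum_congr rfl fun z _ => ?_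
        have := sq_expand f (fun _ => 1) (fun x => k (z - x)) ε
        simp only [mul_one, one_mul] at this
        rw [mul_comm, this]
        exact Finset.sum_congr rfl fun x _ => Finset.sum_congr rfl fun x' _ => by ring
      have e3 : 0 ≤ ∑ z, (u z)^2 := Finset.sum_nonneg fun z _ => sq_nonneg _
      have hCκ : 0 ≤ C * κ := mul_nonneg (by linarith) hκ0
      have e4 : ∑ i : Fin 3, ∑ z, (u z - u (z + unitVec L i))^2 ≤ 3 * (C * κ) := by
        rw [Fin.sum_univ_three]; linarith [e1 0, e1 1, e1 2]
      have e5 := mul_le_mul_of_nonneg_left e4 hβ0.le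
      have e6 : ε / 2 * ∑ z, (u z)^2 ≤ C * κ := by nlinarith
      nlinarith
    have hinv := inv_lower hAp f ((4 * β * C)⁻¹ • u)
    have hp : 0 < 4 * β * C := by positivity
    rw [smul_dotProduct, huf, smul_dotProduct, mulVec_smul, dotProduct_smul] at hinv
    simp only [smul_eq_mul] at hinv
    have h3 : (4 * β * C)⁻¹ * (u ⬝ᵥ A *ᵥ u) ≤ κ := by rw [inv_mul_le_iff₀ hp]; exact huA
    have h4 := mul_le_mul_of_nonneg_left h3 (inv_nonneg.2 hp.le)
    have h5 : (4 * β * C)⁻¹ * κ ≤ f ⬝ᵥ A⁻¹ *ᵥ f := by linarith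
    rwa [inv_mul_le_iff₀ hp] at h5
  have h8 : 0 ≤ 8 * M * C := by positivity
  calc _ ≤ 8 * M * C * κ := s1
    _ ≤ 8 * M * C * (4 * β * C * (f ⬝ᵥ (Dmat β (ε/2) (fun _ : Torus L => 0))⁻¹ *ᵥ f)) := mul_le_mul_of_nonneg_left s2 h8
    _ = _ := by ring

lemma lower {M β ε : ℝ} (hM : 1 ≤ M) (hβ : 0 < β) (hε : 0 < ε) (h1 : (1 : ZMod L) ≠ 0)
    (hmom : ∀ y : Torus L, Bd (mu L β ε) (fun t => Real.exp (-t y)^4) M ∧ Bd (mu L β ε) (fun t => Real.exp (t y)^4) M)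
    (f g : Torus L → ℝ) (hg : ∀ j, 0 ≤ g j) (hgf : ∀ j, g j ≤ f j) :
    (1 / M) * (g ⬝ᵥ (Dmat β ε (fun _ : Torus L => 0))⁻¹ *ᵥ g) ≤ ∑ i, ∑ j, corr β ε i j * f i * f j := by
  have hpr := mu_prob (L := L) hβ.le hε
  have bone : Bd (mu L β ε) (fun _ => (1:ℝ)^4) M := (Bd.const _).le (by simpa using hM)
  set A := Dmat β ε (fun _ : Torus L => 0) with hA
  have hAp : A.PosDef := Dmat_posDef hβ.le hε _
  have hAu : IsUnit A.det := (Matrix.isUnit_iff_isUnit_det _).1 hAp.isUnit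
  set φ := A⁻¹ *ᵥ g with hφ
  have hAφ : A *ᵥ φ = g := by
    rw [hφ, mulVec_mulVec, Matrix.mul_nonsing_inv _ hAu, one_mulVec]
  have hφ0 : ∀ i, 0 ≤ φ i := by
    refine pos_of_mulVec_nonneg A hAp (fun i j hij => ?_) φ (fun i => by rw [hAφ]; exact hg i)
    simp only [hA, Dmat, Matrix.of_apply, hij, if_false]
    split_ifs
    · have := mul_pos hβ (Real.exp_pos ((0:ℝ) + 0)); linarith
    · exact le_rfl
  set Q := g ⬝ᵥ φ with hQ
  have hQ2 : φ ⬝ᵥ A *ᵥ φ = Q := by rw [hAφ, dotProduct_comm]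
  have hQf : Q ≤ φ ⬝ᵥ f := by
    rw [hQ, dotProduct_comm]
    exact Finset.sum_le_sum fun i _ => mul_le_mul_of_nonneg_left (hgf i) (hφ0 i)
  obtain ⟨hintg, heq⟩ := corr_sum hβ hε h1 f
  rw [heq]
  have hie : ∀ y : Torus L, Integrable (fun t : Torus L → ℝ => Real.exp (t y)) (mu L β ε) := fun y => by
    simpa using int_pos_of hβ.le hε y 1 (by norm_num) (by norm_num)
  have bD : Bd (mu L β ε) (fun t => φ ⬝ᵥ Dmat β ε t *ᵥ φ) (M * Q) := by
    have b : Bd (mu L β ε) (fun t => (1/2) * (∑ j, ∑ k, (if NN j k then β * (φ j - φ k)^2 else 0) * (Real.exp (t j) * Real.exp (t k) * (1 * 1)))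
       + ∑ j, (ε * (φ j)^2) * (Real.exp (t j) * 1 * (1 * 1)))
       ((1/2) * (∑ j, ∑ k, (if NN j k then β * (φ j - φ k)^2 else 0) * M) + ∑ j, (ε * (φ j)^2) * M) := by
      refine Bd.add (Bd.smul _ (by norm_num) (Bd.sum fun j => Bd.sum fun k => Bd.smul _ ?_ ?_)) (Bd.sum fun j => Bd.smul _ (by positivity) ?_)
      · split_ifs <;> positivity
      · exact Bd4 (by fun_prop) (by fun_prop) (by fun_prop) (by fun_prop) (fun t => (Real.exp_pos _).le) (fun t => (Real.exp_pos _).le)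
          (fun t => zero_le_one) (fun t => zero_le_one) (hmom _).2 (hmom _).2 bone bone
      · exact Bd4 (by fun_prop) (by fun_prop) (by fun_prop) (by fun_prop) (fun t => (Real.exp_pos _).le) (fun t => zero_le_one)
          (fun t => zero_le_one) (fun t => zero_le_one) (hmom _).2 bone bone bone
    have e1 : (fun t => φ ⬝ᵥ Dmat β ε t *ᵥ φ) = (fun t => (1/2) * (∑ j, ∑ k, (if NN j k then β * (φ j - φ k)^2 else 0) * (Real.exp (t j) * Real.exp (t k) * (1 * 1)))
       + ∑ j, (ε * (φ j)^2) * (Real.exp (t j) * 1 * (1 * 1))) := by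
      ext t
      rw [Dmat_quad]
      congr 1
      · congr 1
        refine Finset.sum_congr rfl fun j _ => Finset.sum_congr rfl fun k _ => ?_
        split_ifs <;> ring
      · exact Finset.sum_congr rfl fun j _ => by ring
    rw [e1]
    refine b.le (le_of_eq ?_)
    rw [← hQ2, hA, Dmat_quad]
    simp only [Real.exp_zero, mul_one, ← Finset.sum_mul]
    ring
  have hM0 : 0 < M := by linarith
  have bi : Integrable (fun t : Torus L → ℝ => φ ⬝ᵥ (fun x => f x * Real.exp (t x))) (mu L β ε) := by
    simp only [dotProduct]
    exact integrable_finsetSum _ fun i _ => ((hie i).const_mul _).const_mul _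
  have be : ∫ t, φ ⬝ᵥ (fun x => f x * Real.exp (t x)) ∂(mu L β ε) = φ ⬝ᵥ f := by
    simp only [dotProduct]
    rw [integral_finsetSum _ fun i _ => ((hie i).const_mul _).const_mul _]
    refine Finset.sum_congr rfl fun i _ => ?_
    rw [integral_const_mul, integral_const_mul, exp_one_eq hβ.le hε, mul_one]
  have hmono : ∫ t, (2 * M⁻¹ * (φ ⬝ᵥ (fun x => f x * Real.exp (t x))) - M⁻¹^2 * (φ ⬝ᵥ Dmat β ε t *ᵥ φ)) ∂(mu L β ε) ≤ _ :=
    integral_mono ((bi.const_mul _).sub (bD.1.const_mul _)) hintg fun t => by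
      have := inv_lower (Dmat_posDef hβ.le hε t) (fun x => f x * Real.exp (t x)) (M⁻¹ • φ)
      rw [smul_dotProduct, smul_dotProduct, mulVec_smul, dotProduct_smul] at this
      simp only [smul_eq_mul] at this
      refine le_trans (le_of_eq ?_) this
      ring
  refine le_trans ?_ hmono
  rw [integral_sub (bi.const_mul _) (bD.1.const_mul _), integral_const_mul, integral_const_mul, be]
  have h3 := mul_le_mul_of_nonneg_left bD.2 (by positivity : 0 ≤ M⁻¹^2)
  have h4 : M⁻¹^2 * (M * Q) = M⁻¹ * Q := by field_simp
  have h5 := mul_le_mul_of_nonneg_left hQf (by positivity : 0 ≤ 2 * M⁻¹)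
  rw [one_div]
  linarith

end final
end QD

/-- **Theorem 3 (quasi-diffusive bounds).** There is `β̄ ≥ 1` such that for `β ≥ β̄` and
`1/ln β ≤ α < 1/2` there exist constants `K, K' > 0` such that for all torus sides `L ≥ 2`
and `ε > 0` with `ε L^{3-α} ≥ 1`, all nonnegative `f` and every site `x`:
`(1/K') [f̃; G₀ f̃] ≤ [f; C f] ≤ K [f; G̃₀ f]`, where `f̃(j) = (1+|j-x|^α)⁻¹ f(j)`,
`G₀ = (-βΔ + ε)⁻¹` and `G̃₀ = (-βΔ + ε/2)⁻¹`. -/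
theorem quasi_diffusion :
    ∃ βbar : ℝ, 1 ≤ βbar ∧
      ∀ β : ℝ, βbar ≤ β → ∀ α : ℝ, 1 / Real.log β ≤ α → α < 1 / 2 →
        ∃ K K' : ℝ, 0 < K ∧ 0 < K' ∧
          ∀ L : ℕ, ∀ ε : ℝ, 0 < ε → 1 ≤ ε * ((L + 2 : ℕ) : ℝ) ^ ((3 : ℝ) - α) →
            ∀ f : Torus (L + 2) → ℝ, (∀ j, 0 ≤ f j) → ∀ x : Torus (L + 2),
              (1 / K') * qform ((-β) • lap (L + 2) +
                    ε • (1 : Matrix (Torus (L + 2)) (Torus (L + 2)) ℝ))⁻¹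
                  (fun j => (1 + torusDist j x ^ α)⁻¹ * f j)
                  (fun j => (1 + torusDist j x ^ α)⁻¹ * f j) ≤
                ∑ i : Torus (L + 2), ∑ j : Torus (L + 2), corr β ε i j * f i * f j ∧
              ∑ i : Torus (L + 2), ∑ j : Torus (L + 2), corr β ε i j * f i * f j ≤
                K * qform ((-β) • lap (L + 2) +
                    (ε / 2) • (1 : Matrix (Torus (L + 2)) (Torus (L + 2)) ℝ))⁻¹ f f := by
  obtain ⟨C, hC, M, hM, H⟩ := QD.moments
  refine ⟨168 * C^2 + 2, by nlinarith, fun β hβ α hα _ => ?_⟩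
  have hC2 : 0 ≤ C^2 := sq_nonneg C
  have hβ2 : 2 ≤ β := by linarith
  have hα0 : 0 < α := lt_of_lt_of_le (one_div_pos.2 (Real.log_pos (by linarith))) hα
  refine ⟨32 * β * M * C^2, M, by positivity, by linarith, fun L ε hε hL f hf x => ?_⟩
  have h1 : (1 : ZMod (L + 2)) ≠ 0 := by
    have : Fact (1 < L + 2) := ⟨by omega⟩
    exact one_ne_zero
  have hL3 : 1 ≤ ε * ((L + 2 : ℕ) : ℝ)^3 := by
    refine hL.trans (mul_le_mul_of_nonneg_left ?_ hε.le)
    rw [← Real.rpow_natCast]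
    exact Real.rpow_le_rpow_of_exponent_le (by exact_mod_cast (by omega : 1 ≤ L + 2)) (by push_cast; linarith)
  obtain ⟨hmom, θ, ρ, k, h01, h02, h03, hk, hfl, ha1, ha2, hb1, hb2⟩ := H (L + 2) β ε h1 (by linarith) hε hL3
  rw [QD.lap_eq, QD.lap_eq, QD.qform_eq, QD.qform_eq]
  refine ⟨?_, QD.upper hC hM (by linarith) hε h1 hmom θ ρ k h01 h02 hk hfl ha1 ha2 hb1 hb2 h03 f hf⟩
  have hd : ∀ j, 1 ≤ 1 + torusDist j x ^ α := fun j => by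
    have hj : 0 ≤ torusDist j x := Real.sqrt_nonneg _
    have := Real.rpow_nonneg hj α
    linarith
  refine QD.lower hM (by linarith) hε h1 hmom f _ (fun j => mul_nonneg (inv_nonneg.2 (by linarith [hd j])) (hf j)) fun j => ?_
  exact mul_le_of_le_one_left (hf j) (inv_le_one_of_one_le₀ (hd j))

end
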